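/- arXiv:2605.00795 — 3 statements merged into one kernel-verified Lean document; each statement's English description precedes it below -/
import Mathlib

section
/- Let n ≥ 2 be an integer, let γ > n be real, 1 < p < n, and let 1 < r < p(1+(n-2)γ)/((γ-p)(n-1)). Then there exists a constant C > 0 such that for every continuously differentiable function u : ℝ^n → ℝ one has (∫_{∂Ω_γ} |u(x)|^r dH^{n-1}(x))^{1/r} ≤ C · ( (∫_{Ω_γ} |∇u(x)|^p dx)^{1/p} + (∫_{Ω_γ} |u(x)|^p dx)^{1/p} ). (This is the unweighted trace inequality of the Corollary, stated on the dense class of C¹ functions.) -/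
open MeasureTheory ENNReal

noncomputable section

/-- The outward `γ`-cuspidal domain
`Ω_γ = {x ∈ ℝⁿ : 0 < x_n < 1, 0 < x_i < x_n^α for i = 1,…,n-1}`, `α = (γ-1)/(n-1)`. -/
def cuspDomain (n : ℕ) (hn : 2 ≤ n) (γ : ℝ) : Set (EuclideanSpace ℝ (Fin n)) :=
  {x | 0 < x ⟨n - 1, by omega⟩ ∧ x ⟨n - 1, by omega⟩ < 1 ∧
    ∀ i : Fin n, (i : ℕ) < n - 1 →
      0 < x i ∧ x i < x ⟨n - 1, by omega⟩ ^ ((γ - 1) / ((n : ℝ) - 1))}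

section Part1


def lam : Measure ℝ := volume.restrict (Set.Icc 0 1)

def PP (ι : Type*) [Fintype ι] : Measure (ι → ℝ) := Measure.pi fun _ => lam

instance : IsProbabilityMeasure lam := ⟨by simp [lam]⟩

instance (ι : Type*) [Fintype ι] : IsProbabilityMeasure (PP ι) := by
  unfold PP; infer_instance

lemma PP_eq (ι : Type*) [Fintype ι] :
    PP ι = (volume : Measure (ι → ℝ)).restrict (Set.univ.pi fun _ => Set.Icc (0:ℝ) 1) := by
  rw [volume_pi, Measure.restrict_pi_pi]; rfl

lemma PP_eq' (ι : Type*) [Fintype ι] :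
    PP ι = (volume : Measure (ι → ℝ)).restrict (Set.univ.pi fun _ => Set.Ioo (0:ℝ) 1) := by
  rw [volume_pi, Measure.restrict_pi_pi]
  simp only [PP, lam, Measure.restrict_congr_set Ioo_ae_eq_Icc]

lemma PP_ae (ι : Type*) [Fintype ι] : ∀ᵐ x ∂(PP ι), ∀ i, x i ∈ Set.Ioo (0:ℝ) 1 := by
  rw [PP_eq']
  filter_upwards [ae_restrict_mem (MeasurableSet.univ_pi fun _ => measurableSet_Ioo)] with x hx i
  exact hx i (Set.mem_univ i)

lemma mp_eval {ι : Type*} [Fintype ι] (i : ι) :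
    MeasurePreserving (Function.eval i) (PP ι) lam := measurePreserving_eval (fun _ : ι => lam) i

lemma mp_piecewise {ι : Type*} [Fintype ι] [DecidableEq ι] (s : Finset ι) :
    MeasurePreserving (fun q : (ι → ℝ) × (ι → ℝ) => s.piecewise q.1 q.2)
      ((PP ι).prod (PP ι)) (PP ι) := by
  have h1 := (measurePreserving_arrowProdEquivProdArrow ℝ ℝ ι (fun _ => lam) (fun _ => lam)).symm
  have h2 := measurePreserving_pi (fun _ : ι => lam.prod lam) (fun _ : ι => lam)
    (f := fun i => if i ∈ s then Prod.fst else Prod.snd) (fun i => by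
      split_ifs
      · exact measurePreserving_fst
      · exact measurePreserving_snd)
  have := h2.comp h1
  have e : (fun q : (ι → ℝ) × (ι → ℝ) => s.piecewise q.1 q.2) =
    ((fun (a : ι → ℝ × ℝ) i => (if i ∈ s then Prod.fst else Prod.snd) (a i)) ∘
      (MeasurableEquiv.arrowProdEquivProdArrow ℝ ℝ ι).symm) := by
    ext q i
    simp only [Finset.piecewise, Function.comp]
    split_ifs <;> rfl
  rw [e]
  exact this

lemma lintegral_piecewise {ι : Type*} [Fintype ι] [DecidableEq ι] (s : Finset ι)
    {f : (ι → ℝ) → ℝ≥0∞} (hf : Measurable f) :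
    ∫⁻ x, ∫⁻ z, f (s.piecewise x z) ∂(PP ι) ∂(PP ι) = ∫⁻ x, f x ∂(PP ι) := by
  rw [← (mp_piecewise s).lintegral_comp hf, lintegral_prod]
  exact (hf.comp (mp_piecewise s).measurable).aemeasurable

lemma lintegral_piecewise' {ι : Type*} [Fintype ι] [DecidableEq ι] (s : Finset ι)
    {f : (ι → ℝ) → ℝ≥0∞} (hf : Measurable f) :
    ∫⁻ x, ∫⁻ z, f (s.piecewise z x) ∂(PP ι) ∂(PP ι) = ∫⁻ x, f x ∂(PP ι) := by
  rw [← (mp_piecewise s).lintegral_comp hf, lintegral_prod_symm]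
  exact (hf.comp (mp_piecewise s).measurable).aemeasurable

lemma lintegral_upd_eval {ι : Type*} [Fintype ι] [DecidableEq ι] (i : ι)
    {f : (ι → ℝ) → ℝ≥0∞} (hf : Measurable f) (x : ι → ℝ) :
    ∫⁻ ξ, f (Function.update x i ξ) ∂lam = ∫⁻ z, f (Function.update x i (z i)) ∂(PP ι) := by
  have := (mp_eval i).lintegral_comp (f := fun ξ => f (Function.update x i ξ))
    (hf.comp (measurable_update x))
  rw [← this]

lemma lintegral_upd {ι : Type*} [Fintype ι] [DecidableEq ι] (i : ι)
    {f : (ι → ℝ) → ℝ≥0∞} (hf : Measurable f) :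
    ∫⁻ x, ∫⁻ ξ, f (Function.update x i ξ) ∂lam ∂(PP ι) = ∫⁻ x, f x ∂(PP ι) := by
  rw [← lintegral_piecewise' {i} hf]
  refine lintegral_congr fun x => ?_
  rw [lintegral_upd_eval i hf]
  refine lintegral_congr fun z => ?_
  rw [Finset.piecewise_singleton]

lemma lintegral_updlast {ι : Type*} [Fintype ι] [DecidableEq ι] (i : ι)
    {f : (ι → ℝ) → ℝ≥0∞} (hf : Measurable f) :
    ∫⁻ x, ∫⁻ z, f (Function.update z i (x i)) ∂(PP ι) ∂(PP ι) = ∫⁻ x, f x ∂(PP ι) := by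
  rw [← lintegral_piecewise {i} hf]
  refine lintegral_congr fun x => ?_
  refine lintegral_congr fun z => ?_
  rw [Finset.piecewise_singleton]

lemma jensen_ge {X : Type*} [MeasurableSpace X] (ν : Measure X) [IsProbabilityMeasure ν]
    {p : ℝ} (hp : 1 ≤ p) {f : X → ℝ≥0∞} (hf : AEMeasurable f ν) :
    (∫⁻ x, f x ∂ν) ^ p ≤ ∫⁻ x, f x ^ p ∂ν := by
  rcases hp.eq_or_lt with rfl | hp
  · simp
  have h := ENNReal.lintegral_mul_le_Lp_mul_Lq ν (Real.HolderConjugate.conjExponent hp) hf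
    (aemeasurable_const (b := (1:ℝ≥0∞)))
  simp only [Pi.mul_apply, mul_one, ENNReal.one_rpow, lintegral_const, measure_univ] at h
  calc _ ≤ ((∫⁻ x, f x ^ p ∂ν) ^ (1/p)) ^ p := by gcongr
    _ = _ := by rw [← ENNReal.rpow_mul]; simp [show p ≠ 0 by positivity]

lemma jensen_le {X : Type*} [MeasurableSpace X] (ν : Measure X) [IsProbabilityMeasure ν]
    {p : ℝ} (hp0 : 0 < p) (hp : p ≤ 1) {f : X → ℝ≥0∞} (hf : AEMeasurable f ν) :
    ∫⁻ x, f x ^ p ∂ν ≤ (∫⁻ x, f x ∂ν) ^ p := by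
  have h := jensen_ge ν (p := 1/p) (by rw [le_div_iff₀ hp0]; linarith) (hf.pow_const p)
  simp only [← ENNReal.rpow_mul] at h
  rw [mul_one_div_cancel hp0.ne'] at h
  simp only [ENNReal.rpow_one] at h
  calc _ = ((∫⁻ x, f x ^ p ∂ν) ^ (1/p)) ^ p := by rw [← ENNReal.rpow_mul]; simp [hp0.ne']
    _ ≤ _ := by gcongr

lemma sub_le_line {φ h : ℝ → ℝ} {c : ℝ} 
    (hφ : ContinuousOn φ (Set.Icc c 1)) (hh : ContinuousOn h (Set.Icc c 1))
    (h0 : ∀ ξ ∈ Set.Icc c 1, 0 ≤ h ξ)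
    (hd : ∀ ξ ∈ Set.Ioo c 1, DifferentiableAt ℝ φ ξ) (hb : ∀ ξ ∈ Set.Ioo c 1, |deriv φ ξ| ≤ h ξ)
    {a b : ℝ} (ha : a ∈ Set.Icc c 1) (hb' : b ∈ Set.Icc c 1) :
    |φ a - φ b| ≤ ∫ ξ in Set.Icc c 1, h ξ := by
  wlog hab : b ≤ a generalizing a b
  · rw [abs_sub_comm]; exact this hb' ha (le_of_not_ge hab)
  have hsub : Set.Icc b a ⊆ Set.Icc c 1 := Set.Icc_subset_Icc hb'.1 ha.2
  have hsub' : Set.Ioo b a ⊆ Set.Ioo c 1 := Set.Ioo_subset_Ioo hb'.1 ha.2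
  have hi : IntegrableOn h (Set.Icc c 1) := hh.integrableOn_compact isCompact_Icc
  have := norm_sub_le_integral_of_norm_deriv_le_of_le (f := φ) (B := h) hab (hφ.mono hsub)
    (fun x hx => (hd x (hsub' hx)).differentiableWithinAt)
    (Filter.Eventually.of_forall fun t ht => hb t (hsub' ht))
    ((hh.mono (by rwa [Set.uIcc_of_le hab])).intervalIntegrable)
  rw [Real.norm_eq_abs] at this
  refine this.trans ?_
  rw [intervalIntegral.integral_of_le hab]
  exact setIntegral_mono_set hi ((ae_restrict_iff' measurableSet_Icc).2
    (Filter.Eventually.of_forall h0))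
    (Filter.Eventually.of_forall (Set.Ioc_subset_Icc_self.trans hsub))

lemma line1 {φ h : ℝ → ℝ}
    (hφ : ContinuousOn φ (Set.Icc 0 1)) (hh : ContinuousOn h (Set.Icc 0 1))
    (h0 : ∀ ξ ∈ Set.Icc (0:ℝ) 1, 0 ≤ h ξ)
    (hd : ∀ ξ ∈ Set.Ioo (0:ℝ) 1, DifferentiableAt ℝ φ ξ)
    (hb : ∀ ξ ∈ Set.Ioo (0:ℝ) 1, |deriv φ ξ| ≤ h ξ)
    {a : ℝ} (ha : a ∈ Set.Icc (0:ℝ) 1) :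
    ENNReal.ofReal |φ a| ≤ ∫⁻ ξ, ENNReal.ofReal (|φ ξ| + h ξ) ∂lam := by
  have hi : IntegrableOn h (Set.Icc 0 1) := hh.integrableOn_compact isCompact_Icc
  have hi2 : IntegrableOn (fun ξ => |φ ξ|) (Set.Icc 0 1) := 
    (hφ.abs).integrableOn_compact isCompact_Icc
  rw [lam, ← ofReal_integral_eq_lintegral_ofReal (f := fun ξ => |φ ξ| + h ξ) (hi2.add hi)]
  · apply ENNReal.ofReal_le_ofReal
    rw [integral_add hi2 hi]
    set J := ∫ ξ in Set.Icc (0:ℝ) 1, h ξ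
    have : ∫ ξ in Set.Icc (0:ℝ) 1, (|φ a| - J) ≤ ∫ ξ in Set.Icc (0:ℝ) 1, |φ ξ| := by
      refine setIntegral_mono_on (by simp [integrableOn_const_iff]) hi2 measurableSet_Icc ?_
      intro ξ hξ
      have := sub_le_line hφ hh h0 hd hb ha hξ
      have h2 := abs_sub_abs_le_abs_sub (φ a) (φ ξ)
      linarith
    simp at this
    linarith
  · rw [Filter.EventuallyLE, ae_restrict_iff' measurableSet_Icc]
    exact Filter.Eventually.of_forall fun ξ hξ => add_nonneg (abs_nonneg _) (h0 ξ hξ)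

lemma diff_line {φ h : ℝ → ℝ}
    (hφ : ContinuousOn φ (Set.Icc 0 1)) (hh : ContinuousOn h (Set.Icc 0 1))
    (h0 : ∀ ξ ∈ Set.Icc (0:ℝ) 1, 0 ≤ h ξ)
    (hd : ∀ ξ ∈ Set.Ioo (0:ℝ) 1, DifferentiableAt ℝ φ ξ)
    (hb : ∀ ξ ∈ Set.Ioo (0:ℝ) 1, |deriv φ ξ| ≤ h ξ)
    {a b : ℝ} (ha : a ∈ Set.Icc (0:ℝ) 1) (hb' : b ∈ Set.Icc (0:ℝ) 1) :
    ENNReal.ofReal |φ a - φ b| ≤ ∫⁻ ξ, ENNReal.ofReal (h ξ) ∂lam := by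
  have hi : IntegrableOn h (Set.Icc 0 1) := hh.integrableOn_compact isCompact_Icc
  rw [lam, ← ofReal_integral_eq_lintegral_ofReal hi]
  · exact ENNReal.ofReal_le_ofReal (sub_le_line hφ hh h0 hd hb ha hb')
  · rw [Filter.EventuallyLE, ae_restrict_iff' measurableSet_Icc]
    exact Filter.Eventually.of_forall fun ξ hξ => h0 ξ hξ
end Part1

section Part2

set_option linter.unusedSectionVars false

structure Core {ι : Type} [Fintype ι] [DecidableEq ι] (l : ι) (α K : ℝ)
    (v G : (ι → ℝ) → ℝ) : Prop where
  hv : Continuous v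
  hG : Continuous G
  hG0 : ∀ x, 0 ≤ G x
  hK : 0 ≤ K
  d : ∀ x : ι → ℝ, (∀ i, x i ∈ Set.Icc (0:ℝ) 1) → 0 < x l → ∀ i,
    DifferentiableAt ℝ (fun ξ => v (Function.update x i ξ)) (x i)
  b1 : ∀ x : ι → ℝ, (∀ i, x i ∈ Set.Icc (0:ℝ) 1) → 0 < x l → ∀ i, i ≠ l →
    |deriv (fun ξ => v (Function.update x i ξ)) (x i)| ≤ x l ^ α * G x
  b2 : ∀ x : ι → ℝ, (∀ i, x i ∈ Set.Icc (0:ℝ) 1) → 0 < x l →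
    |deriv (fun ξ => v (Function.update x l ξ)) (x l)| ≤ K * G x

variable {ι : Type} [Fintype ι] [DecidableEq ι]

def vb (v : (ι → ℝ) → ℝ) (l : ι) (t : ℝ) : ℝ := ∫ z, v (Function.update z l t) ∂(PP ι)

lemma cube_compact : IsCompact (Set.univ.pi fun _ : ι => Set.Icc (0:ℝ) 1) :=
  isCompact_univ_pi fun _ => isCompact_Icc

lemma cont_upd {v : (ι → ℝ) → ℝ} (hv : Continuous v) (l : ι) :
    Continuous (fun q : ℝ × (ι → ℝ) => v (Function.update q.2 l q.1)) :=
  hv.comp (continuous_snd.update l continuous_fst)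

lemma vb_cont {v : (ι → ℝ) → ℝ} (hv : Continuous v) (l : ι) : Continuous (vb v l) := by
  unfold vb
  rw [PP_eq]
  exact continuous_parametric_integral_of_continuous
    (f := fun t z => v (Function.update z l t)) (cont_upd hv l) cube_compact

lemma int_cont {v : (ι → ℝ) → ℝ} (hv : Continuous v) : Integrable v (PP ι) := by
  rw [PP_eq]
  exact hv.continuousOn.integrableOn_compact cube_compact

lemma upd_cube {x : ι → ℝ} (hx : ∀ i, x i ∈ Set.Icc (0:ℝ) 1) (i : ι) {ξ : ℝ}
    (hξ : ξ ∈ Set.Icc (0:ℝ) 1) : ∀ j, Function.update x i ξ j ∈ Set.Icc (0:ℝ) 1 := by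
  intro j
  by_cases h : j = i
  · subst h; simpa using hξ
  · simpa [h] using hx j

lemma vb_nonneg {G : (ι → ℝ) → ℝ} (h : ∀ x, 0 ≤ G x) (l : ι) (t : ℝ) : 0 ≤ vb G l t :=
  integral_nonneg fun _ => h _

variable {l : ι} {α K : ℝ} {v G : (ι → ℝ) → ℝ}

lemma Core.diff (H : Core l α K v G) {x : ι → ℝ} (hx : ∀ i, x i ∈ Set.Icc (0:ℝ) 1) {i : ι} {ξ : ℝ}
    (hξ : ξ ∈ Set.Icc (0:ℝ) 1) (hl : 0 < Function.update x i ξ l) :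
    DifferentiableAt ℝ (fun ξ => v (Function.update x i ξ)) ξ := by
  simpa using H.d (Function.update x i ξ) (upd_cube hx i hξ) hl i

lemma Core.bd1 (H : Core l α K v G) {x : ι → ℝ} (hx : ∀ i, x i ∈ Set.Icc (0:ℝ) 1) {i : ι} {ξ : ℝ}
    (hξ : ξ ∈ Set.Icc (0:ℝ) 1) (hl : 0 < x l) (hi : i ≠ l) :
    |deriv (fun ξ => v (Function.update x i ξ)) ξ| ≤ x l ^ α * G (Function.update x i ξ) := by
  have := H.b1 (Function.update x i ξ) (upd_cube hx i hξ) (by simpa [hi.symm] using hl) i hi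
  simpa [hi.symm] using this

lemma Core.bd2 (H : Core l α K v G) {x : ι → ℝ} (hx : ∀ i, x i ∈ Set.Icc (0:ℝ) 1) {ξ : ℝ}
    (hξ : ξ ∈ Set.Ioc (0:ℝ) 1) :
    |deriv (fun ξ => v (Function.update x l ξ)) ξ| ≤ K * G (Function.update x l ξ) := by
  have := H.b2 (Function.update x l ξ) (upd_cube hx l ⟨hξ.1.le, hξ.2⟩) (by simpa using hξ.1)
  simpa using this

lemma Core.vb_deriv (H : Core l α K v G) {t : ℝ} (ht : t ∈ Set.Ioo (0:ℝ) 1) :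
    DifferentiableAt ℝ (vb v l) t ∧ |deriv (vb v l) t| ≤ K * vb G l t := by
  obtain ⟨M, hM⟩ := (cube_compact (ι := ι)).bddAbove_image H.hG.continuousOn
  have hcube : ∀ᵐ z ∂(PP ι), ∀ i, z i ∈ Set.Icc (0:ℝ) 1 := by
    filter_upwards [PP_ae ι] with z hz i using Set.Ioo_subset_Icc_self (hz i)
  have key := hasDerivAt_integral_of_dominated_loc_of_deriv_le (μ := PP ι) (𝕜 := ℝ)
    (F := fun t z => v (Function.update z l t)) (s := Set.Ioo (0:ℝ) 1) (x₀ := t)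
    (F' := fun t z => deriv (fun ξ => v (Function.update z l ξ)) t) (bound := fun _ => K * M)
    (Ioo_mem_nhds ht.1 ht.2)
    (Filter.Eventually.of_forall fun t =>
      (H.hv.comp (continuous_id.update l continuous_const)).aestronglyMeasurable)
    (int_cont (H.hv.comp (continuous_id.update l continuous_const)))
    (by
      have := measurable_deriv_with_param (𝕜 := ℝ) (F := ℝ)
        (f := fun (z : ι → ℝ) ξ => v (Function.update z l ξ))
        (H.hv.comp (continuous_fst.update l continuous_snd))
      exact (this.comp (measurable_id.prodMk measurable_const)).aestronglyMeasurable)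
    (by
      filter_upwards [hcube] with z hz ξ hξ
      refine (H.bd2 hz ⟨hξ.1, hξ.2.le⟩).trans ?_
      refine mul_le_mul_of_nonneg_left ?_ H.hK
      exact hM ⟨_, fun i _ => upd_cube hz l ⟨hξ.1.le, hξ.2.le⟩ i, rfl⟩)
    (integrable_const _)
    (by
      filter_upwards [hcube] with z hz ξ hξ
      exact (H.diff hz ⟨hξ.1.le, hξ.2.le⟩ (by simpa using hξ.1)).hasDerivAt)
  have hd : HasDerivAt (vb v l) _ t := key.2
  refine ⟨hd.differentiableAt, ?_⟩
  rw [hd.deriv]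
  refine (abs_integral_le_integral_abs).trans ?_
  rw [vb, ← integral_const_mul]
  refine integral_mono_ae key.1.abs ((int_cont
    (H.hG.comp (continuous_id.update l continuous_const))).const_mul K) ?_
  filter_upwards [hcube] with z hz
  exact H.bd2 hz ⟨ht.1, ht.2.le⟩

def ww (v : (ι → ℝ) → ℝ) (l : ι) (x : ι → ℝ) : ℝ := v x - vb v l (x l)

def ff (v G : (ι → ℝ) → ℝ) (l : ι) (β₀ β₁ s : ℝ) (x : ι → ℝ) : ℝ :=
  x l ^ β₀ * |ww v l x| ^ s + x l ^ β₁ * |ww v l x| ^ (s - 1) * (G x + vb G l (x l))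

lemma ww_cont (hv : Continuous v) : Continuous (ww v l) :=
  hv.sub ((vb_cont hv l).comp (continuous_apply l))

lemma ff_cont (hv : Continuous v) (hG : Continuous G) {β₀ β₁ s : ℝ} (h0 : 0 ≤ β₀) (h1 : 0 ≤ β₁)
    (hs : 1 ≤ s) : Continuous (ff v G l β₀ β₁ s) := by
  have a := ww_cont (l := l) hv
  have b := (vb_cont hG l).comp (continuous_apply (A := fun _ => ℝ) l)
  have c := (Real.continuous_rpow_const h0).comp (continuous_apply (A := fun _ => ℝ) l)
  have d := (Real.continuous_rpow_const h1).comp (continuous_apply (A := fun _ => ℝ) l)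
  have e := (Real.continuous_rpow_const (show 0 ≤ s by linarith)).comp a.abs
  have f := (Real.continuous_rpow_const (show 0 ≤ s - 1 by linarith)).comp a.abs
  exact (c.mul e).add ((d.mul f).mul (hG.add b))

lemma abs_deriv_aux (a : ℝ) {s : ℝ} (hs : 1 < s) : |s * |a| ^ (s - 2) * a| = s * |a| ^ (s - 1) := by
  rw [abs_mul, abs_mul, abs_of_pos (by linarith : 0 < s), abs_of_nonneg (by positivity : 0 ≤ |a| ^ (s-2)),
    mul_assoc]
  congr 1
  by_cases h : a = 0
  · subst h; simp [Real.zero_rpow (by linarith : s - 1 ≠ 0)]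
  · have : 0 < |a| := abs_pos.2 h
    rw [show s - 1 = (s - 2) + 1 by ring, Real.rpow_add this, Real.rpow_one]

lemma deriv_abs_rpow_comp {φ : ℝ → ℝ} {ξ s : ℝ} (hs : 1 < s) (h : DifferentiableAt ℝ φ ξ) :
    DifferentiableAt ℝ (fun ξ => |φ ξ| ^ s) ξ ∧
    |deriv (fun ξ => |φ ξ| ^ s) ξ| ≤ s * |φ ξ| ^ (s - 1) * |deriv φ ξ| := by
  have := (hasDerivAt_abs_rpow (φ ξ) hs).comp ξ h.hasDerivAt
  have h2 : HasDerivAt (fun ξ => |φ ξ| ^ s) (s * |φ ξ| ^ (s - 2) * φ ξ * deriv φ ξ) ξ := this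
  refine ⟨h2.differentiableAt, ?_⟩
  rw [h2.deriv, abs_mul, abs_deriv_aux _ hs]

lemma ff_nonneg (hG0 : ∀ x, 0 ≤ G x) (β₀ β₁ s : ℝ) {x : ι → ℝ} (hx : 0 ≤ x l) :
    0 ≤ ff v G l β₀ β₁ s x := by
  have := vb_nonneg hG0 l (x l)
  have := hG0 x
  unfold ff; positivity

lemma lint_mul_aux {f : ℝ → ℝ} {g : ℝ → ℝ} {c : ℝ} (hc : 0 ≤ c)
   (h : ∀ ξ ∈ Set.Icc (0:ℝ) 1, g ξ ≤ c * f ξ) :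
   ∫⁻ ξ, ENNReal.ofReal (g ξ) ∂lam ≤ ENNReal.ofReal c * ∫⁻ ξ, ENNReal.ofReal (f ξ) ∂lam := by
  rw [← lintegral_const_mul' _ _ ENNReal.ofReal_ne_top]
  refine setLIntegral_mono' measurableSet_Icc fun ξ hξ => ?_
  rw [← ENNReal.ofReal_mul hc]
  exact ENNReal.ofReal_le_ofReal (h ξ hξ)

lemma Core.line_side (H : Core l α K v G) {β₀ β₁ s : ℝ} (hβ : β₁ = β₀ + α) (h0 : 0 ≤ β₀)
    (hα : 1 ≤ α) (hs : 1 < s) {x : ι → ℝ} (hx : ∀ i, x i ∈ Set.Icc (0:ℝ) 1) (hl : 0 < x l)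
    {i : ι} (hi : i ≠ l) :
    ENNReal.ofReal (x l ^ β₀ * |ww v l x| ^ s) ≤ ENNReal.ofReal (1 + s) *
      ∫⁻ ξ, ENNReal.ofReal (ff v G l β₀ β₁ s (Function.update x i ξ)) ∂lam := by
  have hupd : Continuous fun ξ : ℝ => Function.update x i ξ :=
    continuous_const.update i continuous_id
  have hx2 : ∀ ξ, Function.update x i ξ l = x l := fun ξ => by simp [hi.symm]
  have hwc := (ww_cont (l := l) H.hv).comp hupd
  have hfc := (ff_cont (l := l) H.hv H.hG h0 (by linarith : 0 ≤ β₁) hs.le).comp hupd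
  have hd : ∀ ξ ∈ Set.Ioo (0:ℝ) 1, DifferentiableAt ℝ
      (fun ξ => ww v l (Function.update x i ξ)) ξ ∧
      deriv (fun ξ => ww v l (Function.update x i ξ)) ξ =
        deriv (fun ξ => v (Function.update x i ξ)) ξ := by
    intro ξ hξ
    simp only [ww, hx2]
    refine ⟨(H.diff hx ⟨hξ.1.le, hξ.2.le⟩ (by simpa [hx2] using hl)).sub_const _, ?_⟩
    rw [deriv_sub_const]
  have hA : (fun ξ => x l ^ β₀ * |ww v l (Function.update x i ξ)| ^ s) (x i) =
      x l ^ β₀ * |ww v l x| ^ s := by simp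
  have hnn : 0 ≤ x l ^ β₀ * |ww v l x| ^ s := by positivity
  rw [← abs_of_nonneg hnn, ← hA]
  refine (line1 (φ := fun ξ => x l ^ β₀ * |ww v l (Function.update x i ξ)| ^ s)
    (h := fun ξ => s * ff v G l β₀ β₁ s (Function.update x i ξ)) ?_ ?_ ?_ ?_ ?_ (hx i)).trans ?_
  · exact (continuous_const.mul
      ((Real.continuous_rpow_const (by linarith)).comp hwc.abs)).continuousOn
  · exact (continuous_const.mul hfc).continuousOn
  · intro ξ _
    exact mul_nonneg (by linarith) (ff_nonneg H.hG0 _ _ _ (by rw [hx2]; exact hl.le))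
  · intro ξ hξ
    exact (deriv_abs_rpow_comp hs (hd ξ hξ).1).1.const_mul _
  · intro ξ hξ
    have h1 := deriv_abs_rpow_comp hs (hd ξ hξ).1
    have h2 := H.bd1 hx ⟨hξ.1.le, hξ.2.le⟩ hl hi
    rw [deriv_const_mul _ h1.1, abs_mul, abs_of_nonneg (by positivity)]
    rw [(hd ξ hξ).2] at h1
    have hvb := vb_nonneg H.hG0 l (x l)
    have hGn := H.hG0 (Function.update x i ξ)
    set A := |ww v l (Function.update x i ξ)|
    have hA0 : 0 ≤ A := abs_nonneg _
    calc _ ≤ x l ^ β₀ * (s * A ^ (s-1) * (x l ^ α * G (Function.update x i ξ))) := by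
          gcongr
          exact h1.2.trans (by gcongr)
      _ = s * (x l ^ β₁ * A ^ (s-1) * G (Function.update x i ξ)) := by
          rw [hβ, Real.rpow_add hl]; ring
      _ ≤ _ := by
          gcongr
          unfold ff
          rw [hx2]
          have : 0 ≤ x l ^ β₀ * A ^ s := by positivity
          have : x l ^ β₁ * A ^ (s - 1) * G (Function.update x i ξ) ≤
            x l ^ β₁ * A ^ (s - 1) * (G (Function.update x i ξ) + vb G l (x l)) := by
            gcongr; linarith
          linarith
  · refine lint_mul_aux (by linarith) fun ξ hξ => ?_
    have hvb := vb_nonneg H.hG0 l (x l)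
    have hGn := H.hG0 (Function.update x i ξ)
    rw [abs_of_nonneg (by positivity), one_add_mul]
    gcongr
    unfold ff
    rw [hx2]
    have : 0 ≤ x l ^ β₁ * |ww v l (Function.update x i ξ)| ^ (s - 1) * (G (Function.update x i ξ) + vb G l (x l)) := by positivity
    linarith

lemma Core.line_top (H : Core l α K v G) {β₀ β₁ s : ℝ} (hβ : β₁ = β₀ + α) (h0 : 0 ≤ β₀)
    (hα : 1 ≤ α) (hs : 1 < s) {x : ι → ℝ} (hx : ∀ i, x i ∈ Set.Icc (0:ℝ) 1) :
    ENNReal.ofReal (x l ^ β₁ * |ww v l x| ^ s) ≤ ENNReal.ofReal (1 + (β₁ + s * K)) *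
      ∫⁻ ξ, ENNReal.ofReal (ff v G l β₀ β₁ s (Function.update x l ξ)) ∂lam := by
  have hupd : Continuous fun ξ : ℝ => Function.update x l ξ :=
    continuous_const.update l continuous_id
  have hβ1 : 1 ≤ β₁ := by linarith
  have hK := H.hK
  have hx2 : ∀ ξ, Function.update x l ξ l = ξ := fun ξ => by simp
  have hwc := (ww_cont (l := l) H.hv).comp hupd
  have hfc := (ff_cont (l := l) H.hv H.hG h0 (by linarith : 0 ≤ β₁) hs.le).comp hupd
  have hd : ∀ ξ ∈ Set.Ioo (0:ℝ) 1, DifferentiableAt ℝ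
      (fun ξ => ww v l (Function.update x l ξ)) ξ ∧
      |deriv (fun ξ => ww v l (Function.update x l ξ)) ξ| ≤
        K * (G (Function.update x l ξ) + vb G l ξ) := by
    intro ξ hξ
    have h1 := H.diff (i := l) hx ⟨hξ.1.le, hξ.2.le⟩ (by simpa [hx2] using hξ.1)
    have h2 := H.vb_deriv hξ
    have h3 := H.bd2 hx ⟨hξ.1, hξ.2.le⟩
    simp only [ww, hx2]
    refine ⟨h1.sub h2.1, ?_⟩
    rw [deriv_fun_sub h1 h2.1]
    refine (abs_sub _ _).trans ?_
    linarith [h2.2]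
  have hA : (fun ξ => ξ ^ β₁ * |ww v l (Function.update x l ξ)| ^ s) (x l) =
      x l ^ β₁ * |ww v l x| ^ s := by simp
  have hxl := (hx l).1
  have hnn : 0 ≤ x l ^ β₁ * |ww v l x| ^ s := by positivity
  rw [← abs_of_nonneg hnn, ← hA]
  have hff : ∀ ξ ∈ Set.Icc (0:ℝ) 1, ξ ^ β₀ * |ww v l (Function.update x l ξ)| ^ s ≤
      ff v G l β₀ β₁ s (Function.update x l ξ) := by
    intro ξ hξ
    have hvb := vb_nonneg H.hG0 l ξ
    have hGn := H.hG0 (Function.update x l ξ)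
    have := hξ.1
    unfold ff
    rw [hx2]
    have : 0 ≤ ξ ^ β₁ * |ww v l (Function.update x l ξ)| ^ (s - 1) * (G (Function.update x l ξ) + vb G l ξ) := by positivity
    linarith
  refine (line1 (φ := fun ξ => ξ ^ β₁ * |ww v l (Function.update x l ξ)| ^ s)
    (h := fun ξ => (β₁ + s * K) * ff v G l β₀ β₁ s (Function.update x l ξ))
      ?_ ?_ ?_ ?_ ?_ (hx l)).trans ?_
  · exact ((Real.continuous_rpow_const (by linarith)).mul
      ((Real.continuous_rpow_const (by linarith)).comp hwc.abs)).continuousOn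
  · exact (continuous_const.mul hfc).continuousOn
  · intro ξ hξ
    exact mul_nonneg (by positivity) (ff_nonneg H.hG0 _ _ _ (by rw [hx2]; exact hξ.1))
  · intro ξ hξ
    exact (Real.differentiableAt_rpow_const_of_ne _ hξ.1.ne').mul
      (deriv_abs_rpow_comp hs (hd ξ hξ).1).1
  · intro ξ hξ
    have h1 := deriv_abs_rpow_comp hs (hd ξ hξ).1
    have h2 := (hd ξ hξ).2
    have hξ0 := hξ.1
    rw [deriv_fun_mul (Real.differentiableAt_rpow_const_of_ne _ hξ.1.ne') h1.1,
      Real.deriv_rpow_const]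
    have hvb := vb_nonneg H.hG0 l ξ
    have hGn := H.hG0 (Function.update x l ξ)
    have h4 : ξ ^ (β₁ - 1) ≤ ξ ^ β₀ :=
      Real.rpow_le_rpow_of_exponent_ge hξ.1 hξ.2.le (by linarith)
    unfold ff
    rw [hx2]
    set A := |ww v l (Function.update x l ξ)|
    have hA0 : 0 ≤ A := abs_nonneg _
    have hAs : |A ^ s| = A ^ s := abs_of_nonneg (by positivity)
    refine (abs_add_le _ _).trans ?_
    rw [abs_mul, abs_mul, abs_mul, hAs, abs_of_nonneg (by linarith : 0 ≤ β₁),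
      abs_of_nonneg (by positivity : 0 ≤ ξ ^ (β₁ - 1)), abs_of_nonneg (by positivity : 0 ≤ ξ ^ β₁)]
    have e1 : β₁ * ξ ^ (β₁ - 1) * A ^ s ≤ β₁ * (ξ ^ β₀ * A ^ s) := by
      rw [mul_assoc]; gcongr
    have e2 : ξ ^ β₁ * |deriv (fun ξ => |ww v l (Function.update x l ξ)| ^ s) ξ| ≤
       s * K * (ξ ^ β₁ * A ^ (s-1) * (G (Function.update x l ξ) + vb G l ξ)) := by
      calc _ ≤ ξ ^ β₁ * (s * A ^ (s-1) * (K * (G (Function.update x l ξ) + vb G l ξ))) := by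
            gcongr
            exact h1.2.trans (by gcongr)
        _ = _ := by ring
    have e3 : 0 ≤ ξ ^ β₁ * A ^ (s-1) * (G (Function.update x l ξ) + vb G l ξ) := by positivity
    have e4 : 0 ≤ ξ ^ β₀ * A ^ s := by positivity
    have e5 : 0 ≤ s * K := by positivity
    nlinarith [mul_nonneg e5 e4, mul_nonneg (by linarith : 0 ≤ β₁) e3]
  · refine lint_mul_aux (by positivity) fun ξ hξ => ?_
    have hξ0 := hξ.1
    rw [abs_of_nonneg (by positivity), one_add_mul]
    gcongr
    refine le_trans ?_ (hff ξ hξ)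
    rcases hξ0.eq_or_lt with h | h
    · rw [← h, Real.zero_rpow (by linarith), zero_mul]
      positivity
    · gcongr ?_ * _
      exact Real.rpow_le_rpow_of_exponent_ge h hξ.2 (by linarith)
end Part2

section Part3

set_option linter.unusedSectionVars false
variable {ι : Type} [Fintype ι] [DecidableEq ι] {l : ι} {α K : ℝ} {v G : (ι → ℝ) → ℝ}

def SS (G : (ι → ℝ) → ℝ) (l : ι) (β p : ℝ) : ℝ≥0∞ :=
  ∫⁻ x, ENNReal.ofReal (x l ^ β) * ENNReal.ofReal (G x) ^ p ∂(PP ι)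

lemma meas_pow (l : ι) (β : ℝ) : Measurable fun x : ι → ℝ => ENNReal.ofReal (x l ^ β) :=
  ((measurable_pi_apply l).pow_const β).ennreal_ofReal

lemma meas_SS (hG : Continuous G) (l : ι) (β p : ℝ) :
    Measurable fun x : ι → ℝ => ENNReal.ofReal (x l ^ β) * ENNReal.ofReal (G x) ^ p :=
  (meas_pow l β).mul (hG.measurable.ennreal_ofReal.pow_const p)

lemma mp_piecewise2 (s : Finset ι) :
    MeasurePreserving (fun q : (ι → ℝ) × (ι → ℝ) => s.piecewise q.2 q.1)
      ((PP ι).prod (PP ι)) (PP ι) := by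
  have := mp_piecewise (ι := ι) sᶜ
  simpa only [Finset.piecewise_compl] using this

lemma poinc_aux (l : ι) (α K β : ℝ) {p : ℝ} (hp : 1 ≤ p) (s : Finset ι) :
    l ∉ s → ∃ C : NNReal, ∀ v G : (ι → ℝ) → ℝ, Core l α K v G →
      ∫⁻ q, ENNReal.ofReal (q.1 l ^ (β - α * p)) *
        ENNReal.ofReal |v q.1 - v (s.piecewise q.2 q.1)| ^ p ∂((PP ι).prod (PP ι)) ≤
      C * SS G l β p := by
  induction s using Finset.induction_on with
  | empty =>
    intro _
    refine ⟨0, fun v G H => ?_⟩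
    simp [ENNReal.zero_rpow_of_pos (by linarith : 0 < p)]
  | insert k s hk ih =>
    intro hl
    have hkl : k ≠ l := fun h => hl (by simp [h])
    have hls : l ∉ s := fun h => hl (by simp [h])
    obtain ⟨C, hC⟩ := ih hls
    refine ⟨2 ^ (p - 1) * (C + 1), fun v G H => ?_⟩
    have hm1 : Measurable fun q : (ι → ℝ) × (ι → ℝ) => ENNReal.ofReal (q.1 l ^ (β - α * p)) *
        ENNReal.ofReal |v q.1 - v (s.piecewise q.2 q.1)| ^ p := by
      refine ((meas_pow l _).comp measurable_fst).mul (Measurable.pow_const ?_ p)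
      refine Measurable.ennreal_ofReal ?_
      have := (H.hv.measurable.comp measurable_fst).sub
        (H.hv.measurable.comp (mp_piecewise2 s).measurable)
      exact continuous_abs.measurable.comp this
    have hmH := meas_SS H.hG l β p
    have hmH2 : Measurable fun y : ι → ℝ => ∫⁻ ξ, ENNReal.ofReal ((Function.update y k ξ) l ^ β) *
       ENNReal.ofReal (G (Function.update y k ξ)) ^ p ∂lam := by
      have hu : Measurable fun a : (ι → ℝ) × ℝ => Function.update a.1 k a.2 := by
        exact (continuous_fst.update k continuous_snd).measurable
      exact Measurable.lintegral_prod_right' (hmH.comp hu)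
    have key : ∀ᵐ q ∂((PP ι).prod (PP ι)), ENNReal.ofReal (q.1 l ^ (β - α * p)) *
        ENNReal.ofReal |v q.1 - v ((insert k s).piecewise q.2 q.1)| ^ p ≤
        2 ^ (p - 1) * (ENNReal.ofReal (q.1 l ^ (β - α * p)) *
        ENNReal.ofReal |v q.1 - v (s.piecewise q.2 q.1)| ^ p +
        ∫⁻ ξ, ENNReal.ofReal ((Function.update (s.piecewise q.2 q.1) k ξ) l ^ β) *
       ENNReal.ofReal (G (Function.update (s.piecewise q.2 q.1) k ξ)) ^ p ∂lam) := by
      filter_upwards [(measurePreserving_fst (μ := PP ι) (ν := PP ι)).quasiMeasurePreserving.ae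
        (PP_ae ι), (measurePreserving_snd (μ := PP ι) (ν := PP ι)).quasiMeasurePreserving.ae
        (PP_ae ι)] with q h1 h2
      obtain ⟨x, z⟩ := q
      dsimp only at h1 h2 ⊢
      set y := s.piecewise z x with hy
      have hyc : ∀ i, y i ∈ Set.Icc (0:ℝ) 1 := by
        intro i
        by_cases hi : i ∈ s
        · simpa [hy, hi] using Set.Ioo_subset_Icc_self (h2 i)
        · simpa [hy, hi] using Set.Ioo_subset_Icc_self (h1 i)
      have hyl : y l = x l := by simp [hy, hls]
      have hxl : 0 < x l := (h1 l).1
      have hul : ∀ ξ, Function.update y k ξ l = x l := fun ξ => by simp [hkl.symm, hyl]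
      have e1 : (insert k s).piecewise z x = Function.update y k (z k) := by
        rw [Finset.piecewise_insert]
      have hupd : Continuous fun ξ : ℝ => Function.update y k ξ :=
        continuous_const.update k continuous_id
      have hd := diff_line (φ := fun ξ => v (Function.update y k ξ))
        (h := fun ξ => x l ^ α * G (Function.update y k ξ))
        (H.hv.comp hupd).continuousOn (continuous_const.mul (H.hG.comp hupd)).continuousOn
        (fun ξ _ => mul_nonneg (by positivity) (H.hG0 _))
        (fun ξ hξ => H.diff hyc ⟨hξ.1.le, hξ.2.le⟩ (by rw [hul]; exact hxl))
        (fun ξ hξ => by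
          have := H.bd1 (i := k) hyc ⟨hξ.1.le, hξ.2.le⟩ (by rw [hyl]; exact hxl) hkl
          rwa [hyl] at this) (hyc k) (Set.Ioo_subset_Icc_self (h2 k))
      simp only [Function.update_eq_self] at hd
      simp only [hul]
      rw [e1]
      have hmG : Measurable fun ξ => ENNReal.ofReal (G (Function.update y k ξ)) :=
        (H.hG.comp hupd).measurable.ennreal_ofReal
      have hd2 : ENNReal.ofReal (x l ^ (β - α * p)) *
          ENNReal.ofReal |v y - v (Function.update y k (z k))| ^ p ≤
          ∫⁻ ξ, ENNReal.ofReal (x l ^ β) * ENNReal.ofReal (G (Function.update y k ξ)) ^ p ∂lam := by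
        calc _ ≤ ENNReal.ofReal (x l ^ (β - α * p)) * 
              (∫⁻ ξ, ENNReal.ofReal (x l ^ α * G (Function.update y k ξ)) ∂lam) ^ p := by gcongr
          _ ≤ ENNReal.ofReal (x l ^ (β - α * p)) * 
              (∫⁻ ξ, ENNReal.ofReal (x l ^ α * G (Function.update y k ξ)) ^ p ∂lam) := by
              gcongr
              exact jensen_ge lam hp
                (continuous_const.mul (H.hG.comp hupd)).measurable.ennreal_ofReal.aemeasurable
          _ = _ := by
              rw [← lintegral_const_mul' _ _ ENNReal.ofReal_ne_top]
              refine lintegral_congr fun ξ => ?_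
              rw [ENNReal.ofReal_mul (by positivity), ENNReal.mul_rpow_of_nonneg _ _ (by linarith),
                ← mul_assoc, ENNReal.ofReal_rpow_of_pos (by positivity), ← Real.rpow_mul hxl.le,
                ← ENNReal.ofReal_mul (by positivity), ← Real.rpow_add hxl]
              congr 4; ring
      calc _ ≤ ENNReal.ofReal (x l ^ (β - α * p)) * (2 ^ (p - 1) *
            (ENNReal.ofReal |v x - v y| ^ p +
             ENNReal.ofReal |v y - v (Function.update y k (z k))| ^ p)) := by
            gcongr
            refine le_trans ?_ (ENNReal.rpow_add_le_mul_rpow_add_rpow _ _ hp)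
            gcongr
            rw [← ENNReal.ofReal_add (abs_nonneg _) (abs_nonneg _)]
            exact ENNReal.ofReal_le_ofReal (abs_sub_le _ _ _)
        _ = 2 ^ (p - 1) * (ENNReal.ofReal (x l ^ (β - α * p)) * ENNReal.ofReal |v x - v y| ^ p +
             ENNReal.ofReal (x l ^ (β - α * p)) * 
              ENNReal.ofReal |v y - v (Function.update y k (z k))| ^ p) := by ring
        _ ≤ _ := by gcongr
    refine (lintegral_mono_ae key).trans ?_
    rw [lintegral_const_mul' _ _ (by simp), lintegral_add_left hm1,
      (mp_piecewise2 s).lintegral_comp hmH2, lintegral_upd k hmH]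
    have e : ((2 ^ (p - 1) * (C + 1) : NNReal) : ℝ≥0∞) = 2 ^ (p - 1) * ((C:ℝ≥0∞) + 1) := by
      push_cast
      rw [ENNReal.coe_rpow_of_nonneg _ (by linarith)]
      simp
    rw [e, mul_assoc, add_mul, one_mul]
    gcongr
    · exact hC v G H
    · exact le_rfl

lemma vb_ofReal_le (hv : Continuous v) (l : ι) (c t : ℝ) :
    ENNReal.ofReal |c - vb v l t| ≤ ∫⁻ z, ENNReal.ofReal |c - v (Function.update z l t)| ∂(PP ι) := by
  have hi : Integrable (fun z => v (Function.update z l t)) (PP ι) :=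
    int_cont (hv.comp (continuous_id.update l continuous_const))
  have : c - vb v l t = ∫ z, (c - v (Function.update z l t)) ∂(PP ι) := by
    rw [integral_sub (integrable_const _) hi]; simp [vb]
  rw [this, ← Real.enorm_eq_ofReal_abs]
  refine (enorm_integral_le_lintegral_enorm _).trans ?_
  simp only [Real.enorm_eq_ofReal_abs]
  exact le_rfl

lemma poinc (l : ι) (α K β : ℝ) {p : ℝ} (hp : 1 ≤ p) :
    ∃ C : NNReal, ∀ v G : (ι → ℝ) → ℝ, Core l α K v G →
      ∫⁻ x, ENNReal.ofReal (x l ^ (β - α * p)) *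
        ENNReal.ofReal |ww v l x| ^ p ∂(PP ι) ≤ C * SS G l β p := by
  obtain ⟨C, hC⟩ := poinc_aux l α K β hp (Finset.univ.erase l) (by simp)
  refine ⟨C, fun v G H => le_trans ?_ (hC v G H)⟩
  have hm : Measurable fun q : (ι → ℝ) × (ι → ℝ) => ENNReal.ofReal (q.1 l ^ (β - α * p)) *
        ENNReal.ofReal |v q.1 - v ((Finset.univ.erase l).piecewise q.2 q.1)| ^ p := by
    refine ((meas_pow l _).comp measurable_fst).mul (Measurable.pow_const ?_ p)
    refine Measurable.ennreal_ofReal ?_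
    have := (H.hv.measurable.comp measurable_fst).sub
      (H.hv.measurable.comp (mp_piecewise2 (Finset.univ.erase l)).measurable)
    exact continuous_abs.measurable.comp this
  rw [lintegral_prod _ hm.aemeasurable]
  refine lintegral_mono fun x => ?_
  dsimp only
  rw [lintegral_const_mul' _ _ ENNReal.ofReal_ne_top]
  gcongr
  have hpw : ∀ z : ι → ℝ, (Finset.univ.erase l).piecewise z x = Function.update z l (x l) := by
    intro z; ext i
    by_cases h : i = l
    · subst h; simp
    · simp [h]
  simp only [hpw]
  refine le_trans ?_ (jensen_ge (PP ι) hp ?_)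
  · gcongr
    exact vb_ofReal_le H.hv l (v x) (x l)
  · have : Continuous fun z : ι → ℝ => |v x - v (Function.update z l (x l))| :=
      (continuous_const.sub (H.hv.comp (continuous_id.update l continuous_const))).abs
    exact this.measurable.ennreal_ofReal.aemeasurable

lemma ofReal_vb (hG : Continuous G) (hG0 : ∀ x, 0 ≤ G x) (l : ι) (t : ℝ) :
    ENNReal.ofReal (vb G l t) = ∫⁻ z, ENNReal.ofReal (G (Function.update z l t)) ∂(PP ι) := by
  rw [vb, ofReal_integral_eq_lintegral_ofReal (f := fun z => G (Function.update z l t))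
    (int_cont (hG.comp (continuous_id.update l continuous_const)))]
  exact Filter.Eventually.of_forall fun z => hG0 _

lemma gbar (hG : Continuous G) (hG0 : ∀ x, 0 ≤ G x) (l : ι) (β : ℝ) {p : ℝ} (hp : 1 ≤ p) :
    ∫⁻ x, ENNReal.ofReal (x l ^ β) * ENNReal.ofReal (vb G l (x l)) ^ p ∂(PP ι) ≤ SS G l β p := by
  rw [SS, ← lintegral_updlast l (meas_SS hG l β p)]
  refine lintegral_mono fun x => ?_
  simp only [Function.update_self]
  rw [lintegral_const_mul' _ _ ENNReal.ofReal_ne_top]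
  gcongr
  rw [ofReal_vb hG hG0]
  exact jensen_ge (PP ι) hp
    (hG.comp (continuous_id.update l continuous_const)).measurable.ennreal_ofReal.aemeasurable
end Part3

section Part4

set_option linter.unusedSectionVars false
variable {ι : Type} [Fintype ι] [DecidableEq ι] {l : ι} {α K : ℝ} {v G : (ι → ℝ) → ℝ}

def AA (v G : (ι → ℝ) → ℝ) (l : ι) (β₀ β₁ s : ℝ) : ℝ≥0∞ :=
  ∫⁻ x, ENNReal.ofReal (ff v G l β₀ β₁ s x) ∂(PP ι)

lemma Core.lw (H : Core l α K v G) {β₀ β₁ s n : ℝ} (hβ : β₁ = β₀ + α) (h0 : 0 ≤ β₀)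
    (hα : 1 ≤ α) (hs : 1 < s) (hn : n = Fintype.card ι) (hn1 : 1 < n)
    (hβn : β₁ = (n - 1) * α) :
    ∫⁻ x, ENNReal.ofReal (x l ^ β₁ * |ww v l x| ^ (s * n / (n - 1))) ∂(PP ι) ≤
      (ENNReal.ofReal (1 + s + (β₁ + s * K)) * AA v G l β₀ β₁ s) ^ (n / (n - 1)) := by
  have hfc := ff_cont (l := l) H.hv H.hG h0 (by linarith : 0 ≤ β₁) hs.le
  have hK := H.hK
  set c : ℝ≥0∞ := ENNReal.ofReal (1 + s + (β₁ + s * K)) with hc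
  have hsK : 0 ≤ s * K := by positivity
  have hfm : Measurable fun x => c * ENNReal.ofReal (ff v G l β₀ β₁ s x) :=
    hfc.measurable.ennreal_ofReal.const_mul c
  have hq : Real.HolderConjugate (Fintype.card ι : ℝ) (n / (n - 1)) := by
    rw [← hn]; exact Real.HolderConjugate.conjExponent hn1
  have := lintegral_prod_lintegral_pow_le (μ := fun _ : ι => lam) hq hfm
  rw [AA, ← lintegral_const_mul' _ _ ENNReal.ofReal_ne_top]
  refine le_trans (lintegral_mono_ae ?_) this
  change ∀ᵐ x ∂(PP ι), _
  filter_upwards [PP_ae ι] with x hx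
  have hxc : ∀ i, x i ∈ Set.Icc (0:ℝ) 1 := fun i => Set.Ioo_subset_Icc_self (hx i)
  have hxl : 0 < x l := (hx l).1
  have hW : 0 ≤ |ww v l x| := abs_nonneg _
  rw [← hn]
  have hn0 : 0 < n - 1 := by linarith
  have hb : ∀ i, ENNReal.ofReal (x l ^ (if i = l then β₁ else β₀) * |ww v l x| ^ s) ≤
      ∫⁻ ξ, c * ENNReal.ofReal (ff v G l β₀ β₁ s (Function.update x i ξ)) ∂lam := by
    intro i
    rw [lintegral_const_mul' _ _ ENNReal.ofReal_ne_top]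
    by_cases hi : i = l
    · subst hi
      simp only [if_true]
      refine (H.line_top hβ h0 hα hs hxc).trans ?_
      gcongr
      linarith
    · simp only [hi, if_false]
      refine (H.line_side hβ h0 hα hs hxc hxl hi).trans ?_
      exact mul_le_mul_left (ENNReal.ofReal_le_ofReal (by linarith)) _
  refine le_trans (le_of_eq ?_) (Finset.prod_le_prod' fun i _ => ENNReal.rpow_le_rpow (hb i)
    (by positivity : 0 ≤ 1 / (n - 1)))
  have e : ∀ i, ENNReal.ofReal (x l ^ (if i = l then β₁ else β₀) * |ww v l x| ^ s) ^ (1 / (n-1)) =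
     ENNReal.ofReal (x l ^ ((if i = l then β₁ else β₀) / (n-1)) * |ww v l x| ^ (s / (n-1))) := by
    intro i
    rw [ENNReal.ofReal_rpow_of_nonneg (by positivity) (by positivity),
      Real.mul_rpow (by positivity) (by positivity), ← Real.rpow_mul hxl.le, ← Real.rpow_mul hW]
    congr 3 <;> ring
  simp only [e]
  rw [← ENNReal.ofReal_prod_of_nonneg (fun i _ => by positivity), Finset.prod_mul_distrib,
    Finset.prod_const, ← Real.rpow_sum_of_pos hxl, ← Real.rpow_mul_natCast hW, Finset.card_univ, ← hn]
  congr 3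
  · rw [← Finset.sum_div, Finset.sum_ite]
    simp only [Finset.sum_const, nsmul_eq_mul, Finset.filter_eq', Finset.mem_univ, if_true,
      Finset.card_singleton]
    have : (Finset.univ.filter (fun x : ι => ¬ x = l)).card = Fintype.card ι - 1 := by
      rw [Finset.filter_ne', Finset.card_erase_of_mem (Finset.mem_univ _), Finset.card_univ]
    rw [this, Nat.cast_sub (Fintype.card_pos_iff.2 ⟨l⟩), ← hn]
    field_simp
    push_cast
    have : β₀ = (n - 2) * α := by linarith
    rw [this, hβn]; ring
  · ring

lemma Core.kk {β p C : ℝ} (H : Core l α K v G) (hp : 1 ≤ p) (hC : 0 ≤ C)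
    (hP : ∫⁻ x, ENNReal.ofReal (x l ^ (β - α * p)) *
        ENNReal.ofReal |ww v l x| ^ p ∂(PP ι) ≤ ENNReal.ofReal C * SS G l β p) :
    ∫⁻ x, ENNReal.ofReal (x l ^ (β / p) * (x l ^ (-α) * |ww v l x| + (G x + vb G l (x l)))) ^ p ∂(PP ι)
      ≤ ENNReal.ofReal (2 ^ (p-1) * (C + 2 ^ (p-1) * 2)) * SS G l β p := by
  have hmb : Measurable fun x : ι → ℝ => ENNReal.ofReal (vb G l (x l)) ^ p :=
    ((vb_cont H.hG l).comp (continuous_apply l)).measurable.ennreal_ofReal.pow_const p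
  have hmw : Measurable fun x : ι → ℝ => ENNReal.ofReal |ww v l x| ^ p :=
    (ww_cont H.hv).abs.measurable.ennreal_ofReal.pow_const p
  have key : ∀ᵐ x ∂(PP ι), 
     ENNReal.ofReal (x l ^ (β / p) * (x l ^ (-α) * |ww v l x| + (G x + vb G l (x l)))) ^ p ≤
      2 ^ (p-1) * (ENNReal.ofReal (x l ^ (β - α * p)) * ENNReal.ofReal |ww v l x| ^ p +
       2 ^ (p-1) * (ENNReal.ofReal (x l ^ β) * ENNReal.ofReal (G x) ^ p +
        ENNReal.ofReal (x l ^ β) * ENNReal.ofReal (vb G l (x l)) ^ p)) := by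
    filter_upwards [PP_ae ι] with x hx
    have hxl : 0 < x l := (hx l).1
    have hG := H.hG0 x
    have hGb := vb_nonneg H.hG0 l (x l)
    have hp0 : 0 ≤ p := by linarith
    rw [ENNReal.ofReal_mul (by positivity), ENNReal.mul_rpow_of_nonneg _ _ hp0,
      ENNReal.ofReal_rpow_of_pos (by positivity), ← Real.rpow_mul hxl.le,
      div_mul_cancel₀ _ (by linarith), ENNReal.ofReal_add (by positivity) (by positivity),
      ENNReal.ofReal_add hG hGb]
    calc _ ≤ ENNReal.ofReal (x l ^ β) * (2 ^ (p-1) * (ENNReal.ofReal (x l ^ (-α) * |ww v l x|) ^ p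
            + 2 ^ (p-1) * (ENNReal.ofReal (G x) ^ p + ENNReal.ofReal (vb G l (x l)) ^ p))) := by
          gcongr
          refine (ENNReal.rpow_add_le_mul_rpow_add_rpow _ _ hp).trans ?_
          gcongr
          exact (ENNReal.rpow_add_le_mul_rpow_add_rpow _ _ hp)
      _ = 2 ^ (p-1) * (ENNReal.ofReal (x l ^ β) * ENNReal.ofReal (x l ^ (-α) * |ww v l x|) ^ p +
         2 ^ (p-1) * (ENNReal.ofReal (x l ^ β) * ENNReal.ofReal (G x) ^ p +
        ENNReal.ofReal (x l ^ β) * ENNReal.ofReal (vb G l (x l)) ^ p)) := by ring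
      _ = _ := by
          congr 2
          rw [ENNReal.ofReal_mul (by positivity), ENNReal.mul_rpow_of_nonneg _ _ hp0,
           ENNReal.ofReal_rpow_of_pos (by positivity), ← Real.rpow_mul hxl.le, ← mul_assoc,
           ← ENNReal.ofReal_mul (by positivity), ← Real.rpow_add hxl]
          congr 4; ring
  refine (lintegral_mono_ae key).trans ?_
  have h2 : (2:ℝ≥0∞) ^ (p-1) ≠ ⊤ := by simp
  have hm1 : Measurable fun x : ι → ℝ =>
      ENNReal.ofReal (x l ^ (β - α * p)) * ENNReal.ofReal |ww v l x| ^ p :=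
    (meas_pow l _).mul hmw
  rw [lintegral_const_mul' _ _ h2, lintegral_add_left hm1,
    lintegral_const_mul' _ _ h2, lintegral_add_left (meas_SS H.hG l β p)]
  have h3 := gbar H.hG H.hG0 l β hp
  have e2 : ENNReal.ofReal ((2:ℝ) ^ (p-1)) = 2 ^ (p-1) := by
    rw [← ENNReal.ofReal_rpow_of_pos (by norm_num)]; simp
  rw [ENNReal.ofReal_mul (by positivity), ENNReal.ofReal_add hC (by positivity),
    ENNReal.ofReal_mul (by positivity), e2]
  calc _ ≤ 2 ^ (p-1) * (ENNReal.ofReal C * SS G l β p +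
         2 ^ (p-1) * (SS G l β p + SS G l β p)) := by
        gcongr
        exact le_rfl
    _ = _ := by
        rw [ENNReal.ofReal_ofNat]; ring

lemma Core.AA_ne_top (H : Core l α K v G) {β₀ β₁ s : ℝ} (h0 : 0 ≤ β₀) (h1 : 0 ≤ β₁) (hs : 1 ≤ s) :
    AA v G l β₀ β₁ s ≠ ⊤ := by
  have := (int_cont (ff_cont (l := l) H.hv H.hG h0 h1 hs)).lintegral_lt_top
  exact this.ne

lemma Core.hold (H : Core l α K v G) {β₀ β₁ s p : ℝ} (hβ : β₁ = β₀ + α) (h0 : 0 ≤ β₀)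
    (hs : 1 < s) (hp : 1 < p) :
    AA v G l β₀ β₁ s ≤
     (∫⁻ x, ENNReal.ofReal (x l ^ β₁ * |ww v l x| ^ ((s - 1) * (p / (p - 1)))) ∂(PP ι)) ^ (1 - 1 / p)
     * (∫⁻ x, ENNReal.ofReal (x l ^ (β₁ / p) *
        (x l ^ (-α) * |ww v l x| + (G x + vb G l (x l)))) ^ p ∂(PP ι)) ^ (1/p) := by
  have hw := (ww_cont (l := l) H.hv).abs.measurable
  have hxm : ∀ β : ℝ, Measurable fun x : ι → ℝ => x l ^ β := fun β =>
    (measurable_pi_apply l).pow_const β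
  have hb := ((vb_cont H.hG l).comp (continuous_apply (A := fun _ : ι => ℝ) l)).measurable
  have hc := (Real.HolderConjugate.conjExponent hp).symm
  have h := ENNReal.lintegral_mul_le_Lp_mul_Lq (PP ι) hc
    (f := fun x => ENNReal.ofReal (x l ^ (β₁ * (1 - 1 / p)) * |ww v l x| ^ (s-1)))
    (g := fun x => ENNReal.ofReal (x l ^ (β₁ / p) *
        (x l ^ (-α) * |ww v l x| + (G x + vb G l (x l)))))
    (((hxm _).mul (hw.pow_const _)).ennreal_ofReal.aemeasurable)
    (((hxm _).mul (((hxm _).mul hw).add (H.hG.measurable.add hb))).ennreal_ofReal.aemeasurable)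
  have hpp : 0 < p / (p - 1) := div_pos (by linarith) (by linarith)
  have hc1 : Real.conjExponent p = p / (p - 1) := rfl
  have hc2 : 1 / Real.conjExponent p = 1 - 1 / p := by
    rw [hc1]; have : p - 1 ≠ 0 := by linarith
    field_simp
  rw [hc2] at h
  refine le_trans (lintegral_mono_ae ?_) (h.trans (mul_le_mul_left (ENNReal.rpow_le_rpow
    (lintegral_mono_ae ?_) ?_) _))
  · filter_upwards [PP_ae ι] with x hx
    have hxl : 0 < x l := (hx l).1
    have hG := H.hG0 x
    have hGb := vb_nonneg H.hG0 l (x l)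
    simp only [Pi.mul_apply]
    rw [← ENNReal.ofReal_mul (by positivity)]
    apply ENNReal.ofReal_le_ofReal
    apply le_of_eq
    set W := |ww v l x|
    have hW : 0 ≤ W := abs_nonneg _
    have e1 : x l ^ β₁ = x l ^ (β₁ * (1 - 1/p)) * x l ^ (β₁ / p) := by
      rw [← Real.rpow_add hxl]; congr 1; field_simp; ring
    have e2 : x l ^ β₀ = x l ^ β₁ * x l ^ (-α) := by
      rw [← Real.rpow_add hxl]; congr 1; linarith
    have e3 : W ^ s = W ^ (s - 1) * W := by
      rw [← Real.rpow_add_one' hW (by linarith)]; congr 1; ring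
    change x l ^ β₀ * W ^ s + x l ^ β₁ * W ^ (s-1) * _ = _
    rw [e2, e3, e1]; ring
  · filter_upwards [PP_ae ι] with x hx
    have hxl : 0 < x l := (hx l).1
    apply le_of_eq
    rw [ENNReal.ofReal_rpow_of_nonneg (by positivity) (by rw [hc1]; exact hpp.le),
      Real.mul_rpow (by positivity) (by positivity), ← Real.rpow_mul hxl.le,
      ← Real.rpow_mul (abs_nonneg _), hc1]
    congr 3
    have : p - 1 ≠ 0 := by linarith
    field_simp
  · rw [sub_nonneg, div_le_one (by linarith)]; exact hp.le

/-- main bound for the oscillating part -/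
lemma main_AA (l : ι) (α K : ℝ) {β₀ β₁ s n p : ℝ} (hβ : β₁ = β₀ + α) (h0 : 0 ≤ β₀)
    (hα : 1 ≤ α) (hn : n = Fintype.card ι) (hp : 1 < p) (hpn : p < n)
    (hβn : β₁ = (n - 1) * α) (hs : s = p * (n - 1) / (n - p)) :
    ∃ C : NNReal, ∀ v G : (ι → ℝ) → ℝ, Core l α K v G →
      AA v G l β₀ β₁ s ≤ C * SS G l β₁ p ^ (s / p) := by
  obtain ⟨C, hC⟩ := poinc l α K β₁ hp.le
  have hnp : 0 < n - p := by linarith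
  have hn1 : 0 < n - 1 := by linarith
  have hp1 : 0 < p - 1 := by linarith
  have hs1 : 1 < s := by
    rw [hs, lt_div_iff₀ hnp]; nlinarith
  have hs0 : 0 < s := by linarith
  set c1 : ℝ≥0∞ := ENNReal.ofReal (1 + s + (β₁ + s * K)) with hc1
  set c2 : ℝ≥0∞ := ENNReal.ofReal (2 ^ (p-1) * (C + 2 ^ (p-1) * 2)) with hc2
  set D : ℝ≥0∞ := (c1 ^ (1 - 1/s) * c2 ^ (1/p)) ^ s with hD
  have h1s : 0 ≤ 1 - 1/s := by rw [sub_nonneg, div_le_one hs0]; exact hs1.le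
  have hDt : D ≠ ⊤ := by
    have h1 : c1 ^ (1 - 1/s) ≠ ⊤ := ENNReal.rpow_ne_top_of_nonneg h1s ENNReal.ofReal_ne_top
    have h2 : c2 ^ (1/p) ≠ ⊤ :=
      ENNReal.rpow_ne_top_of_nonneg (by positivity) ENNReal.ofReal_ne_top
    exact ENNReal.rpow_ne_top_of_nonneg hs0.le (ENNReal.mul_ne_top h1 h2)
  refine ⟨D.toNNReal, fun v G H => ?_⟩
  rw [ENNReal.coe_toNNReal hDt]
  have hA := H.AA_ne_top h0 (by linarith : 0 ≤ β₁) hs1.le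
  set A := AA v G l β₀ β₁ s with hAdef
  have a1 := H.lw hβ h0 hα hs1 hn (by linarith) hβn
  have a2 := H.hold hβ h0 hs1 hp
  have a3 := H.kk (C := C) hp.le C.2 (by rw [ENNReal.ofReal_coe_nnreal]; exact hC v G H)
  have ee : (s - 1) * (p / (p - 1)) = s * n / (n - 1) := by
    rw [hs]; field_simp; ring
  rw [ee] at a2
  have a4 : A ≤ ((c1 * A) ^ (n / (n - 1))) ^ (1 - 1/p) * (c2 * SS G l β₁ p) ^ (1/p) := by
    refine a2.trans ?_
    have : 0 ≤ 1 - 1/p := by rw [sub_nonneg, div_le_one (by linarith)]; exact hp.le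
    gcongr
  have ee2 : n / (n-1) * (1 - 1/p) = 1 - 1/s := by
    rw [hs]; field_simp; ring
  rw [← ENNReal.rpow_mul, ee2, ENNReal.mul_rpow_of_nonneg _ _ h1s,
    ENNReal.mul_rpow_of_nonneg _ _ (by positivity : 0 ≤ 1/p)] at a4
  by_cases hA0 : A = 0
  · rw [hA0]; exact zero_le
  have a5 : A ^ (1/s) ≤ c1 ^ (1 - 1/s) * c2 ^ (1/p) * SS G l β₁ p ^ (1/p) := by
    have t1 : A ^ (1 - 1/s) ≠ 0 := by
      simp [ENNReal.rpow_eq_zero_iff, hA0, hA]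
    have t2 : A ^ (1 - 1/s) ≠ ⊤ := ENNReal.rpow_ne_top_of_nonneg h1s hA
    refine (ENNReal.mul_le_mul_iff_right t1 t2).1 ?_
    rw [← ENNReal.rpow_add _ _ hA0 hA]
    simp only [sub_add_cancel, ENNReal.rpow_one]
    refine a4.trans (le_of_eq ?_)
    ring
  calc A = (A ^ (1/s)) ^ s := by rw [← ENNReal.rpow_mul]; simp [hs0.ne']
    _ ≤ (c1 ^ (1 - 1/s) * c2 ^ (1/p) * SS G l β₁ p ^ (1/p)) ^ s := by gcongr
    _ = _ := by
      rw [ENNReal.mul_rpow_of_nonneg _ _ hs0.le, ← ENNReal.rpow_mul, one_div_mul_eq_div]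
end Part4

section Part5

set_option linter.unusedSectionVars false
variable {ι : Type} [Fintype ι] [DecidableEq ι] {l : ι} {α K : ℝ} {v G : (ι → ℝ) → ℝ}

lemma hold1 {β p : ℝ} (hp : 1 < p) (hβ : p - 1 < β) :
    ∃ D : NNReal, ∀ c : ℝ, 0 < c → ∀ h : ℝ → ℝ≥0∞, Measurable h →
      ∫⁻ τ in Set.Icc c 1, h τ ≤ D * ENNReal.ofReal (c ^ (-((β + 1 - p) / p))) *
        (∫⁻ τ, ENNReal.ofReal (τ ^ β) * h τ ^ p ∂lam) ^ (1/p) := by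
  have hp1 : 0 < p - 1 := by linarith
  have hp0 : 0 < p := by linarith
  set q := β / (p - 1) with hq
  have hq1 : 1 < q := by rw [hq, lt_div_iff₀ hp1]; linarith
  have hc' : 0 ≤ 1 - 1/p := by rw [sub_nonneg, div_le_one hp0]; exact hp.le
  refine ⟨(1 / (q - 1)).toNNReal ^ (1 - 1/p), fun c hc h hh => ?_⟩
  have hc0 := (Real.HolderConjugate.conjExponent hp)
  have hc2 : 1 / Real.conjExponent p = 1 - 1 / p := by
    have : Real.conjExponent p = p / (p - 1) := rfl
    rw [this]; field_simp
  have hm : ∀ β : ℝ, Measurable fun τ : ℝ => ENNReal.ofReal (τ ^ β) := fun β =>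
    (measurable_id.pow_const β).ennreal_ofReal
  have H := ENNReal.lintegral_mul_le_Lp_mul_Lq (volume.restrict (Set.Icc c 1)) hc0
    (f := fun τ => ENNReal.ofReal (τ ^ (β / p)) * h τ)
    (g := fun τ => ENNReal.ofReal (τ ^ (-(β / p))))
    ((hm _).mul hh).aemeasurable (hm _).aemeasurable
  have e0 : ∫⁻ τ in Set.Icc c 1, h τ = ∫⁻ τ in Set.Icc c 1,
      ((fun τ => ENNReal.ofReal (τ ^ (β / p)) * h τ) * (fun τ => ENNReal.ofReal (τ ^ (-(β / p))))) τ := by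
    refine setLIntegral_congr_fun measurableSet_Icc fun τ hτ => ?_
    have hτ0 : 0 < τ := lt_of_lt_of_le hc hτ.1
    simp only [Pi.mul_apply]
    rw [mul_right_comm, ← ENNReal.ofReal_mul (by positivity), ← Real.rpow_add hτ0]
    simp
  rw [e0]
  refine H.trans ?_
  rw [hc2, mul_comm]
  refine mul_le_mul' ?_ ?_
  · have e1 : ∫⁻ τ in Set.Icc c 1, ENNReal.ofReal (τ ^ (-(β / p))) ^ Real.conjExponent p ≤
        ENNReal.ofReal ((1/(q-1)) * c ^ (1 - q)) := by
      calc _ ≤ ∫⁻ τ in Set.Ici c, ENNReal.ofReal (τ ^ (-q)) := by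
            refine (lintegral_mono_set Set.Icc_subset_Ici_self).trans (le_of_eq ?_)
            refine setLIntegral_congr_fun measurableSet_Ici fun τ hτ => ?_
            have hτ0 : 0 < τ := lt_of_lt_of_le hc hτ
            change ENNReal.ofReal (τ ^ (-(β / p))) ^ Real.conjExponent p = _
            rw [ENNReal.ofReal_rpow_of_pos (by positivity), ← Real.rpow_mul hτ0.le]
            congr 2
            have : Real.conjExponent p = p / (p - 1) := rfl
            rw [this, hq]; field_simp
        _ = ∫⁻ τ in Set.Ioi c, ENNReal.ofReal (τ ^ (-q)) :=
            setLIntegral_congr Ioi_ae_eq_Ici.symm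
        _ ≤ _ := by
            rw [← ofReal_integral_eq_lintegral_ofReal
              (integrableOn_Ioi_rpow_of_lt (by linarith) hc), integral_Ioi_rpow_of_lt (by linarith) hc]
            · apply ENNReal.ofReal_le_ofReal
              apply le_of_eq
              have e1 : -q + 1 = 1 - q := by ring
              have e2 : 1 - q ≠ 0 := by linarith
              have e3 : q - 1 ≠ 0 := by linarith
              rw [e1]
              field_simp
              ring
            · filter_upwards [ae_restrict_mem measurableSet_Ioi] with τ hτ
              have hτ0 : 0 < τ := lt_trans hc hτ
              simp only [Pi.zero_apply]; positivity
    have hq2 : 0 ≤ 1 / (q - 1) := by rw [one_div_nonneg]; linarith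
    refine (ENNReal.rpow_le_rpow e1 hc').trans (le_of_eq ?_)
    rw [ENNReal.ofReal_mul hq2, ENNReal.mul_rpow_of_nonneg _ _ hc',
      ENNReal.ofReal_rpow_of_pos (x := c ^ (1 - q)) (by positivity), ← Real.rpow_mul hc.le,
      ENNReal.coe_rpow_of_nonneg _ hc']
    refine congrArg₂ (· * ·) rfl ?_
    congr 2
    rw [hq]; field_simp; ring
  · have : ∫⁻ τ in Set.Icc c 1, (ENNReal.ofReal (τ ^ (β / p)) * h τ) ^ p ≤
       ∫⁻ τ, ENNReal.ofReal (τ ^ β) * h τ ^ p ∂lam := by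
      have : ∀ τ ∈ Set.Icc c 1, (ENNReal.ofReal (τ ^ (β / p)) * h τ) ^ p =
         ENNReal.ofReal (τ ^ β) * h τ ^ p := by
        intro τ hτ
        have hτ0 : 0 < τ := lt_of_lt_of_le hc hτ.1
        rw [ENNReal.mul_rpow_of_nonneg _ _ hp0.le, ENNReal.ofReal_rpow_of_pos (by positivity),
          ← Real.rpow_mul hτ0.le, div_mul_cancel₀ _ hp0.ne']
      rw [setLIntegral_congr_fun measurableSet_Icc this]
      exact lintegral_mono_set (Set.Icc_subset_Icc_left hc.le)
    exact ENNReal.rpow_le_rpow this (by positivity)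

lemma Core.avg (H : Core l α K v G) {t : ℝ} (ht : 0 < t) (ht1 : t ≤ 1) :
    ENNReal.ofReal |vb v l t| ≤ 2 * (∫⁻ τ in Set.Icc (t/2) 1, ENNReal.ofReal |vb v l τ|) +
      ENNReal.ofReal K * ∫⁻ τ in Set.Icc (t/2) 1, ENNReal.ofReal (vb G l τ) := by
  have hvc := vb_cont H.hv l
  have hGc := vb_cont H.hG l
  set I : ℝ≥0∞ := ENNReal.ofReal K * ∫⁻ τ in Set.Icc (t/2) 1, ENNReal.ofReal (vb G l τ) with hI
  have key : ∀ τ ∈ Set.Icc (1/2:ℝ) 1, ENNReal.ofReal |vb v l t| ≤ ENNReal.ofReal |vb v l τ| + I := by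
    intro τ hτ
    have := sub_le_line (φ := vb v l) (h := fun τ => K * vb G l τ) (c := t/2) (a := t) (b := τ)
      hvc.continuousOn (continuous_const.mul hGc).continuousOn
      (fun ξ _ => mul_nonneg H.hK (vb_nonneg H.hG0 l ξ))
      (fun ξ hξ => (H.vb_deriv ⟨by linarith [hξ.1], hξ.2⟩).1)
      (fun ξ hξ => (H.vb_deriv ⟨by linarith [hξ.1], hξ.2⟩).2)
      ⟨by linarith, ht1⟩ ⟨by linarith [hτ.1], hτ.2⟩
    have e : I = ENNReal.ofReal (∫ ξ in Set.Icc (t/2) 1, K * vb G l ξ) := by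
      rw [integral_const_mul, ENNReal.ofReal_mul H.hK,
        ofReal_integral_eq_lintegral_ofReal (hGc.continuousOn.integrableOn_compact isCompact_Icc)
        (Filter.Eventually.of_forall fun τ => vb_nonneg H.hG0 l τ)]
    rw [e]
    refine le_trans (ENNReal.ofReal_le_ofReal ?_) ENNReal.ofReal_add_le
    have h2 := abs_sub_abs_le_abs_sub (vb v l t) (vb v l τ)
    linarith
  have h2 : (2:ℝ≥0∞)⁻¹ * ENNReal.ofReal |vb v l t| ≤
      (∫⁻ τ in Set.Icc (t/2) 1, ENNReal.ofReal |vb v l τ|) + 2⁻¹ * I := by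
    have vol : volume (Set.Icc (1/2:ℝ) 1) = (2:ℝ≥0∞)⁻¹ := by
      rw [Real.volume_Icc]
      rw [show (1 - 1/2 : ℝ) = 2⁻¹ by norm_num, ENNReal.ofReal_inv_of_pos (by norm_num)]; simp
    have h3 := setLIntegral_mono' (μ := volume) (measurableSet_Icc (a := (1/2:ℝ)) (b := 1)) key
    rw [setLIntegral_const, lintegral_add_right _ measurable_const, setLIntegral_const, vol] at h3
    rw [mul_comm, mul_comm _ I]
    refine h3.trans ?_
    gcongr
  calc ENNReal.ofReal |vb v l t| = 2 * (2⁻¹ * ENNReal.ofReal |vb v l t|) := by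
        rw [← mul_assoc, ENNReal.mul_inv_cancel (by norm_num) (by norm_num), one_mul]
    _ ≤ 2 * ((∫⁻ τ in Set.Icc (t/2) 1, ENNReal.ofReal |vb v l τ|) + 2⁻¹ * I) := by gcongr
    _ = _ := by
        rw [mul_add, ← mul_assoc, ← mul_assoc, ENNReal.mul_inv_cancel (by norm_num) (by norm_num), one_mul]

def NN (v G : (ι → ℝ) → ℝ) (l : ι) (β p : ℝ) : ℝ≥0∞ :=
  SS G l β p ^ (1/p) + SS (fun x => |v x|) l β p ^ (1/p)

lemma vb_SS (hG : Continuous G) (hG0 : ∀ x, 0 ≤ G x) (l : ι) (β : ℝ) {p : ℝ} (hp : 1 ≤ p) :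
    ∫⁻ τ, ENNReal.ofReal (τ ^ β) * ENNReal.ofReal (vb G l τ) ^ p ∂lam ≤ SS G l β p := by
  refine le_trans (le_of_eq ?_) (gbar hG hG0 l β hp)
  have hm : Measurable fun τ : ℝ => ENNReal.ofReal (τ ^ β) * ENNReal.ofReal (vb G l τ) ^ p :=
    (measurable_id.pow_const β).ennreal_ofReal.mul
      ((vb_cont hG l).measurable.ennreal_ofReal.pow_const p)
  exact ((mp_eval l).lintegral_comp hm).symm

lemma vb_pt (l : ι) (α K : ℝ) {β p : ℝ} (hp : 1 < p) (hβ : p - 1 < β) :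
    ∃ D : NNReal, ∀ v G : (ι → ℝ) → ℝ, Core l α K v G → ∀ t : ℝ, 0 < t → t ≤ 1 →
      ENNReal.ofReal |vb v l t| ≤ D * ENNReal.ofReal (t ^ (-((β + 1 - p) / p))) * NN v G l β p := by
  obtain ⟨D, hD⟩ := hold1 hp hβ
  set k := (β + 1 - p) / p with hk
  refine ⟨(2 + K.toNNReal) * D * (2 ^ k : ℝ).toNNReal, fun v G H t ht ht1 => ?_⟩
  have hvb : ∀ τ, |vb v l τ| ≤ vb (fun x => |v x|) l τ := fun τ => abs_integral_le_integral_abs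
  have a := H.avg ht ht1
  have b1 := hD (t/2) (by positivity) (fun τ => ENNReal.ofReal (vb G l τ))
    (vb_cont H.hG l).measurable.ennreal_ofReal
  have b2 := hD (t/2) (by positivity) (fun τ => ENNReal.ofReal (vb (fun x => |v x|) l τ))
    (vb_cont H.hv.abs l).measurable.ennreal_ofReal
  have c1 := vb_SS H.hG H.hG0 l β hp.le
  have c2 := vb_SS H.hv.abs (fun x => abs_nonneg (v x)) l β hp.le
  have e : ENNReal.ofReal ((t/2) ^ (-k)) = (2 ^ k : ℝ).toNNReal * ENNReal.ofReal (t ^ (-k)) := by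
    change _ = ENNReal.ofReal _ * _
    rw [← ENNReal.ofReal_mul (by positivity), Real.div_rpow ht.le (by norm_num),
      Real.rpow_neg (by norm_num : (0:ℝ) ≤ 2), div_inv_eq_mul, mul_comm]
  rw [e] at b1 b2
  have b1' := b1.trans (mul_le_mul_right (ENNReal.rpow_le_rpow c1 (by positivity : 0 ≤ 1/p)) _)
  have b2' := b2.trans (mul_le_mul_right (ENNReal.rpow_le_rpow c2 (by positivity : 0 ≤ 1/p)) _)
  have b3 : ∫⁻ τ in Set.Icc (t/2) 1, ENNReal.ofReal |vb v l τ| ≤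
      ∫⁻ τ in Set.Icc (t/2) 1, ENNReal.ofReal (vb (fun x => |v x|) l τ) :=
    lintegral_mono fun τ => ENNReal.ofReal_le_ofReal (hvb τ)
  refine a.trans ((add_le_add (mul_le_mul_right (b3.trans b2') _) (mul_le_mul_right b1' _)).trans ?_)
  have hKK : ENNReal.ofReal K = (K.toNNReal : ℝ≥0∞) := rfl
  rw [NN, hKK]
  push_cast
  set A := SS G l β p ^ (1/p)
  set B := SS (fun x => |v x|) l β p ^ (1/p)
  set E := (D:ℝ≥0∞) * ((2 ^ k : ℝ).toNNReal * ENNReal.ofReal (t ^ (-k)))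
  calc 2 * (E * B) + K.toNNReal * (E * A) ≤ (2 + K.toNNReal) * (E * (A + B)) := by
        have h1 : E * B ≤ E * (A + B) := by gcongr; exact le_add_self
        have h2 : E * A ≤ E * (A + B) := by gcongr; exact le_self_add
        rw [add_mul]
        gcongr
    _ = _ := by ring

end Part5

section Part6

set_option linter.unusedSectionVars false
variable {ι : Type} [Fintype ι] [DecidableEq ι] {l : ι} {α K : ℝ} {v G : (ι → ℝ) → ℝ}

lemma upd_update (x : ι → ℝ) (i : ι) (e ξ : ℝ) :
    Function.update (Function.update x i e) i ξ = Function.update x i ξ := by simp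

lemma meas_upd (i : ι) (e : ℝ) : Measurable fun x : ι → ℝ => Function.update x i e := by
  have : Continuous fun x : ι → ℝ => Function.update x i e := continuous_id.update i continuous_const
  exact this.measurable

lemma Core.face_AA (H : Core l α K v G) {β₀ β₁ s : ℝ} (hβ : β₁ = β₀ + α) (h0 : 0 ≤ β₀)
    (hα : 1 ≤ α) (hs : 1 < s) {i : ι} {e : ℝ} (he : e = 0 ∨ e = 1) (hi : i = l → e = 1) :
    ∫⁻ x, ENNReal.ofReal (Function.update x i e l ^ β₀ * |ww v l (Function.update x i e)| ^ s) ∂(PP ι)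
      ≤ ENNReal.ofReal (1 + s + (β₁ + s * K)) * AA v G l β₀ β₁ s := by
  have hfc := ff_cont (l := l) H.hv H.hG h0 (by linarith : 0 ≤ β₁) hs.le
  have hK := H.hK
  have hsK : 0 ≤ s * K := by positivity
  rw [AA, ← lintegral_upd i hfc.measurable.ennreal_ofReal,
    ← lintegral_const_mul' _ _ ENNReal.ofReal_ne_top]
  refine lintegral_mono_ae ?_
  filter_upwards [PP_ae ι] with x hx
  have hxc : ∀ i, x i ∈ Set.Icc (0:ℝ) 1 := fun i => Set.Ioo_subset_Icc_self (hx i)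
  have heI : e ∈ Set.Icc (0:ℝ) 1 := by rcases he with rfl | rfl <;> simp
  have hy := upd_cube hxc i heI
  by_cases h : i = l
  · have he1 := hi h
    subst h
    have := H.line_top hβ h0 hα hs hy
    simp only [upd_update] at this
    subst he1
    simp only [Function.update_self, Real.one_rpow] at this ⊢
    exact this.trans (mul_le_mul_left (ENNReal.ofReal_le_ofReal (by linarith)) _)
  · have hyl : Function.update x i e l = x l := by simp [Ne.symm h]
    have := H.line_side hβ h0 hα hs hy (by rw [hyl]; exact (hx l).1) h
    simp only [upd_update] at this
    exact this.trans (mul_le_mul_left (ENNReal.ofReal_le_ofReal (by linarith)) _)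

lemma face_w (l : ι) (α K : ℝ) {β₀ β₁ s n p r : ℝ} (hβ : β₁ = β₀ + α) (h0 : 0 ≤ β₀)
    (hα : 1 ≤ α) (hn : n = Fintype.card ι) (hp : 1 < p) (hpn : p < n)
    (hβn : β₁ = (n - 1) * α) (hs : s = p * (n - 1) / (n - p)) (hr : 1 < r) (hrs : r ≤ s) :
    ∃ C : NNReal, ∀ v G : (ι → ℝ) → ℝ, Core l α K v G → ∀ (i : ι) (e : ℝ), (e = 0 ∨ e = 1) →
      (i = l → e = 1) →
     ∫⁻ x, ENNReal.ofReal (Function.update x i e l ^ β₀) *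
       ENNReal.ofReal |ww v l (Function.update x i e)| ^ r ∂(PP ι) ≤ C * NN v G l β₁ p ^ r := by
  obtain ⟨C, hC⟩ := main_AA l α K hβ h0 hα hn hp hpn hβn hs
  have hs1 : 1 < s := by linarith
  have hr0 : 0 < r := by linarith
  have hs0 : 0 < s := by linarith
  have hp0 : 0 < p := by linarith
  have hrs0 : 0 < r / s := by positivity
  have hrs1 : r / s ≤ 1 := by rw [div_le_one hs0]; exact hrs
  set c1 : NNReal := (1 + s + (β₁ + s * K)).toNNReal with hc1
  refine ⟨(c1 * C) ^ (r/s), fun v G H i e he hi => ?_⟩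
  have h1 := H.face_AA hβ h0 hα hs1 he hi
  have h2 := hC v G H
  have hym := meas_upd (ι := ι) i e
  have hyl : Measurable fun x : ι → ℝ => Function.update x i e l :=
    (measurable_pi_apply l).comp hym
  have hwm : Measurable fun x : ι → ℝ => |ww v l (Function.update x i e)| :=
    (ww_cont H.hv).abs.measurable.comp hym
  have hm : Measurable fun x => ENNReal.ofReal (Function.update x i e l ^ β₀ * |ww v l (Function.update x i e)| ^ s) :=
    ((hyl.pow_const _).mul (hwm.pow_const _)).ennreal_ofReal
  calc _ ≤ ∫⁻ x, ENNReal.ofReal (Function.update x i e l ^ β₀ * |ww v l (Function.update x i e)| ^ s)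
          ^ (r/s) ∂(PP ι) := by
        refine lintegral_mono_ae ?_
        filter_upwards [PP_ae ι] with x hx
        have hxc : ∀ i, x i ∈ Set.Icc (0:ℝ) 1 := fun i => Set.Ioo_subset_Icc_self (hx i)
        have heI : e ∈ Set.Icc (0:ℝ) 1 := by rcases he with rfl | rfl <;> simp
        have hy := upd_cube hxc i heI l
        set t := Function.update x i e l
        set W := |ww v l (Function.update x i e)|
        have hW : 0 ≤ W := abs_nonneg _
        have ht : 0 ≤ t ^ β₀ := Real.rpow_nonneg hy.1 _
        have ht1 : t ^ β₀ ≤ 1 := Real.rpow_le_one hy.1 hy.2 h0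
        have ht2 : t ^ β₀ ≤ (t ^ β₀) ^ (r/s) := Real.self_le_rpow_of_le_one ht ht1 hrs1
        rw [ENNReal.ofReal_rpow_of_nonneg hW hr0.le, ← ENNReal.ofReal_mul ht,
          ENNReal.ofReal_rpow_of_nonneg (by positivity) hrs0.le, Real.mul_rpow ht (by positivity),
          ← Real.rpow_mul hW, mul_div_cancel₀ _ hs0.ne']
        apply ENNReal.ofReal_le_ofReal
        gcongr
    _ ≤ (∫⁻ x, ENNReal.ofReal (Function.update x i e l ^ β₀ * |ww v l (Function.update x i e)| ^ s)
         ∂(PP ι)) ^ (r/s) := jensen_le _ hrs0 hrs1 hm.aemeasurable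
    _ ≤ (c1 * (C * SS G l β₁ p ^ (s/p))) ^ (r/s) := by
        gcongr
        exact h1.trans (mul_le_mul_right h2 _)
    _ = ((c1 * C) ^ (r/s) : NNReal) * (SS G l β₁ p ^ (1/p)) ^ r := by
        rw [← mul_assoc, ENNReal.mul_rpow_of_nonneg _ _ hrs0.le, ← ENNReal.rpow_mul,
          ← ENNReal.rpow_mul, ENNReal.coe_rpow_of_nonneg _ hrs0.le]
        push_cast
        congr 2
        field_simp
    _ ≤ _ := by
        gcongr
        exact le_self_add

lemma face_b (l : ι) (α K : ℝ) {β₀ β₁ p r : ℝ} (hp : 1 < p) (hβ : p - 1 < β₁) (hr : 1 < r)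
    (hrr : -1 < β₀ - r * ((β₁ + 1 - p) / p)) :
    ∃ C : NNReal, ∀ v G : (ι → ℝ) → ℝ, Core l α K v G → ∀ (i : ι) (e : ℝ), (e = 0 ∨ e = 1) →
      (i = l → e = 1) →
     ∫⁻ x, ENNReal.ofReal (Function.update x i e l ^ β₀) *
       ENNReal.ofReal |vb v l (Function.update x i e l)| ^ r ∂(PP ι) ≤ C * NN v G l β₁ p ^ r := by
  obtain ⟨D, hD⟩ := vb_pt l α K hp hβ
  set k := (β₁ + 1 - p) / p with hk
  set J : ℝ≥0∞ := 1 + ∫⁻ t, ENNReal.ofReal (t ^ (β₀ - r * k)) ∂lam with hJ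
  have hr0 : 0 < r := by linarith
  have hJt : J ≠ ⊤ := by
    refine ENNReal.add_ne_top.2 ⟨by simp, ?_⟩
    have hi : IntegrableOn (fun t : ℝ => t ^ (β₀ - r * k)) (Set.Icc 0 1) := by
      have := intervalIntegral.intervalIntegrable_rpow' (a := 0) (b := 1) hrr
      rw [intervalIntegrable_iff_integrableOn_Icc_of_le zero_le_one] at this
      exact this
    exact hi.lintegral_lt_top.ne
  refine ⟨D ^ r * J.toNNReal, fun v G H i e he hi => ?_⟩
  have hJ2 : ∫⁻ x, ENNReal.ofReal (Function.update x i e l ^ (β₀ - r * k)) ∂(PP ι) ≤ J := by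
    by_cases h : i = l
    · rw [hi h, h]; simp [hJ]
    · have : ∀ x : ι → ℝ, Function.update x i e l = x l := fun x => by simp [Ne.symm h]
      simp only [this]
      have hm : Measurable fun t : ℝ => ENNReal.ofReal (t ^ (β₀ - r * k)) :=
        (measurable_id.pow_const _).ennreal_ofReal
      have := (mp_eval l).lintegral_comp hm
      simp only [Function.eval] at this
      rw [this]; exact le_add_self
  have hym := meas_upd (ι := ι) i e
  have hyl : Measurable fun x : ι → ℝ => Function.update x i e l :=
    (measurable_pi_apply l).comp hym
  calc _ ≤ ∫⁻ x, ENNReal.ofReal (Function.update x i e l ^ (β₀ - r * k)) *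
        ((D : ℝ≥0∞) ^ r * NN v G l β₁ p ^ r) ∂(PP ι) := by
        refine lintegral_mono_ae ?_
        filter_upwards [PP_ae ι] with x hx
        have hy : 0 < Function.update x i e l ∧ Function.update x i e l ≤ 1 := by
          by_cases h : i = l
          · rw [hi h, h]; simp
          · have : Function.update x i e l = x l := by simp [Ne.symm h]
            rw [this]; exact ⟨(hx l).1, (hx l).2.le⟩
        have hh := hD v G H _ hy.1 hy.2
        set t := Function.update x i e l
        have ht := hy.1
        refine (mul_le_mul_right (ENNReal.rpow_le_rpow hh hr0.le) _).trans (le_of_eq ?_)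
        rw [ENNReal.mul_rpow_of_nonneg _ _ hr0.le, ENNReal.mul_rpow_of_nonneg _ _ hr0.le,
          ENNReal.ofReal_rpow_of_pos (by positivity), ← Real.rpow_mul ht.le]
        have : t ^ (β₀ - r * k) = t ^ β₀ * t ^ (-k * r) := by
          rw [← Real.rpow_add ht]; congr 1; ring
        rw [this, ENNReal.ofReal_mul (by positivity)]
        ring
    _ = (∫⁻ x, ENNReal.ofReal (Function.update x i e l ^ (β₀ - r * k)) ∂(PP ι)) *
        ((D : ℝ≥0∞) ^ r * NN v G l β₁ p ^ r) := 
        lintegral_mul_const _ (hyl.pow_const _).ennreal_ofReal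
    _ ≤ J * ((D : ℝ≥0∞) ^ r * NN v G l β₁ p ^ r) := by gcongr
    _ = _ := by
        push_cast
        rw [ENNReal.coe_toNNReal hJt, ENNReal.coe_rpow_of_nonneg _ hr0.le]
        ring

/-- The face estimate on the unit cube. -/
theorem face_main (l : ι) (α K : ℝ) {β₀ β₁ s n p r : ℝ} (hβ : β₁ = β₀ + α) (h0 : 0 ≤ β₀)
    (hα : 1 ≤ α) (hn : n = Fintype.card ι) (hp : 1 < p) (hpn : p < n)
    (hβn : β₁ = (n - 1) * α) (hs : s = p * (n - 1) / (n - p)) (hr : 1 < r) (hrs : r ≤ s)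
    (hβp : p - 1 < β₁) (hrr : -1 < β₀ - r * ((β₁ + 1 - p) / p)) :
    ∃ C : NNReal, ∀ v G : (ι → ℝ) → ℝ, Core l α K v G → ∀ (i : ι) (e : ℝ), (e = 0 ∨ e = 1) →
      (i = l → e = 1) →
     ∫⁻ x, ENNReal.ofReal (Function.update x i e l ^ β₀) *
       ENNReal.ofReal (|v (Function.update x i e)| ^ r) ∂(PP ι) ≤ C * NN v G l β₁ p ^ r := by
  obtain ⟨C1, h1⟩ := face_w l α K hβ h0 hα hn hp hpn hβn hs hr hrs
  obtain ⟨C2, h2⟩ := face_b l α K (β₀ := β₀) hp hβp hr hrr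
  have hr0 : 0 ≤ r := by linarith
  refine ⟨2 ^ (r-1) * (C1 + C2), fun v G H i e he hi => ?_⟩
  have a1 := h1 v G H i e he hi
  have a2 := h2 v G H i e he hi
  have hym := meas_upd (ι := ι) i e
  have hyl : Measurable fun x : ι → ℝ => Function.update x i e l :=
    (measurable_pi_apply l).comp hym
  have hwm : Measurable fun x : ι → ℝ => |ww v l (Function.update x i e)| :=
    (ww_cont H.hv).abs.measurable.comp hym
  have hm : Measurable fun x => ENNReal.ofReal (Function.update x i e l ^ β₀) *
       ENNReal.ofReal |ww v l (Function.update x i e)| ^ r :=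
    (hyl.pow_const _).ennreal_ofReal.mul (hwm.ennreal_ofReal.pow_const _)
  have h2t : (2:ℝ≥0∞) ^ (r-1) ≠ ⊤ := by simp
  calc _ ≤ ∫⁻ x, 2 ^ (r-1) * (ENNReal.ofReal (Function.update x i e l ^ β₀) *
       ENNReal.ofReal |ww v l (Function.update x i e)| ^ r +
        ENNReal.ofReal (Function.update x i e l ^ β₀) *
       ENNReal.ofReal |vb v l (Function.update x i e l)| ^ r) ∂(PP ι) := by
        refine lintegral_mono fun x => ?_
        set y := Function.update x i e
        have : v y = ww v l y + vb v l (y l) := by simp [ww]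
        have h3 : ENNReal.ofReal (|v y| ^ r) ≤ 2 ^ (r-1) *
            (ENNReal.ofReal |ww v l y| ^ r + ENNReal.ofReal |vb v l (y l)| ^ r) := by
          rw [← ENNReal.ofReal_rpow_of_nonneg (abs_nonneg _) hr0]
          refine le_trans (ENNReal.rpow_le_rpow ?_ hr0)
            (ENNReal.rpow_add_le_mul_rpow_add_rpow _ _ hr.le)
          rw [← ENNReal.ofReal_add (abs_nonneg _) (abs_nonneg _), this]
          exact ENNReal.ofReal_le_ofReal (abs_add_le _ _)
        refine (mul_le_mul_right h3 _).trans (le_of_eq ?_)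
        ring
    _ = 2 ^ (r-1) * ((∫⁻ x, ENNReal.ofReal (Function.update x i e l ^ β₀) *
       ENNReal.ofReal |ww v l (Function.update x i e)| ^ r ∂(PP ι)) + ∫⁻ x,
        ENNReal.ofReal (Function.update x i e l ^ β₀) *
       ENNReal.ofReal |vb v l (Function.update x i e l)| ^ r ∂(PP ι)) := by
        rw [lintegral_const_mul' _ _ h2t, lintegral_add_left hm]
    _ ≤ 2 ^ (r-1) * (C1 * NN v G l β₁ p ^ r + C2 * NN v G l β₁ p ^ r) := by gcongr
    _ = _ := by
        push_cast
        rw [← add_mul, mul_assoc, ENNReal.coe_rpow_of_ne_zero (by norm_num)]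
        simp
end Part6

section Part7


def Phi {ι : Type} [DecidableEq ι] (l : ι) (α : ℝ) (x : ι → ℝ) : ι → ℝ :=
  fun i => if i = l then x l else x l ^ α * x i

abbrev ins {m : ℕ} (i : Fin (m+1)) (t : ℝ) (z : Fin m → ℝ) : Fin (m+1) → ℝ :=
  Fin.insertNth (α := fun _ => ℝ) i t z

lemma Phi_ins {m : ℕ} (α t : ℝ) (z : Fin m → ℝ) :
    Phi (Fin.last m) α (ins (Fin.last m) t z) = ins (Fin.last m) t (t ^ α • z) := by
  refine Fin.eq_insertNth_iff.2 ⟨?_, ?_⟩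
  · simp [Phi]
  · funext j
    have h : (Fin.last m).succAbove j ≠ Fin.last m := Fin.succAbove_ne _ _
    simp [Phi, Fin.removeNth]

lemma lint_fin {m : ℕ} (i : Fin (m+1)) {f : (Fin (m+1) → ℝ) → ℝ≥0∞} (hf : Measurable f)
    (μ : Measure ℝ) [SigmaFinite μ] :
    ∫⁻ x, f x ∂(Measure.pi fun _ => μ) = 
      ∫⁻ t, ∫⁻ z, f (ins i t z) ∂(Measure.pi fun _ => μ) ∂μ := by
  have h := (measurePreserving_piFinSuccAbove (fun _ : Fin (m+1) => μ) i).symm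
  rw [← h.lintegral_comp hf, lintegral_prod]
  · rfl
  · exact (hf.comp h.measurable).aemeasurable

lemma meas_ins {m : ℕ} (i : Fin (m+1)) :
    Measurable fun q : ℝ × (Fin m → ℝ) => ins i q.1 q.2 :=
  (MeasurableEquiv.piFinSuccAbove (fun _ => ℝ) i).symm.measurable

lemma cov {m : ℕ} (α : ℝ) {f : (Fin (m+1) → ℝ) → ℝ≥0∞} (hf : Measurable f)
    (hf0 : ∀ x, x (Fin.last m) ≤ 0 → f x = 0) :
    ∫⁻ x, f x = ∫⁻ x, ENNReal.ofReal (x (Fin.last m) ^ (m * α)) * f (Phi (Fin.last m) α x)  := by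
  have hP : Measurable (Phi (Fin.last m) α) := by
    refine measurable_pi_lambda _ fun i => ?_
    unfold Phi
    split_ifs
    · exact measurable_pi_apply _
    · exact ((measurable_pi_apply _).pow_const _).mul (measurable_pi_apply _)
  have hm : Measurable fun x : Fin (m+1) → ℝ =>
      ENNReal.ofReal (x (Fin.last m) ^ (m * α)) * f (Phi (Fin.last m) α x) :=
    (meas_pow _ _).mul (hf.comp hP)
  rw [volume_pi, lint_fin (Fin.last m) hf, lint_fin (Fin.last m) hm]
  refine lintegral_congr fun t => ?_
  by_cases ht : t ≤ 0
  · have h1 : ∀ z : Fin m → ℝ, f (ins (Fin.last m) t z) = 0 := fun z => hf0 _ (by simpa using ht)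
    simp only [Phi_ins, h1]; simp
  push Not at ht
  simp only [Phi_ins, Fin.insertNth_apply_same]
  rw [lintegral_const_mul' _ _ ENNReal.ofReal_ne_top]
  have hc : t ^ α ≠ 0 := by positivity
  have hg : Measurable fun z : Fin m → ℝ => f (ins (Fin.last m) t z) :=
    hf.comp ((meas_ins _).comp (measurable_const.prodMk measurable_id))
  have h := Measure.map_addHaar_smul (volume : Measure (Fin m → ℝ)) hc
  have h2 : ∫⁻ z, f (ins (Fin.last m) t z) ∂(Measure.map (t ^ α • ·) (volume : Measure (Fin m → ℝ)))
      = ∫⁻ z, f (ins (Fin.last m) t (t ^ α • z)) :=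
    lintegral_map hg (measurable_const_smul _)
  rw [h, lintegral_smul_measure, Module.finrank_fin_fun] at h2
  change _ = _ * (∫⁻ z, f (ins (Fin.last m) t (t ^ α • z)))
  rw [← h2, smul_eq_mul, ← mul_assoc, ← ENNReal.ofReal_mul (by positivity), abs_of_pos (by positivity),
    mul_comm (m:ℝ), Real.rpow_mul ht.le, Real.rpow_natCast, mul_inv_cancel₀ (by positivity)]
  simp [volume_pi]

def OO (m : ℕ) (α : ℝ) : Set (Fin (m+1) → ℝ) :=
  {x | 0 < x (Fin.last m) ∧ x (Fin.last m) < 1 ∧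
    ∀ i, i ≠ Fin.last m → 0 < x i ∧ x i < x (Fin.last m) ^ α}
def OC (m : ℕ) (α : ℝ) : Set (Fin (m+1) → ℝ) :=
  {x | 0 < x (Fin.last m) ∧ x (Fin.last m) ≤ 1 ∧
    ∀ i, i ≠ Fin.last m → 0 ≤ x i ∧ x i ≤ x (Fin.last m) ^ α}

lemma meas_OO (m : ℕ) (α : ℝ) : MeasurableSet (OO m α) := by
  have e : OO m α = {x | 0 < x (Fin.last m)} ∩ ({x | x (Fin.last m) < 1} ∩
      ⋂ i, ⋂ (_ : i ≠ Fin.last m), ({x | 0 < x i} ∩ {x | x i < x (Fin.last m) ^ α})) := by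
    ext x; simp [OO]
  rw [e]
  refine (measurableSet_lt measurable_const (measurable_pi_apply _)).inter
    ((measurableSet_lt (measurable_pi_apply _) measurable_const).inter
    (MeasurableSet.iInter fun i => MeasurableSet.iInter fun _ =>
     (measurableSet_lt measurable_const (measurable_pi_apply _)).inter
     (measurableSet_lt (measurable_pi_apply _) ((measurable_pi_apply _).pow_const _))))

lemma meas_OC (m : ℕ) (α : ℝ) : MeasurableSet (OC m α) := by
  have e : OC m α = {x | 0 < x (Fin.last m)} ∩ ({x | x (Fin.last m) ≤ 1} ∩
      ⋂ i, ⋂ (_ : i ≠ Fin.last m), ({x | 0 ≤ x i} ∩ {x | x i ≤ x (Fin.last m) ^ α})) := by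
    ext x; simp [OC]
  rw [e]
  refine (measurableSet_lt measurable_const (measurable_pi_apply _)).inter
    ((measurableSet_le (measurable_pi_apply _) measurable_const).inter
    (MeasurableSet.iInter fun i => MeasurableSet.iInter fun _ =>
     (measurableSet_le measurable_const (measurable_pi_apply _)).inter
     (measurableSet_le (measurable_pi_apply _) ((measurable_pi_apply _).pow_const _))))

lemma cov_OO {m : ℕ} (α : ℝ) {f : (Fin (m+1) → ℝ) → ℝ≥0∞} (hf : Measurable f) :
    ∫⁻ x, ENNReal.ofReal (x (Fin.last m) ^ (m * α)) * f (Phi (Fin.last m) α x) ∂(PP (Fin (m+1)))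
     ≤ ∫⁻ x in OO m α, f x := by
  rw [← lintegral_indicator (meas_OO m α), cov α (hf.indicator (meas_OO m α))]
  · rw [PP_eq', ← lintegral_indicator (MeasurableSet.univ_pi fun _ => measurableSet_Ioo)]
    refine lintegral_mono fun x => ?_
    by_cases hx : x ∈ Set.univ.pi fun _ : Fin (m+1) => Set.Ioo (0:ℝ) 1
    · have hx' : ∀ i, 0 < x i ∧ x i < 1 := fun i => hx i (Set.mem_univ i)
      rw [Set.indicator_of_mem hx, Set.indicator_of_mem]
      have h0 := (hx' (Fin.last m)).1
      refine ⟨by simpa [Phi] using h0, by simpa [Phi] using (hx' _).2, fun i hi => ?_⟩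
      have hpos : 0 < x (Fin.last m) ^ α := by positivity
      simp only [Phi, hi, if_false, if_true]
      exact ⟨mul_pos hpos (hx' i).1, mul_lt_of_lt_one_right hpos (hx' i).2⟩
    · rw [Set.indicator_of_notMem hx]; exact zero_le
  · intro x hx
    exact Set.indicator_of_notMem (fun h => absurd h.1 (not_lt.2 hx)) _

lemma cov_OC {m : ℕ} (α : ℝ) {f : (Fin (m+1) → ℝ) → ℝ≥0∞} (hf : Measurable f) :
    ∫⁻ x in OC m α, f x ≤ 
    ∫⁻ x, ENNReal.ofReal (x (Fin.last m) ^ (m * α)) * f (Phi (Fin.last m) α x) ∂(PP (Fin (m+1))) := by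
  rw [← lintegral_indicator (meas_OC m α), cov α (hf.indicator (meas_OC m α))]
  · rw [PP_eq, ← lintegral_indicator (MeasurableSet.univ_pi fun _ => measurableSet_Icc)]
    refine lintegral_mono fun x => ?_
    by_cases hx : Phi (Fin.last m) α x ∈ OC m α
    · have hx2 := hx
      obtain ⟨h0, h1, h2⟩ := hx
      simp only [Phi, if_true] at h0 h1 h2
      have hpos : 0 < x (Fin.last m) ^ α := by positivity
      rw [Set.indicator_of_mem hx2, Set.indicator_of_mem]
      intro i _
      by_cases hi : i = Fin.last m
      · rw [hi]; exact ⟨h0.le, h1⟩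
      · have := h2 i hi
        simp only [hi, if_false] at this
        exact ⟨nonneg_of_mul_nonneg_right this.1 hpos, by
          by_contra hc; push Not at hc; nlinarith⟩
    · rw [Set.indicator_of_notMem hx]; simp
  · intro x hx
    exact Set.indicator_of_notMem (fun h => absurd h.1 (not_lt.2 hx)) _

lemma PP_ins {m : ℕ} (i : Fin (m+1)) (e : ℝ) {f : (Fin (m+1) → ℝ) → ℝ≥0∞} (hf : Measurable f) :
    ∫⁻ z, f (ins i e z) ∂(PP (Fin m)) = ∫⁻ x, f (Function.update x i e) ∂(PP (Fin (m+1))) := by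
  have h := lint_fin i (hf.comp (meas_upd i e)) lam
  simp only [Function.comp, ins, Fin.update_insertNth] at h
  simp only [PP]
  rw [h]
  simp

lemma haus {m n : ℕ} {K : NNReal} {B : Set (Fin m → ℝ)} (hB : MeasurableSet B)
    {ψ : (Fin m → ℝ) → EuclideanSpace ℝ (Fin n)} (hψ : Measurable ψ) (hL : LipschitzOnWith K ψ B)
    (F : EuclideanSpace ℝ (Fin n) → ℝ≥0∞) (hF : Measurable F) :
    ∫⁻ x in ψ '' B, F x ∂μH[(m:ℝ)] ≤ (K : ℝ≥0∞) ^ m * ∫⁻ z in B, F (ψ z) := by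
  have key : (μH[(m:ℝ)] : Measure (EuclideanSpace ℝ (Fin n))).restrict (ψ '' B) ≤
      ((K : ℝ≥0∞) ^ m) • Measure.map ψ (volume.restrict B) := by
    refine Measure.le_iff.2 fun S hS => ?_
    rw [Measure.restrict_apply hS, Measure.smul_apply, Measure.map_apply hψ hS,
      Measure.restrict_apply (hψ hS), smul_eq_mul]
    have e : S ∩ ψ '' B = ψ '' (ψ ⁻¹' S ∩ B) := by rw [Set.image_preimage_inter]
    rw [e]
    have h := (hL.mono (Set.inter_subset_right : ψ ⁻¹' S ∩ B ⊆ B)).hausdorffMeasure_image_le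
      (d := m) (by positivity)
    rw [ENNReal.rpow_natCast] at h
    have hv := hausdorffMeasure_pi_real (ι := Fin m)
    rw [Fintype.card_fin] at hv
    rwa [hv] at h
  refine (lintegral_mono' key le_rfl).trans ?_
  rw [lintegral_smul_measure, lintegral_map hF hψ, smul_eq_mul]
end Part7

section Part8


abbrev EE (n : ℕ) := EuclideanSpace ℝ (Fin n)

def LL (n : ℕ) : (Fin n → ℝ) →L[ℝ] EE n :=
  ((PiLp.continuousLinearEquiv 2 ℝ (fun _ : Fin n => ℝ)).symm : (Fin n → ℝ) →L[ℝ] EE n)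

lemma LL_apply (n : ℕ) (x : Fin n → ℝ) : LL n x = WithLp.toLp 2 x := rfl

lemma Phi_cont {ι : Type} [DecidableEq ι] (l : ι) {α : ℝ} (hα : 0 ≤ α) :
    Continuous (Phi l α) := by
  refine continuous_pi fun i => ?_
  unfold Phi
  split_ifs
  · exact continuous_apply _
  · exact ((Real.continuous_rpow_const hα).comp (continuous_apply l)).mul (continuous_apply i)

lemma Phi_deriv_ne {ι : Type} [Fintype ι] [DecidableEq ι] {l i : ι} (α : ℝ) (hi : i ≠ l) (x : ι → ℝ) :
    HasDerivAt (fun ξ => Phi l α (Function.update x i ξ)) (Pi.single i (x l ^ α)) (x i) := by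
  refine hasDerivAt_pi.2 fun j => ?_
  by_cases hj : j = l
  · subst hj
    simp only [Phi, if_true, Function.update_of_ne hi.symm]
    rw [Pi.single_eq_of_ne hi.symm]
    exact hasDerivAt_const _ _
  · simp only [Phi, hj, if_false, Function.update_of_ne hi.symm]
    by_cases hji : j = i
    · subst hji
      simp only [Function.update_self, Pi.single_eq_same]
      simpa using (hasDerivAt_id (x j)).const_mul (x l ^ α)
    · simp only [Function.update_of_ne hji]
      rw [Pi.single_eq_of_ne hji]
      exact hasDerivAt_const _ _

lemma Phi_deriv_eq {ι : Type} [Fintype ι] [DecidableEq ι] {l : ι} (α : ℝ) (x : ι → ℝ) (hx : 0 < x l) :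
    HasDerivAt (fun ξ => Phi l α (Function.update x l ξ))
      (fun j => if j = l then 1 else α * x l ^ (α - 1) * x j) (x l) := by
  refine hasDerivAt_pi.2 fun j => ?_
  by_cases hj : j = l
  · subst hj
    simp only [Phi, if_true, Function.update_self]
    exact hasDerivAt_id _
  · simp only [Phi, hj, if_false, Function.update_self, Function.update_of_ne hj]
    exact (Real.hasDerivAt_rpow_const (Or.inl hx.ne')).mul_const (x j)

lemma core_u {m : ℕ} {α : ℝ} (hα : 1 ≤ α) {u : EE (m+1) → ℝ} (hu : ContDiff ℝ 1 u) :
    Core (Fin.last m) α (‖LL (m+1)‖ * α) (fun x => u (LL _ (Phi (Fin.last m) α x)))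
      (fun x => ‖fderiv ℝ u (LL _ (Phi (Fin.last m) α x))‖) := by
  have hα0 : 0 ≤ α := by linarith
  have hc : Continuous fun x => LL (m+1) (Phi (Fin.last m) α x) :=
    (LL _).continuous.comp (Phi_cont _ hα0)
  have hd : ∀ y, HasFDerivAt u (fderiv ℝ u y) y := fun y =>
    (hu.differentiable (by norm_num) y).hasFDerivAt
  have D : ∀ (x : Fin (m+1) → ℝ) i w, 
      HasDerivAt (fun ξ => Phi (Fin.last m) α (Function.update x i ξ)) w (x i) →
      HasDerivAt (fun ξ => u (LL _ (Phi (Fin.last m) α (Function.update x i ξ))))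
        (fderiv ℝ u (LL _ (Phi (Fin.last m) α x)) (LL _ w)) (x i) := by
    intro x i w h
    have h1 := (LL (m+1)).hasFDerivAt.comp_hasDerivAt (x i) h
    have h2 := hd (LL _ (Phi (Fin.last m) α (Function.update x i (x i))))
    have h3 := h2.comp_hasDerivAt (x i) h1
    simpa [Function.comp_def] using h3
  refine ⟨hu.continuous.comp hc, ((hu.continuous_fderiv (by norm_num)).comp hc).norm,
    fun x => norm_nonneg _, by positivity, ?_, ?_, ?_⟩
  · intro x hx hl i
    by_cases hi : i = Fin.last m
    · subst hi
      exact (D x _ _ (Phi_deriv_eq α x hl)).differentiableAt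
    · exact (D x _ _ (Phi_deriv_ne α hi x)).differentiableAt
  · intro x hx hl i hi
    rw [(D x _ _ (Phi_deriv_ne α hi x)).deriv, ← Real.norm_eq_abs, mul_comm]
    refine (ContinuousLinearMap.le_opNorm _ _).trans ?_
    gcongr
    rw [LL_apply]
    have : WithLp.toLp 2 (Pi.single i (x (Fin.last m) ^ α)) =
      EuclideanSpace.single i (x (Fin.last m) ^ α) := rfl
    rw [this, EuclideanSpace.norm_single, Real.norm_eq_abs, abs_of_nonneg (by positivity)]
  · intro x hx hl
    rw [(D x _ _ (Phi_deriv_eq α x hl)).deriv, ← Real.norm_eq_abs, mul_comm (‖LL (m+1)‖ * α)]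
    refine (ContinuousLinearMap.le_opNorm _ _).trans ?_
    refine mul_le_mul_of_nonneg_left ?_ (norm_nonneg _)
    refine ((LL (m+1)).le_opNorm _).trans ?_
    refine mul_le_mul_of_nonneg_left ?_ (norm_nonneg _)
    refine (pi_norm_le_iff_of_nonneg hα0).2 fun j => ?_
    split_ifs
    · simpa using hα
    · have h1 : x (Fin.last m) ^ (α - 1) ≤ 1 := Real.rpow_le_one hl.le (hx _).2 (by linarith)
      have h2 : 0 ≤ x (Fin.last m) ^ (α - 1) := by positivity
      rw [Real.norm_eq_abs, abs_of_nonneg (mul_nonneg (by positivity) (hx j).1)]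
      calc _ ≤ α * 1 * 1 := by
            have := (hx j).2
            have := (hx j).1
            gcongr
        _ = α := by ring

lemma rpow_lip {α : ℝ} (hα : 1 ≤ α) {a b : ℝ} (ha : a ∈ Set.Icc (0:ℝ) 1) (hb : b ∈ Set.Icc (0:ℝ) 1) :
    |a ^ α - b ^ α| ≤ α * |a - b| := by
  have := Convex.norm_image_sub_le_of_norm_hasDerivWithin_le (𝕜 := ℝ) (f := fun x : ℝ => x ^ α)
    (f' := fun x => α * x ^ (α - 1)) (C := α) (s := Set.Icc 0 1) (x := b) (y := a)
    (fun x _ => (Real.hasDerivAt_rpow_const (Or.inr hα)).hasDerivWithinAt)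
    (fun x hx => ?_) (convex_Icc 0 1) hb ha
  · simpa using this
  · have h1 : x ^ (α - 1) ≤ 1 := Real.rpow_le_one hx.1 hx.2 (by linarith)
    have h2 : 0 ≤ x ^ (α - 1) := Real.rpow_nonneg hx.1 _
    rw [Real.norm_eq_abs, abs_of_nonneg (by positivity)]
    nlinarith

def psi (k : ℕ) (α : ℝ) (i : Fin (k+2)) (e : ℝ) (z : Fin (k+1) → ℝ) : EE (k+2) :=
  LL _ (ins i (e * z (Fin.last k) ^ α) z)

lemma psi_cont (k : ℕ) {α : ℝ} (hα : 0 ≤ α) (i : Fin (k+2)) (e : ℝ) : Continuous (psi k α i e) := by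
  refine (LL _).continuous.comp (continuous_pi ((Fin.forall_iff_succAbove i).2 ⟨?_, fun j => ?_⟩))
  · simp only [Fin.insertNth_apply_same]
    exact continuous_const.mul ((Real.continuous_rpow_const hα).comp (continuous_apply _))
  · simp only [Fin.insertNth_apply_succAbove]
    exact continuous_apply _

lemma psi_lip (k : ℕ) {α : ℝ} (hα : 1 ≤ α) (i : Fin (k+2)) {e : ℝ} (he : |e| ≤ 1)
    {B : Set (Fin (k+1) → ℝ)} (hB : ∀ z ∈ B, z (Fin.last k) ∈ Set.Icc (0:ℝ) 1) :
    LipschitzOnWith (‖LL (k+2)‖₊ * α.toNNReal) (psi k α i e) B := by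
  refine (LL (k+2)).lipschitz.comp_lipschitzOnWith (LipschitzOnWith.of_dist_le_mul fun z hz y hy => ?_)
  have hα0 : 0 ≤ α := by linarith
  rw [Real.coe_toNNReal _ hα0]
  refine (dist_pi_le_iff (by positivity)).2 ((Fin.forall_iff_succAbove i).2 ⟨?_, fun j => ?_⟩)
  · simp only [Fin.insertNth_apply_same]
    rw [Real.dist_eq, ← mul_sub, abs_mul]
    have h1 := rpow_lip hα (hB z hz) (hB y hy)
    have h2 := dist_le_pi_dist z y (Fin.last k)
    rw [Real.dist_eq] at h2
    calc _ ≤ 1 * (α * |z (Fin.last k) - y (Fin.last k)|) := by gcongr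
      _ ≤ _ := by rw [one_mul]; gcongr
  · simp only [Fin.insertNth_apply_succAbove]
    have h2 := dist_le_pi_dist z y j
    have h3 : 0 ≤ dist z y := dist_nonneg
    nlinarith

lemma psi_side (k : ℕ) (α : ℝ) {i : Fin (k+2)} (hi : i ≠ Fin.last (k+1)) (e : ℝ) (z : Fin (k+1) → ℝ) :
    psi k α i e (Phi (Fin.last k) α z) = LL _ (Phi (Fin.last (k+1)) α (ins i e z)) := by
  unfold psi
  congr 1
  symm
  have hl := Fin.succAbove_ne_last_last hi
  have hz : ins i e z (Fin.last (k+1)) = z (Fin.last k) := by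
    rw [← hl]; simp [ins]
  refine Fin.eq_insertNth_iff.2 ⟨?_, ?_⟩
  · simp only [Phi, hi, if_false, if_true]
    rw [hz]; simp [ins, mul_comm]
  · funext j
    simp only [Fin.removeNth, Phi]
    rw [hz]
    have : i.succAbove j = Fin.last (k+1) ↔ j = Fin.last k := by
      rw [← hl]; exact Fin.succAbove_right_inj
    simp only [this]
    simp [ins]

lemma psi_top (k : ℕ) (α : ℝ) (z : Fin (k+1) → ℝ) :
    LL _ (ins (Fin.last (k+1)) 1 z) = LL _ (Phi (Fin.last (k+1)) α (ins (Fin.last (k+1)) 1 z)) := by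
  rw [Phi_ins]; simp
end Part8

section Part9


lemma ae_zero_fr {k : ℕ} {α : ℝ} (hα : 0 < α) {Ω : Set (EE (k+2))}
    (hΩ : ∀ x : EE (k+2), x ∈ Ω ↔ (fun i => x i) ∈ OO (k+1) α) :
    IsOpen Ω ∧ frontier Ω ⊆ {0} ∪ ((fun z => LL _ (ins (Fin.last (k+1)) 1 z)) ''
        (Set.univ.pi fun _ : Fin (k+1) => Set.Icc (0:ℝ) 1) ∪
      ⋃ q : Fin (k+1) × Bool, psi k α q.1.castSucc (if q.2 then 1 else 0) '' OC k α) := by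
  have hc : ∀ i : Fin (k+2), Continuous fun x : EE (k+2) => x i := fun i => by fun_prop
  have hcp : Continuous fun x : EE (k+2) => x (Fin.last (k+1)) ^ α :=
    (Real.continuous_rpow_const hα.le).comp (hc _)
  have hop : IsOpen Ω := by
    have e : Ω = {x | 0 < x (Fin.last (k+1))} ∩ ({x | x (Fin.last (k+1)) < 1} ∩
      ⋂ i, ⋂ (_ : i ≠ Fin.last (k+1)), ({x | 0 < x i} ∩ {x | x i < x (Fin.last (k+1)) ^ α})) := by
      ext x; rw [hΩ]; simp [OO]
    rw [e]
    refine (isOpen_lt continuous_const (hc _)).inter ((isOpen_lt (hc _) continuous_const).inter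
      (isOpen_iInter_of_finite fun i => isOpen_iInter_of_finite fun _ =>
       (isOpen_lt continuous_const (hc _)).inter (isOpen_lt (hc _) hcp)))
  refine ⟨hop, fun x hx => ?_⟩
  have hcl : closure Ω ⊆ {x | 0 ≤ x (Fin.last (k+1))} ∩ ({x | x (Fin.last (k+1)) ≤ 1} ∩
      ⋂ i, ⋂ (_ : i ≠ Fin.last (k+1)), ({x | 0 ≤ x i} ∩ {x | x i ≤ x (Fin.last (k+1)) ^ α})) := by
    refine closure_minimal ?_ ?_
    · intro x hx
      obtain ⟨h1, h2, h3⟩ := (hΩ x).1 hx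
      simp only [Set.mem_inter_iff, Set.mem_ofPred_eq, Set.mem_iInter]
      exact ⟨h1.le, h2.le, fun i hi => ⟨(h3 i hi).1.le, (h3 i hi).2.le⟩⟩
    · exact (isClosed_le continuous_const (hc _)).inter ((isClosed_le (hc _) continuous_const).inter
       (isClosed_iInter fun i => isClosed_iInter fun _ =>
       (isClosed_le continuous_const (hc _)).inter (isClosed_le (hc _) hcp)))
  rw [hop.frontier_eq] at hx
  obtain ⟨hx1, hx2⟩ := hx
  have := hcl hx1
  simp only [Set.mem_inter_iff, Set.mem_ofPred_eq, Set.mem_iInter] at this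
  obtain ⟨h0, h1, h2⟩ := this
  rcases h0.eq_or_lt with h0' | h0'
  · left
    ext i
    by_cases hi : i = Fin.last (k+1)
    · rw [hi, ← h0']; rfl
    · have := h2 i hi
      rw [← h0', Real.zero_rpow hα.ne'] at this
      exact le_antisymm this.2 this.1
  right
  rcases h1.eq_or_lt with h1' | h1'
  · left
    refine ⟨fun j => x ((Fin.last (k+1)).succAbove j), fun j _ => ?_, ?_⟩
    · have := h2 ((Fin.last (k+1)).succAbove j) (Fin.succAbove_ne _ _)
      rwa [h1', Real.one_rpow] at this
    · change WithLp.toLp 2 _ = WithLp.toLp 2 (WithLp.ofLp x)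
      congr 1
      exact Fin.insertNth_eq_iff.2 ⟨h1'.symm, rfl⟩
  right
  rw [hΩ] at hx2
  have : ∃ i, i ≠ Fin.last (k+1) ∧ (x i = 0 ∨ x i = x (Fin.last (k+1)) ^ α) := by
    by_contra hcon
    push Not at hcon
    refine hx2 ⟨h0', h1', fun i hi => ?_⟩
    have := hcon i hi
    have h3 := h2 i hi
    exact ⟨lt_of_le_of_ne h3.1 this.1.symm, lt_of_le_of_ne h3.2 this.2⟩
  obtain ⟨i, hi, hxi⟩ := this
  obtain ⟨j, rfl⟩ := Fin.exists_castSucc_eq.2 hi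
  have hl := Fin.succAbove_ne_last_last hi
  have key : ∀ e : ℝ, x j.castSucc = e * x (Fin.last (k+1)) ^ α → x ∈ psi k α j.castSucc e '' OC k α := by
    intro e he
    refine ⟨fun q => x (j.castSucc.succAbove q), ⟨?_, ?_, ?_⟩, ?_⟩
    · beta_reduce; rw [hl]; exact h0'
    · beta_reduce; rw [hl]; exact h1
    · intro q hq
      beta_reduce; rw [hl]
      exact h2 _ (by rw [← hl]; exact fun h => hq (Fin.succAbove_right_inj.1 h))
    · unfold psi
      rw [LL_apply]
      change WithLp.toLp 2 _ = WithLp.toLp 2 (WithLp.ofLp x)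
      congr 1
      refine Fin.insertNth_eq_iff.2 ⟨?_, rfl⟩
      beta_reduce; rw [hl]; exact he.symm
  refine Set.mem_iUnion.2 ?_
  rcases hxi with h | h
  · exact ⟨(j, false), by simpa using key 0 (by simpa using h)⟩
  · exact ⟨(j, true), by simpa using key 1 (by simpa using h)⟩

lemma side_bd {k : ℕ} {α : ℝ} (hα : 1 ≤ α) {i : Fin (k+2)} (hi : i ≠ Fin.last (k+1))
    {e : ℝ} (he : |e| ≤ 1) {F : EE (k+2) → ℝ≥0∞} (hF : Measurable F) :
    ∫⁻ x in psi k α i e '' OC k α, F x ∂μH[((k+1 : ℕ):ℝ)] ≤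
      ((‖LL (k+2)‖₊ * α.toNNReal : NNReal) : ℝ≥0∞) ^ (k+1) *
       ∫⁻ x, ENNReal.ofReal (Function.update x i e (Fin.last (k+1)) ^ (k * α)) *
         F (LL _ (Phi (Fin.last (k+1)) α (Function.update x i e))) ∂(PP (Fin (k+2))) := by
  have hα0 : 0 ≤ α := by linarith
  refine (haus (meas_OC k α) (psi_cont k hα0 i e).measurable
    (psi_lip k hα i he fun z hz => ⟨hz.1.le, hz.2.1⟩) F hF).trans ?_
  refine mul_le_mul_right ((cov_OC α (hF.comp (psi_cont k hα0 i e).measurable)).trans (le_of_eq ?_)) _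
  have hl := Fin.succAbove_ne_last_last hi
  have hm : Measurable fun x : Fin (k+2) → ℝ => ENNReal.ofReal (x (Fin.last (k+1)) ^ (k * α)) *
         F (LL _ (Phi (Fin.last (k+1)) α x)) :=
    (meas_pow _ _).mul (hF.comp ((LL _).continuous.comp (Phi_cont _ hα0)).measurable)
  rw [← PP_ins i e hm]
  refine lintegral_congr fun z => ?_
  have hz : ins i e z (Fin.last (k+1)) = z (Fin.last k) := by
    rw [← hl]; simp [ins]
  rw [hz, ← psi_side k α hi]; rfl

lemma top_bd {k : ℕ} {α : ℝ} (hα : 1 ≤ α) {F : EE (k+2) → ℝ≥0∞} (hF : Measurable F) (β : ℝ) :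
    ∫⁻ x in (fun z => LL _ (ins (Fin.last (k+1)) 1 z)) ''
        (Set.univ.pi fun _ : Fin (k+1) => Set.Icc (0:ℝ) 1), F x ∂μH[((k+1 : ℕ):ℝ)] ≤
      (‖LL (k+2)‖₊ : ℝ≥0∞) ^ (k+1) *
       ∫⁻ x, ENNReal.ofReal (Function.update x (Fin.last (k+1)) 1 (Fin.last (k+1)) ^ β) *
         F (LL _ (Phi (Fin.last (k+1)) α (Function.update x (Fin.last (k+1)) 1))) ∂(PP (Fin (k+2))) := by
  have hα0 : 0 ≤ α := by linarith
  have hL : LipschitzWith (‖LL (k+2)‖₊) (fun z => LL _ (ins (Fin.last (k+1)) 1 z)) := by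
    have : LipschitzWith 1 (fun z : Fin (k+1) → ℝ => ins (Fin.last (k+1)) 1 z) := by
      refine LipschitzWith.of_dist_le_mul fun z y => ?_
      refine (dist_pi_le_iff (by positivity)).2
        ((Fin.forall_iff_succAbove (Fin.last (k+1))).2 ⟨?_, fun j => ?_⟩)
      · simp only [Fin.insertNth_apply_same, dist_self]; positivity
      · simp only [Fin.insertNth_apply_succAbove]
        simpa using dist_le_pi_dist z y j
    have h := (LL (k+2)).lipschitz.comp this
    rw [mul_one] at h
    exact h
  refine (haus (MeasurableSet.univ_pi fun _ => measurableSet_Icc) hL.continuous.measurable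
    hL.lipschitzOnWith F hF).trans ?_
  refine mul_le_mul_right (le_of_eq ?_) _
  have hm : Measurable fun x : Fin (k+2) → ℝ => ENNReal.ofReal (x (Fin.last (k+1)) ^ β) *
         F (LL _ (Phi (Fin.last (k+1)) α x)) :=
    (meas_pow _ _).mul (hF.comp ((LL _).continuous.comp (Phi_cont _ hα0)).measurable)
  rw [← PP_ins (Fin.last (k+1)) 1 hm, ← PP_eq]
  refine lintegral_congr fun z => ?_
  rw [← psi_top]; simp [ins]

lemma vol_bd {m : ℕ} {α : ℝ} {Ω : Set (EE (m+1))}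
    (hΩ : ∀ x : EE (m+1), x ∈ Ω ↔ (fun i => x i) ∈ OO m α) (hm : MeasurableSet Ω)
    {g : EE (m+1) → ℝ} (hg : Continuous g) (hg0 : ∀ x, 0 ≤ g x) {β p : ℝ} (hβ : β = m * α)
    (hp : 0 ≤ p) :
    SS (fun x => g (LL _ (Phi (Fin.last m) α x))) (Fin.last m) β p ≤
      ∫⁻ x in Ω, ENNReal.ofReal (g x ^ p) := by
  have h1 : Measurable fun x => ENNReal.ofReal (g x ^ p) := (hg.measurable.pow_const p).ennreal_ofReal
  have h2 : Measurable fun y : Fin (m+1) → ℝ => ENNReal.ofReal (g (LL _ y) ^ p) :=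
    h1.comp (LL _).continuous.measurable
  have h := (PiLp.volume_preserving_toLp (Fin (m+1))).setLIntegral_comp_preimage hm h1
  rw [← h]
  have e : (WithLp.toLp 2 ⁻¹' Ω : Set (Fin (m+1) → ℝ)) = OO m α := by
    ext y; exact hΩ _
  rw [e]
  refine le_trans (le_of_eq ?_) (cov_OO α h2)
  unfold SS
  refine lintegral_congr fun x => ?_
  rw [hβ, ENNReal.ofReal_rpow_of_nonneg (hg0 _) hp]
  rfl
end Part9

/-- Unweighted trace inequality in the outward cuspidal domain:
`W^{1,p}(Ω_γ) → L^r(∂Ω_γ)` is bounded for `1 < r < p(1+(n-2)γ)/((γ-p)(n-1))`,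
stated on C¹ functions. -/
theorem unweighted_trace_embedding_bounded
    (n : ℕ) (hn : 2 ≤ n) (γ p r : ℝ)
    (hγ : (n : ℝ) < γ) (hp1 : 1 < p) (hpn : p < n)
    (hr1 : 1 < r)
    (hr2 : r < p * (1 + ((n : ℝ) - 2) * γ) / ((γ - p) * ((n : ℝ) - 1))) :
    ∃ C : ℝ, 0 < C ∧
      ∀ u : EuclideanSpace ℝ (Fin n) → ℝ, ContDiff ℝ 1 u →
        (∫⁻ x in frontier (cuspDomain n hn γ),
            ENNReal.ofReal (|u x| ^ r) ∂(μH[(n : ℝ) - 1])) ^ (1 / r)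
        ≤ ENNReal.ofReal C *
          ((∫⁻ x in cuspDomain n hn γ, ENNReal.ofReal (‖fderiv ℝ u x‖ ^ p)) ^ (1 / p) +
           (∫⁻ x in cuspDomain n hn γ, ENNReal.ofReal (|u x| ^ p)) ^ (1 / p)) := by
  obtain ⟨k, rfl⟩ : ∃ k, n = k + 2 := ⟨n - 2, by omega⟩
  set N : ℝ := ((k + 2 : ℕ) : ℝ) with hN
  have hN' : N = k + 2 := by rw [hN]; push_cast; ring
  have hk0 : (0:ℝ) ≤ k := Nat.cast_nonneg k
  have hp0 : 0 < p := by linarith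
  have hr0 : 0 < r := by linarith
  have hN1 : 0 < N - 1 := by linarith
  set α : ℝ := (γ - 1) / (N - 1) with hαd
  have hα : 1 ≤ α := by rw [hαd, le_div_iff₀ hN1]; linarith
  have hα0 : 0 < α := by linarith
  have hαγ : (N - 1) * α = γ - 1 := by rw [hαd]; field_simp
  have hγp : 0 < γ - p := by linarith
  have hNp : 0 < N - p := by linarith
  have hrs : r ≤ p * (N - 1) / (N - p) := by
    refine hr2.le.trans ?_
    rw [div_le_div_iff₀ (by positivity) hNp]
    have key : (1 + (N - 2) * γ) * (N - p) ≤ (N - 1) * ((γ - p) * (N - 1)) := by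
      have h1 : 0 ≤ (γ - N) * ((N - 1) * (N - 1) - (N - 2) * (N - p)) := by
        refine mul_nonneg (by linarith) ?_
        nlinarith
      nlinarith
    calc _ = p * ((1 + (N - 2) * γ) * (N - p)) := by ring
      _ ≤ p * ((N - 1) * ((γ - p) * (N - 1))) := by gcongr
      _ = _ := by ring
  have hrr : -1 < (k:ℝ) * α - r * (((N - 1) * α + 1 - p) / p) := by
    rw [lt_div_iff₀ (by positivity)] at hr2
    have e1 : (k:ℝ) * α = (N - 2) * (γ - 1) / (N - 1) := by
      rw [hαd, hN']; ring
    rw [hαγ, e1]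
    have e2 : γ - 1 + 1 - p = γ - p := by ring
    rw [e2]
    have h3 : r * ((γ - p) / p) < (1 + (N - 2) * γ) / (N - 1) := by
      rw [lt_div_iff₀ hN1, mul_div_assoc', div_mul_eq_mul_div, div_lt_iff₀ hp0]
      linarith
    have h4 : (1 + (N - 2) * γ) / (N - 1) = (N - 2) * (γ - 1) / (N - 1) + 1 := by
      field_simp; ring
    linarith
  obtain ⟨C, hC⟩ := face_main (ι := Fin (k+2)) (Fin.last (k+1)) α (‖LL (k+2)‖ * α)
    (β₀ := k * α) (β₁ := (N - 1) * α) (n := N) (p := p) (r := r)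
    (by rw [hN']; ring) (by positivity) hα (by rw [Fintype.card_fin]) hp1 hpn rfl rfl hr1 hrs
    (by rw [hαγ]; linarith) hrr
  have hΩ : ∀ x : EE (k+2), x ∈ cuspDomain (k+2) hn γ ↔ (fun i => x i) ∈ OO (k+1) α := by
    intro x
    have hlt : ∀ i : Fin (k+2), (i : ℕ) < k + 2 - 1 ↔ i ≠ Fin.last (k+1) := by
      intro i
      rw [Ne, Fin.ext_iff, Fin.val_last]
      have := i.2
      omega
    constructor
    · rintro ⟨h1, h2, h3⟩
      exact ⟨h1, h2, fun i hi => h3 i ((hlt i).2 hi)⟩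
    · rintro ⟨h1, h2, h3⟩
      exact ⟨h1, h2, fun i hi => h3 i ((hlt i).1 hi)⟩
  set Ω := cuspDomain (k+2) hn γ with hΩd
  obtain ⟨hop, hfr⟩ := ae_zero_fr hα0 hΩ
  set M : NNReal := ‖LL (k+2)‖₊ ^ (k+1) * C +
    ∑ _q : Fin (k+1) × Bool, (‖LL (k+2)‖₊ * α.toNNReal) ^ (k+1) * C with hM
  refine ⟨((M ^ (1/r) : NNReal) : ℝ) + 1, by positivity, fun u hu => ?_⟩
  have hdim : N - 1 = ((k+1 : ℕ) : ℝ) := by rw [hN']; push_cast; ring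
  rw [hdim]
  have hcore := core_u (m := k+1) hα hu
  have hF : Measurable fun x : EE (k+2) => ENNReal.ofReal (|u x| ^ r) :=
    (hu.continuous.abs.measurable.pow_const r).ennreal_ofReal
  have hfc := hC _ _ hcore
  set NV := NN (fun x => u (LL (k+2) (Phi (Fin.last (k+1)) α x)))
    (fun x => ‖fderiv ℝ u (LL (k+2) (Phi (Fin.last (k+1)) α x))‖) (Fin.last (k+1)) ((N-1)*α) p with hNV
  have hβm : (N - 1) * α = ((k+1 : ℕ):ℝ) * α := by rw [hdim]
  have hNle : NV ≤ (∫⁻ x in Ω, ENNReal.ofReal (‖fderiv ℝ u x‖ ^ p)) ^ (1 / p) +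
           (∫⁻ x in Ω, ENNReal.ofReal (|u x| ^ p)) ^ (1 / p) := by
    have h1 := vol_bd (m := k+1) hΩ hop.measurableSet (hu.continuous_fderiv (by norm_num)).norm
      (fun x => norm_nonneg _) hβm hp0.le
    have h2 := vol_bd (m := k+1) hΩ hop.measurableSet hu.continuous.abs
      (fun x => abs_nonneg _) hβm hp0.le
    exact add_le_add (ENNReal.rpow_le_rpow h1 (by positivity))
      (ENNReal.rpow_le_rpow h2 (by positivity))
  have hmain : ∫⁻ x in frontier Ω, ENNReal.ofReal (|u x| ^ r) ∂(μH[((k+1 : ℕ) : ℝ)]) ≤ M * NV ^ r := by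
    refine (lintegral_mono_set hfr).trans ((lintegral_union_le _ _ _).trans ?_)
    have hz : ∫⁻ x in ({0} : Set (EE (k+2))), ENNReal.ofReal (|u x| ^ r) ∂(μH[((k+1 : ℕ) : ℝ)]) = 0 := by
      have : NullSingletonClass (μH[((k+1 : ℕ) : ℝ)] : Measure (EE (k+2))) :=
        Measure.nullSingletonClass_hausdorff _ (by positivity)
      exact setLIntegral_measure_zero _ _ (measure_singleton _)
    rw [hz, zero_add]
    refine (lintegral_union_le _ _ _).trans ?_
    have e : (M : ℝ≥0∞) * NV ^ r = (‖LL (k+2)‖₊ : ℝ≥0∞) ^ (k+1) * (C * NV ^ r) +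
        ∑ _q : Fin (k+1) × Bool,
          ((‖LL (k+2)‖₊ * α.toNNReal : NNReal) : ℝ≥0∞) ^ (k+1) * (C * NV ^ r) := by
      rw [hM]
      simp only [← mul_assoc, ← Finset.sum_mul, ← add_mul]
      push_cast
      rfl
    rw [e]
    refine add_le_add ?_ ?_
    · refine (top_bd hα hF (k * α)).trans ?_
      exact mul_le_mul_right (hfc (Fin.last (k+1)) 1 (Or.inr rfl) (fun _ => rfl)) _
    · refine (lintegral_iUnion_le _ _).trans ?_
      rw [tsum_fintype]
      refine Finset.sum_le_sum fun q _ => ?_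
      have hq : q.1.castSucc ≠ Fin.last (k+1) := (Fin.castSucc_lt_last q.1).ne
      refine (side_bd hα hq ?_ hF).trans ?_
      · split_ifs <;> simp
      · refine mul_le_mul_right (hfc _ _ ?_ (fun h => absurd h hq)) _
        split_ifs <;> simp
  calc _ ≤ (M * NV ^ r) ^ (1/r) := ENNReal.rpow_le_rpow hmain (by positivity)
    _ = ((M ^ (1/r) : NNReal) : ℝ≥0∞) * NV := by
        rw [ENNReal.mul_rpow_of_nonneg _ _ (by positivity), ← ENNReal.rpow_mul,
          mul_one_div_cancel hr0.ne', ENNReal.rpow_one,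
          ENNReal.coe_rpow_of_nonneg _ (by positivity)]
    _ ≤ _ := by
        refine mul_le_mul' ?_ hNle
        rw [← ENNReal.ofReal_coe_nnreal]
        exact ENNReal.ofReal_le_ofReal (by linarith)
end
end

section
/- Let n ≥ 2 be an integer, let γ > n be real, 1 < p < n, 1 < q < ∞, and let θ ∈ ℝ. Suppose there exists a constant C > 0 such that for every continuously differentiable function u : ℝ^n → ℝ one has (∫_{∂Ω_γ} |u(x)|^q x_n^θ dH^{n-1}(x))^{1/q} ≤ C · ( (∫_{Ω_γ} |∇u(x)|^p dx)^{1/p} + (∫_{Ω_γ} |u(x)|^p dx)^{1/p} ). Then θ ≥ (q/p)(α(n-1)+1-p) − α(n-2) − 1. In particular, for q = p(n-1)/(n-p) one has θ ≥ (γ-n)(1+p(n-2))/((n-p)(n-1)). -/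
open MeasureTheory ENNReal

noncomputable section

open Filter Topology in
lemma cusp_exponent_le {A B a b : ℝ} (hA : 0 < A)
    (h : ∀ t : ℝ, 0 < t → t < 1 → A * t ^ a ≤ B * t ^ b) : b ≤ a := by
  by_contra hab
  push Not at hab
  have h1 := tendsto_rpow_neg_nhdsGT_zero (y := a - b) (by linarith)
  have h2 : ∀ᶠ t in 𝓝[>] (0 : ℝ), B / A < t ^ (a - b) := h1.eventually_gt_atTop _
  have h3 : ∀ᶠ t in 𝓝[>] (0 : ℝ), t ∈ Set.Ioo (0 : ℝ) 1 := Ioo_mem_nhdsGT one_pos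
  obtain ⟨t, ht2, ht0, ht1⟩ := (h2.and h3).exists
  have h4 := h t ht0 ht1
  rw [Real.rpow_sub ht0, div_lt_div_iff₀ hA (Real.rpow_pos_of_pos ht0 b)] at ht2
  linarith

/-- boxes in Euclidean space -/
def cuspBox {n : ℕ} (I : Fin n → Set ℝ) : Set (EuclideanSpace ℝ (Fin n)) :=
  {x | ∀ i, x i ∈ I i}

lemma cuspBox_eq {n : ℕ} (I : Fin n → Set ℝ) :
    cuspBox I = (WithLp.ofLp : EuclideanSpace ℝ (Fin n) → (Fin n → ℝ)) ⁻¹' (Set.univ.pi I) := by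
  ext x; simp [cuspBox]

lemma cuspBox_meas {n : ℕ} (I : Fin n → Set ℝ) (hI : ∀ i, MeasurableSet (I i)) :
    MeasurableSet (cuspBox I) := by
  rw [cuspBox_eq]
  exact (PiLp.volume_preserving_ofLp (Fin n)).measurable (MeasurableSet.univ_pi hI)

lemma cuspBox_volume {n : ℕ} (I : Fin n → Set ℝ) (hI : ∀ i, MeasurableSet (I i)) :
    volume (cuspBox I) = ∏ i, volume (I i) := by
  rw [cuspBox_eq, (PiLp.volume_preserving_ofLp (Fin n)).measure_preimage
    (MeasurableSet.univ_pi hI).nullMeasurableSet, volume_pi_pi]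

lemma cuspBox_hausdorff {m : ℕ} (I : Fin (m + 1) → Set ℝ) (a : ℝ) (ha : a ∈ I 0) :
    ∏ j : Fin m, volume (I j.succ) ≤ μH[(m : ℝ)] (cuspBox I) := by
  let P : EuclideanSpace ℝ (Fin (m + 1)) → (Fin m → ℝ) := fun x j => x j.succ
  have hP : LipschitzWith 1 P := by
    refine LipschitzWith.of_dist_le_mul fun x y => ?_
    rw [NNReal.coe_one, one_mul]
    refine (dist_pi_le_iff dist_nonneg).2 fun j => ?_
    rw [EuclideanSpace.dist_eq]
    refine Real.le_sqrt_of_sq_le ?_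
    exact Finset.single_le_sum (f := fun i => dist (x i) (y i) ^ 2)
      (fun i _ => sq_nonneg _) (Finset.mem_univ j.succ)
  have h1 := hP.hausdorffMeasure_image_le (d := (m : ℝ)) (Nat.cast_nonneg m) (cuspBox I)
  have h2 : P '' cuspBox I = Set.univ.pi (fun j : Fin m => I j.succ) := by
    ext y
    constructor
    · rintro ⟨x, hx, rfl⟩ j _
      exact hx j.succ
    · intro hy
      refine ⟨WithLp.toLp 2 (Fin.cons a y), ?_, ?_⟩
      · intro i
        refine Fin.cases ?_ (fun j => ?_) i
        · simpa using ha
        · simpa using hy j trivial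
      · ext j; simp [P]
  have h3 : (μH[(m : ℝ)] : Measure (Fin m → ℝ)) = volume := by
    have := hausdorffMeasure_pi_real (ι := Fin m)
    simpa using this
  rw [h2, h3, volume_pi_pi] at h1
  simpa using h1

/-- face box -/
def faceI (k : ℕ) (t α : ℝ) (i : Fin (k + 2)) : Set ℝ :=
  if i = 0 then {0} else if i = Fin.last (k + 1) then Set.Icc (t / 2) t
    else Set.Ioo 0 ((t / 2) ^ α)

/-- solid box -/
def solidI (k : ℕ) (t α : ℝ) (i : Fin (k + 2)) : Set ℝ :=
  if i = Fin.last (k + 1) then Set.Icc 0 (2 * t) else Set.Icc 0 ((2 * t) ^ α)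

lemma faceI_meas (k : ℕ) (t α : ℝ) (i) : MeasurableSet (faceI k t α i) := by
  unfold faceI; split_ifs <;> measurability

lemma solidI_meas (k : ℕ) (t α : ℝ) (i) : MeasurableSet (solidI k t α i) := by
  unfold solidI; split_ifs <;> measurability

lemma face_hausdorff (k : ℕ) (t α : ℝ) (ht : 0 < t) :
    ENNReal.ofReal ((t / 2) ^ (α * k + 1)) ≤ μH[((k + 1 : ℕ) : ℝ)] (cuspBox (faceI k t α)) := by
  refine le_trans (le_of_eq ?_) (cuspBox_hausdorff (faceI k t α) 0 (by simp [faceI]))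
  have h0 : 0 < t / 2 := by linarith
  rw [Fin.prod_univ_castSucc]
  have h1 : ∀ j : Fin k, volume (faceI k t α j.castSucc.succ) = ENNReal.ofReal ((t/2)^α) := by
    intro j
    have : j.castSucc.succ ≠ Fin.last (k+1) := by
      rw [Fin.succ_castSucc]; exact (Fin.castSucc_lt_last _).ne
    simp [faceI, this]
  have h2 : volume (faceI k t α (Fin.last k).succ) = ENNReal.ofReal (t/2) := by
    simp [faceI]; congr 1; ring
  rw [h2, Finset.prod_congr rfl (fun j _ => h1 j), Finset.prod_const, Finset.card_univ,
    Fintype.card_fin, ← ENNReal.ofReal_pow (by positivity), ← ENNReal.ofReal_mul (by positivity),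
    Real.rpow_add h0, Real.rpow_one, Real.rpow_mul h0.le, Real.rpow_natCast]

lemma solid_volume (k : ℕ) (t α : ℝ) (ht : 0 < t) :
    volume (cuspBox (solidI k t α)) = ENNReal.ofReal ((2 * t) ^ (α * (k + 1) + 1)) := by
  have h0 : 0 < 2 * t := by linarith
  rw [cuspBox_volume _ (solidI_meas k t α), Fin.prod_univ_castSucc]
  have h1 : ∀ j : Fin (k+1), volume (solidI k t α j.castSucc) = ENNReal.ofReal ((2*t)^α) := by
    intro j
    simp [solidI, (Fin.castSucc_lt_last j).ne]
  have h2 : volume (solidI k t α (Fin.last (k+1))) = ENNReal.ofReal (2 * t) := by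
    simp [solidI]
  rw [h2, Finset.prod_congr rfl (fun j _ => h1 j), Finset.prod_const, Finset.card_univ,
    Fintype.card_fin, ← ENNReal.ofReal_pow (by positivity), ← ENNReal.ofReal_mul (by positivity),
    Real.rpow_add h0, Real.rpow_one, Real.rpow_mul h0.le, ← Nat.cast_add_one, Real.rpow_natCast]

lemma mem_cusp (k : ℕ) (hn : 2 ≤ k + 2) (γ α : ℝ) (hα : α = (γ - 1) / (((k + 2 : ℕ) : ℝ) - 1))
    (x : EuclideanSpace ℝ (Fin (k + 2))) :
    x ∈ cuspDomain (k + 2) hn γ ↔ 0 < x (Fin.last (k + 1)) ∧ x (Fin.last (k + 1)) < 1 ∧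
      ∀ i : Fin (k + 2), i ≠ Fin.last (k + 1) → 0 < x i ∧ x i < x (Fin.last (k + 1)) ^ α := by
  subst hα
  have h : ∀ i : Fin (k + 2), (i : ℕ) < k + 2 - 1 ↔ i ≠ Fin.last (k + 1) := by
    intro i
    rw [← Fin.lt_last_iff_ne_last, Fin.lt_def]; rfl
  unfold cuspDomain
  simp only [Set.mem_ofPred_eq, h]
  rfl

open Filter Topology in
lemma face_frontier (k : ℕ) (hn : 2 ≤ k + 2) (γ α : ℝ)
    (hα : α = (γ - 1) / (((k + 2 : ℕ) : ℝ) - 1)) (hα0 : 0 < α) (t : ℝ) (ht : 0 < t) (ht1 : t < 1) :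
    cuspBox (faceI k t α) ⊆ frontier (cuspDomain (k + 2) hn γ) := by
  intro x hx
  have hl : (Fin.last (k+1)) ≠ 0 := Fin.last_pos.ne'
  have hx0 : x 0 = 0 := by simpa [faceI] using hx 0
  have hxl : t / 2 ≤ x (Fin.last (k+1)) ∧ x (Fin.last (k+1)) ≤ t := by
    simpa [faceI, hl] using hx (Fin.last (k+1))
  have hxi : ∀ i, i ≠ 0 → i ≠ Fin.last (k+1) → 0 < x i ∧ x i < (t/2)^α := by
    intro i h0 h1
    simpa [faceI, h0, h1] using hx i
  have hpos : 0 < x (Fin.last (k+1)) := by linarith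
  refine ⟨?_, fun h => ?_⟩
  · let f : ℝ → EuclideanSpace ℝ (Fin (k+2)) := fun e => x + e • EuclideanSpace.single 0 1
    have hf : Continuous f := by fun_prop
    have hf0 : Tendsto f (𝓝[>] 0) (𝓝 x) := by
      have := hf.tendsto 0
      simp only [f, zero_smul, add_zero] at this
      exact this.mono_left nhdsWithin_le_nhds
    refine mem_closure_of_tendsto hf0 ?_
    have h3 : ∀ᶠ e in 𝓝[>] (0 : ℝ), e ∈ Set.Ioo (0 : ℝ) (x (Fin.last (k+1)) ^ α) :=
      Ioo_mem_nhdsGT (Real.rpow_pos_of_pos hpos _)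
    filter_upwards [h3] with e he
    rw [mem_cusp k hn γ α hα]
    have e1 : ∀ i, i ≠ 0 → f e i = x i := by
      intro i hi; simp [f, hi]
    have e0 : f e 0 = e := by simp [f, hx0]
    rw [e1 _ hl]
    refine ⟨hpos, by linarith, fun i hi => ?_⟩
    by_cases h0 : i = 0
    · subst h0; rw [e0]; exact he
    · rw [e1 _ h0]
      refine ⟨(hxi i h0 hi).1, (hxi i h0 hi).2.trans_le ?_⟩
      exact Real.rpow_le_rpow (by linarith) hxl.1 hα0.le
  · have h := (mem_cusp k hn γ α hα x).1 (interior_subset h)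
    have := (h.2.2 0 hl.symm).1
    linarith

lemma cusp_subset_solid (k : ℕ) (hn : 2 ≤ k + 2) (γ α : ℝ)
    (hα : α = (γ - 1) / (((k + 2 : ℕ) : ℝ) - 1)) (hα0 : 0 < α) (t : ℝ)
    (x : EuclideanSpace ℝ (Fin (k + 2))) (hx : x ∈ cuspDomain (k + 2) hn γ)
    (hxt : x (Fin.last (k + 1)) ≤ 2 * t) : x ∈ cuspBox (solidI k t α) := by
  rw [mem_cusp k hn γ α hα] at hx
  intro i
  by_cases h : i = Fin.last (k+1)
  · subst h
    simp only [solidI, if_true]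
    exact ⟨hx.1.le, hxt⟩
  · simp only [solidI, h, if_false]
    exact ⟨(hx.2.2 i h).1.le, (hx.2.2 i h).2.le.trans (Real.rpow_le_rpow hx.1.le hxt hα0.le)⟩

/-- test function -/
def cuspU (k : ℕ) (t : ℝ) (x : EuclideanSpace ℝ (Fin (k + 2))) : ℝ :=
  Real.smoothTransition (2 - x (Fin.last (k + 1)) / t)

lemma cuspU_contDiff (k : ℕ) (t : ℝ) : ContDiff ℝ 1 (cuspU k t) := by
  unfold cuspU
  have h : ContDiff ℝ 1 Real.smoothTransition := Real.smoothTransition.contDiff (n := 1)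
  refine h.comp ?_
  fun_prop

lemma cuspU_zero (k : ℕ) (t : ℝ) (ht : 0 < t) (x : EuclideanSpace ℝ (Fin (k + 2)))
    (h : 2 * t ≤ x (Fin.last (k + 1))) : cuspU k t x = 0 := by
  refine Real.smoothTransition.zero_of_nonpos ?_
  have := (le_div_iff₀ ht).2 h
  linarith

lemma cuspU_one (k : ℕ) (t : ℝ) (ht : 0 < t) (x : EuclideanSpace ℝ (Fin (k + 2)))
    (h : x (Fin.last (k + 1)) ≤ t) : cuspU k t x = 1 := by
  refine Real.smoothTransition.one_of_one_le ?_
  have := (div_le_one ht).2 h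
  linarith

open Filter Topology in
lemma cuspU_fderiv_zero (k : ℕ) (t : ℝ) (ht : 0 < t) (x : EuclideanSpace ℝ (Fin (k + 2)))
    (h : 2 * t < x (Fin.last (k + 1))) : fderiv ℝ (cuspU k t) x = 0 := by
  have hc : Continuous fun y : EuclideanSpace ℝ (Fin (k + 2)) => y (Fin.last (k + 1)) := by
    fun_prop
  have : cuspU k t =ᶠ[𝓝 x] fun _ => 0 := by
    filter_upwards [hc.continuousAt.eventually (lt_mem_nhds h)] with y hy
    exact cuspU_zero k t ht y hy.le
  rw [this.fderiv_eq]; simp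

lemma cuspU_fderiv_le (k : ℕ) (M : ℝ)
    (hM : ∀ s ∈ Set.Icc (0 : ℝ) 2, ‖deriv Real.smoothTransition s‖ ≤ M) (t : ℝ) (ht : 0 < t)
    (x : EuclideanSpace ℝ (Fin (k + 2))) (h0 : 0 ≤ x (Fin.last (k + 1)))
    (h : x (Fin.last (k + 1)) ≤ 2 * t) : ‖fderiv ℝ (cuspU k t) x‖ ≤ M / t := by
  let L : EuclideanSpace ℝ (Fin (k + 2)) →L[ℝ] ℝ := EuclideanSpace.proj (Fin.last (k + 1))
  have hL : ‖L‖ ≤ 1 := by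
    refine L.opNorm_le_bound zero_le_one fun y => ?_
    rw [one_mul]
    exact PiLp.norm_apply_le y _
  have hst : Differentiable ℝ Real.smoothTransition :=
    (Real.smoothTransition.contDiff (n := 1)).differentiable (by simp)
  have h1 : HasFDerivAt (fun y : EuclideanSpace ℝ (Fin (k + 2)) => 2 - t⁻¹ * L y)
      (-(t⁻¹ • L)) x := (L.hasFDerivAt.const_mul t⁻¹).const_sub 2
  have h2 := (hst (2 - t⁻¹ * L x)).hasDerivAt.comp_hasFDerivAt x h1
  have h3 : cuspU k t = Real.smoothTransition ∘ fun y => 2 - t⁻¹ * L y := by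
    funext y; simp [cuspU, L, div_eq_inv_mul]
  rw [h3, h2.fderiv, norm_smul, norm_neg, norm_smul, Real.norm_of_nonneg (by positivity : 0 ≤ t⁻¹)]
  have h4 : ‖deriv Real.smoothTransition (2 - t⁻¹ * L x)‖ ≤ M := by
    apply hM
    have e : t⁻¹ * L x = x (Fin.last (k + 1)) / t := by simp [L, div_eq_inv_mul]
    rw [e]
    have := (div_le_iff₀ ht).2 h
    have := div_nonneg h0 ht.le
    constructor <;> linarith
  have hM0 : 0 ≤ M := (norm_nonneg _).trans h4
  calc _ ≤ M * (t⁻¹ * 1) := by gcongr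
    _ = M / t := by rw [mul_one, div_eq_mul_inv]

lemma cusp_upper (k : ℕ) (hn : 2 ≤ k + 2) (γ α : ℝ)
    (hα : α = (γ - 1) / (((k + 2 : ℕ) : ℝ) - 1)) (hα0 : 0 < α) (t : ℝ) (ht : 0 < t)
    (f : EuclideanSpace ℝ (Fin (k + 2)) → ℝ) (D : ℝ) (hD : 0 ≤ D)
    (h0 : ∀ x ∈ cuspDomain (k + 2) hn γ, 2 * t < x (Fin.last (k + 1)) → f x = 0)
    (h1 : ∀ x ∈ cuspDomain (k + 2) hn γ, x (Fin.last (k + 1)) ≤ 2 * t → f x ≤ D) :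
    ∫⁻ x in cuspDomain (k + 2) hn γ, ENNReal.ofReal (f x) ≤
      ENNReal.ofReal (D * (2 * t) ^ (α * (k + 1) + 1)) := by
  have hm := cuspBox_meas _ (solidI_meas k t α)
  calc _ ≤ ∫⁻ x in cuspDomain (k + 2) hn γ,
        (cuspBox (solidI k t α)).indicator (fun _ => ENNReal.ofReal D) x := by
        refine setLIntegral_mono (measurable_const.indicator hm) fun x hx => ?_
        rcases le_or_gt (x (Fin.last (k + 1))) (2 * t) with h | h
        · rw [Set.indicator_of_mem (cusp_subset_solid k hn γ α hα hα0 t x hx h)]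
          exact ENNReal.ofReal_le_ofReal (h1 x hx h)
        · rw [h0 x hx h]; simp
    _ ≤ ∫⁻ x, (cuspBox (solidI k t α)).indicator (fun _ => ENNReal.ofReal D) x :=
        setLIntegral_le_lintegral _ _
    _ = _ := by
        rw [lintegral_indicator_const hm, solid_volume k t α ht, ENNReal.ofReal_mul hD]

lemma cusp_lower (k : ℕ) (hn : 2 ≤ k + 2) (γ α q θ : ℝ)
    (hα : α = (γ - 1) / (((k + 2 : ℕ) : ℝ) - 1)) (hα0 : 0 < α) (t : ℝ) (ht : 0 < t) (ht1 : t < 1) :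
    ENNReal.ofReal (min 1 (2⁻¹ ^ θ) * t ^ θ * (t / 2) ^ (α * k + 1)) ≤
    ∫⁻ x in frontier (cuspDomain (k + 2) hn γ),
            ENNReal.ofReal (|cuspU k t x| ^ q * x (Fin.last (k + 1)) ^ θ)
            ∂(μH[((k + 1 : ℕ) : ℝ)]) := by
  have hm := cuspBox_meas _ (faceI_meas k t α)
  have hc : 0 ≤ min 1 ((2⁻¹ : ℝ) ^ θ) * t ^ θ := by positivity
  calc _ ≤ ∫⁻ x in cuspBox (faceI k t α), ENNReal.ofReal (min 1 (2⁻¹ ^ θ) * t ^ θ)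
            ∂(μH[((k + 1 : ℕ) : ℝ)]) := by
        rw [setLIntegral_const, ENNReal.ofReal_mul hc]
        gcongr
        exact face_hausdorff k t α ht
    _ ≤ ∫⁻ x in cuspBox (faceI k t α),
            ENNReal.ofReal (|cuspU k t x| ^ q * x (Fin.last (k + 1)) ^ θ)
            ∂(μH[((k + 1 : ℕ) : ℝ)]) := by
        refine setLIntegral_mono' hm fun x hx => ENNReal.ofReal_le_ofReal ?_
        have hl : (Fin.last (k+1)) ≠ 0 := Fin.last_pos.ne'
        have hxl : t / 2 ≤ x (Fin.last (k+1)) ∧ x (Fin.last (k+1)) ≤ t := by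
          simpa [faceI, hl] using hx (Fin.last (k+1))
        have hpos : 0 < x (Fin.last (k+1)) := by linarith
        rw [cuspU_one k t ht x hxl.2, abs_one, Real.one_rpow, one_mul]
        have htθ : 0 ≤ t ^ θ := by positivity
        rcases le_or_gt 0 θ with h | h
        · calc _ ≤ 2⁻¹ ^ θ * t ^ θ := by gcongr; exact min_le_right _ _
            _ = (t / 2) ^ θ := by
              rw [← Real.mul_rpow (by norm_num) ht.le]; congr 1; ring
            _ ≤ _ := Real.rpow_le_rpow (by linarith) hxl.1 h
        · calc _ ≤ 1 * t ^ θ := by gcongr; exact min_le_left _ _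
            _ = t ^ θ := one_mul _
            _ ≤ _ := Real.rpow_le_rpow_of_nonpos hpos hxl.2 h.le
    _ ≤ _ := lintegral_mono_set (face_frontier k hn γ α hα hα0 t ht ht1)


/-- Necessary condition on the power weight exponent `θ` for the boundedness of the trace
embedding `W^{1,p}(Ω_γ) → L^q(∂Ω_γ, x_n^θ)`:
`θ ≥ (q/p)(α(n-1)+1-p) − α(n-2) − 1` with `α = (γ-1)/(n-1)`; in particular for
`q = p(n-1)/(n-p)` one gets `θ ≥ (γ-n)(1+p(n-2))/((n-p)(n-1))`. -/
theorem power_weight_necessary_condition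
    (n : ℕ) (hn : 2 ≤ n) (γ p q θ : ℝ)
    (hγ : (n : ℝ) < γ) (hp1 : 1 < p) (hpn : p < n) (hq1 : 1 < q)
    (hbdd : ∃ C : ℝ, 0 < C ∧
      ∀ u : EuclideanSpace ℝ (Fin n) → ℝ, ContDiff ℝ 1 u →
        (∫⁻ x in frontier (cuspDomain n hn γ),
            ENNReal.ofReal (|u x| ^ q * x ⟨n - 1, by omega⟩ ^ θ)
            ∂(μH[(n : ℝ) - 1])) ^ (1 / q)
        ≤ ENNReal.ofReal C *
          ((∫⁻ x in cuspDomain n hn γ, ENNReal.ofReal (‖fderiv ℝ u x‖ ^ p)) ^ (1 / p) +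
           (∫⁻ x in cuspDomain n hn γ, ENNReal.ofReal (|u x| ^ p)) ^ (1 / p))) :
    θ ≥ (q / p) * (((γ - 1) / ((n : ℝ) - 1)) * ((n : ℝ) - 1) + 1 - p) -
        ((γ - 1) / ((n : ℝ) - 1)) * ((n : ℝ) - 2) - 1 ∧
    (q = p * ((n : ℝ) - 1) / ((n : ℝ) - p) →
      θ ≥ (γ - n) * (1 + p * ((n : ℝ) - 2)) / (((n : ℝ) - p) * ((n : ℝ) - 1))) := by
  have key : θ ≥ (q / p) * (((γ - 1) / ((n : ℝ) - 1)) * ((n : ℝ) - 1) + 1 - p) -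
        ((γ - 1) / ((n : ℝ) - 1)) * ((n : ℝ) - 2) - 1 := by
    obtain ⟨k, rfl⟩ : ∃ k, n = k + 2 := ⟨n - 2, by omega⟩
    obtain ⟨C, hC, H⟩ := hbdd
    have hk : (0 : ℝ) ≤ k := Nat.cast_nonneg k
    obtain ⟨α, hα⟩ : ∃ α, α = (γ - 1) / (((k + 2 : ℕ) : ℝ) - 1) := ⟨_, rfl⟩
    have hα0 : 0 < α := by
      rw [hα]; push_cast at hγ ⊢
      apply div_pos <;> linarith
    rw [← hα]
    have e1 : ((k + 2 : ℕ) : ℝ) - 1 = ((k + 1 : ℕ) : ℝ) := by push_cast; ring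
    have e2 : ((k + 2 : ℕ) : ℝ) - 2 = k := by push_cast; ring
    have hst : ContDiff ℝ 1 Real.smoothTransition := Real.smoothTransition.contDiff (n := 1)
    obtain ⟨M₀, hM₀⟩ := (isCompact_Icc (a := (0 : ℝ)) (b := 2)).exists_bound_of_continuousOn
      (hst.continuous_deriv le_rfl).continuousOn
    let M : ℝ := max M₀ 1
    have hM : ∀ s ∈ Set.Icc (0 : ℝ) 2, ‖deriv Real.smoothTransition s‖ ≤ M :=
      fun s hs => (hM₀ s hs).trans (le_max_left _ _)
    have hM1 : 1 ≤ M := le_max_right _ _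
    have hp0 : 0 < p := by linarith
    have hq0 : 0 < q := by linarith
    let c : ℝ := min 1 ((2⁻¹ : ℝ) ^ θ)
    have hc : 0 < c := lt_min one_pos (by positivity)
    have main : ∀ t : ℝ, 0 < t → t < 1 →
        (c * 2⁻¹ ^ (α * k + 1)) ^ (1 / q) * t ^ ((θ + (α * k + 1)) * (1 / q)) ≤
        (C * 2 * (M ^ p * 2 ^ (α * (k + 1) + 1)) ^ (1 / p)) *
          t ^ ((-p + (α * (k + 1) + 1)) * (1 / p)) := by
      intro t ht ht1
      have h := H (cuspU k t) (cuspU_contDiff k t)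
      rw [e1] at h
      have hlow := cusp_lower k hn γ α q θ hα hα0 t ht ht1
      have hMt : 1 ≤ M / t := by rw [le_div_iff₀ ht]; linarith
      have hD : 0 ≤ (M / t) ^ p := by positivity
      have hup1 := cusp_upper k hn γ α hα hα0 t ht (fun x => ‖fderiv ℝ (cuspU k t) x‖ ^ p)
        ((M / t) ^ p) hD
        (fun x _ hx => by
          simp only [cuspU_fderiv_zero k t ht x hx, norm_zero]; exact Real.zero_rpow hp0.ne')
        (fun x hx hxt => Real.rpow_le_rpow (norm_nonneg _)
          (cuspU_fderiv_le k M hM t ht x ((mem_cusp k hn γ α hα x).1 hx).1.le hxt) hp0.le)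
      have hup2 := cusp_upper k hn γ α hα hα0 t ht (fun x => |cuspU k t x| ^ p)
        ((M / t) ^ p) hD
        (fun x _ hx => by
          simp only [cuspU_zero k t ht x hx.le, abs_zero]; exact Real.zero_rpow hp0.ne')
        (fun x hx hxt => Real.rpow_le_rpow (abs_nonneg _) (by
          refine le_trans ?_ hMt
          unfold cuspU
          rw [abs_of_nonneg (Real.smoothTransition.nonneg _)]
          exact Real.smoothTransition.le_one _) hp0.le)
      set V : ℝ := (M / t) ^ p * (2 * t) ^ (α * (k + 1) + 1) with hV
      have hV0 : 0 ≤ V := by positivity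
      set W : ℝ := min 1 ((2⁻¹ : ℝ) ^ θ) * t ^ θ * (t / 2) ^ (α * k + 1) with hW
      have hW0 : 0 ≤ W := by positivity
      have h' : ENNReal.ofReal W ^ (1 / q) ≤ ENNReal.ofReal C *
          (ENNReal.ofReal V ^ (1 / p) + ENNReal.ofReal V ^ (1 / p)) := by
        refine (ENNReal.rpow_le_rpow hlow (by positivity)).trans (h.trans ?_)
        gcongr
      rw [ENNReal.ofReal_rpow_of_nonneg hW0 (by positivity),
        ENNReal.ofReal_rpow_of_nonneg hV0 (by positivity),
        ← ENNReal.ofReal_add (by positivity) (by positivity), ← ENNReal.ofReal_mul hC.le,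
        ENNReal.ofReal_le_ofReal_iff (by positivity)] at h'
      have hWe : W = (c * 2⁻¹ ^ (α * k + 1)) * t ^ (θ + (α * k + 1)) := by
        rw [hW, div_eq_mul_inv, Real.mul_rpow ht.le (by norm_num),
          Real.rpow_add ht θ (α * k + 1)]
        simp only [c]; ring
      have hVe : V = (M ^ p * 2 ^ (α * (k + 1) + 1)) * t ^ (-p + (α * (k + 1) + 1)) := by
        rw [hV, Real.mul_rpow (by norm_num) ht.le,
          Real.rpow_add ht (-p) (α * (k + 1) + 1),
          Real.div_rpow (by linarith) ht.le, Real.rpow_neg ht.le]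
        ring
      have hWp : W ^ (1 / q) = (c * 2⁻¹ ^ (α * k + 1)) ^ (1 / q) *
          t ^ ((θ + (α * k + 1)) * (1 / q)) := by
        rw [hWe, Real.mul_rpow (x := c * 2⁻¹ ^ (α * k + 1)) (by positivity) (by positivity),
          ← Real.rpow_mul ht.le]
      have hVp : V ^ (1 / p) = (M ^ p * 2 ^ (α * (k + 1) + 1)) ^ (1 / p) *
          t ^ ((-p + (α * (k + 1) + 1)) * (1 / p)) := by
        rw [hVe, Real.mul_rpow (x := M ^ p * 2 ^ (α * (k + 1) + 1)) (by positivity)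
          (by positivity), ← Real.rpow_mul ht.le]
      rw [hWp, hVp] at h'
      linarith
    have hfin := cusp_exponent_le (by positivity) main
    have e3 : ((k + 1 : ℕ) : ℝ) = k + 1 := by push_cast; ring
    rw [e1, e2, e3]
    have h5 : (-p + (α * (k + 1) + 1)) * (1 / p) * q ≤ θ + (α * k + 1) := by
      have := mul_le_mul_of_nonneg_right hfin hq0.le
      have e4 : (θ + (α * k + 1)) * (1 / q) * q = θ + (α * k + 1) := by field_simp
      rwa [e4] at this
    have e5 : (-p + (α * (k + 1) + 1)) * (1 / p) * q = q / p * (α * (k + 1) + 1 - p) := by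
      ring
    linarith
  refine ⟨key, fun hq => ?_⟩
  have hn1 : (2 : ℝ) ≤ n := by exact_mod_cast hn
  have a1 : (n : ℝ) - 1 ≠ 0 := by linarith
  have a2 : (n : ℝ) - p ≠ 0 := by linarith
  have a3 : p ≠ 0 := by linarith
  refine le_of_eq_of_le ?_ key
  rw [hq]
  field_simp
  ring
end
end

section
/- Let n ≥ 2 be an integer, let γ > n be real, and 1 < p < n. Then there exists a constant C > 0 such that for every continuously differentiable function u : ℝ^n → ℝ one has (∫_{∂Ω_γ} |u(x)|^p x_n^α dH^{n-1}(x))^{1/p} ≤ C · ( (∫_{Ω_γ} |∇u(x)|^p dx)^{1/p} + (∫_{Ω_γ} |u(x)|^p dx)^{1/p} ), where α = (γ-1)/(n-1). (This is the trace inequality with weight x_n^α from the comparison with the earlier result of Gol'dshtein–Vodopyanov type, stated on the dense class of C¹ functions.) -/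
open MeasureTheory ENNReal

noncomputable section

lemma oneD (p : ℝ) (hp : 1 < p) (f f' : ℝ → ℝ) (hf : ∀ x, HasDerivAt f (f' x) x)
    (hf' : Continuous f') (a b c : ℝ) (hb : b - a ≤ 1) (hc : c ∈ Set.Icc a b) :
    ENNReal.ofReal (b - a) * ‖f c‖ₑ ^ p ≤
      2 ^ (p - 1) * ∫⁻ s in Set.Icc a b, (‖f s‖ₑ ^ p + ‖f' s‖ₑ ^ p) := by
  have hfc : Continuous f := continuous_iff_continuousAt.2 fun x => (hf x).continuousAt
  have hp0 : 0 < p := by linarith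
  set I := ∫⁻ s in Set.Icc a b, ‖f' s‖ₑ with hI
  set J := ∫⁻ s in Set.Icc a b, ‖f' s‖ₑ ^ p with hJ
  have hvol : volume (Set.Icc a b) ≤ 1 := by
    rw [Real.volume_Icc]; exact ENNReal.ofReal_le_one.2 hb
  have hIJ : I ^ p ≤ J := by
    have h := eLpNorm'_le_eLpNorm'_mul_rpow_measure_univ (μ := volume.restrict (Set.Icc a b))
      (f := f') one_pos hp.le hf'.aestronglyMeasurable
    simp only [eLpNorm'_eq_lintegral_enorm, ENNReal.rpow_one, div_one, Measure.restrict_apply_univ] at h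
    have h2 : I ≤ J ^ (1 / p) := by
      refine h.trans (mul_le_of_le_one_right' ?_)
      apply ENNReal.rpow_le_one hvol
      have : 1 / p ≤ 1 := by rw [div_le_one hp0]; exact hp.le
      linarith
    calc I ^ p ≤ (J ^ (1 / p)) ^ p := ENNReal.rpow_le_rpow h2 hp0.le
      _ = J := by rw [← ENNReal.rpow_mul, one_div_mul_cancel hp0.ne', ENNReal.rpow_one]
  have hpt : ∀ s ∈ Set.Icc a b, ‖f c‖ₑ ^ p ≤ 2 ^ (p - 1) * (‖f s‖ₑ ^ p + J) := by
    intro s hs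
    have h1 : ‖f c‖ₑ ≤ ‖f s‖ₑ + I := by
      have h := intervalIntegral.integral_eq_sub_of_hasDerivAt (a := s) (b := c) (f := f) (f' := f')
        (fun x _ => hf x) (hf'.intervalIntegrable _ _)
      have h3 : ‖f c - f s‖ₑ ≤ I := by
        rw [← h]
        have : ‖∫ y in s..c, f' y‖ₑ = ‖∫ y in Set.uIoc s c, f' y‖ₑ := by
          rw [← ofReal_norm, ← ofReal_norm, intervalIntegral.norm_integral_eq_norm_integral_uIoc]
        rw [this]
        refine (enorm_integral_le_lintegral_enorm _).trans ?_
        apply lintegral_mono_set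
        refine Set.uIoc_subset_uIcc.trans ?_
        exact Set.uIcc_subset_Icc hs hc
      calc ‖f c‖ₑ = ‖f s + (f c - f s)‖ₑ := by congr 1; ring
        _ ≤ ‖f s‖ₑ + ‖f c - f s‖ₑ := enorm_add_le _ _
        _ ≤ _ := by gcongr
    calc ‖f c‖ₑ ^ p ≤ (‖f s‖ₑ + I) ^ p := ENNReal.rpow_le_rpow h1 hp0.le
      _ ≤ 2 ^ (p - 1) * (‖f s‖ₑ ^ p + I ^ p) := ENNReal.rpow_add_le_mul_rpow_add_rpow _ _ hp.le
      _ ≤ _ := by gcongr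
  have hm1 : Measurable fun s => ‖f s‖ₑ ^ p := by fun_prop
  calc ENNReal.ofReal (b - a) * ‖f c‖ₑ ^ p = ∫⁻ s in Set.Icc a b, ‖f c‖ₑ ^ p := by
        rw [setLIntegral_const, Real.volume_Icc, mul_comm]
    _ ≤ ∫⁻ s in Set.Icc a b, 2 ^ (p - 1) * (‖f s‖ₑ ^ p + J) := setLIntegral_mono' measurableSet_Icc hpt
    _ = 2 ^ (p - 1) * ((∫⁻ s in Set.Icc a b, ‖f s‖ₑ ^ p) + J * volume (Set.Icc a b)) := by
        rw [lintegral_const_mul _ (by fun_prop), lintegral_add_left hm1, setLIntegral_const]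
    _ ≤ 2 ^ (p - 1) * ((∫⁻ s in Set.Icc a b, ‖f s‖ₑ ^ p) + J) := by
        gcongr; exact mul_le_of_le_one_right' hvol
    _ = _ := by rw [lintegral_add_left hm1]

lemma lint_insert {m : ℕ} (i : Fin (m + 1)) (H : EuclideanSpace ℝ (Fin (m + 1)) → ℝ≥0∞)
    (hH : Measurable H) : ∫⁻ x, H x =
      ∫⁻ z : Fin m → ℝ, ∫⁻ s : ℝ, H (WithLp.toLp 2 (i.insertNth s z)) := by
  rw [← (PiLp.volume_preserving_toLp (Fin (m + 1))).lintegral_comp hH]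
  have h1 : Measurable fun v : Fin (m + 1) → ℝ => H (WithLp.toLp 2 v) := by fun_prop
  rw [← ((volume_preserving_piFinSuccAbove (fun _ : Fin (m + 1) => ℝ) i).symm).lintegral_comp h1]
  rw [Measure.volume_eq_prod, lintegral_prod_symm']
  · rfl
  · fun_prop

lemma haus_param {m : ℕ} {E : Type*} [EMetricSpace E] [MeasurableSpace E] [BorelSpace E]
    (F : (Fin m → ℝ) → E) (hF : Measurable F) (D : Set (Fin m → ℝ)) (L : NNReal)
    (hL : LipschitzOnWith L F D) (g : E → ℝ≥0∞) (hg : Measurable g) :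
    ∫⁻ x in F '' D, g x ∂(μH[(m : ℝ)]) ≤ (L : ℝ≥0∞) ^ (m : ℝ) * ∫⁻ z in D, g (F z) := by
  have key : (μH[(m : ℝ)] : Measure E).restrict (F '' D) ≤
      ((L : ℝ≥0∞) ^ (m : ℝ)) • Measure.map F (volume.restrict D) := by
    refine Measure.le_iff.2 fun A hA => ?_
    rw [Measure.restrict_apply hA, Measure.smul_apply, Measure.map_apply hF hA,
      Measure.restrict_apply (hF hA)]
    have : A ∩ F '' D = F '' (F ⁻¹' A ∩ D) := by
      rw [Set.inter_comm, Set.inter_comm _ D, Set.image_inter_preimage]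
    rw [this]
    have h := (hL.mono (Set.inter_subset_right (s := F ⁻¹' A))).hausdorffMeasure_image_le
      (d := m) (by positivity)
    have h2 : (μH[(m : ℝ)] : Measure (Fin m → ℝ)) = volume := by
      have := hausdorffMeasure_pi_real (ι := Fin m)
      simpa using this
    rw [h2] at h
    exact h
  refine (lintegral_mono' key le_rfl).trans ?_
  rw [lintegral_smul_measure, lintegral_map hg hF, smul_eq_mul]

lemma graph_null {m : ℕ} (i : Fin (m + 1)) (φ : (Fin m → ℝ) → ℝ) (hφ : Measurable φ) :
    volume {x : EuclideanSpace ℝ (Fin (m + 1)) | x i = φ (fun j => x (i.succAbove j))} = 0 := by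
  have hms : MeasurableSet {x : EuclideanSpace ℝ (Fin (m + 1)) | x i = φ (fun j => x (i.succAbove j))} := by
    apply measurableSet_eq_fun <;> fun_prop
  rw [← lintegral_indicator_one hms, lint_insert i _ (measurable_one.indicator hms)]
  rw [← lintegral_zero (μ := (volume : Measure (Fin m → ℝ)))]
  refine lintegral_congr fun z => ?_
  have : (fun s : ℝ => ({x : EuclideanSpace ℝ (Fin (m + 1)) | x i = φ (fun j => x (i.succAbove j))}.indicator
      (1 : EuclideanSpace ℝ (Fin (m + 1)) → ℝ≥0∞)) (WithLp.toLp 2 (i.insertNth s z))) =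
      ({φ z} : Set ℝ).indicator 1 := by
    ext s
    simp [Set.indicator]
  simp only [this]
  rw [lintegral_indicator_one (measurableSet_singleton _)]
  simp

def GG {E : Type*} [NormedAddCommGroup E] [NormedSpace ℝ E] (p : ℝ) (u : E → ℝ) (x : E) : ℝ≥0∞ :=
  ‖u x‖ₑ ^ p + ‖fderiv ℝ u x‖ₑ ^ p

lemma GG_meas {m : ℕ} (p : ℝ) (u : EuclideanSpace ℝ (Fin m) → ℝ) (hu : ContDiff ℝ 1 u) :
    Measurable (GG p u) := by
  have h1 : Measurable u := hu.continuous.measurable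
  have h2 : Measurable (fderiv ℝ u) := (hu.continuous_fderiv one_ne_zero).measurable
  unfold GG
  exact (h1.enorm.pow_const p).add (h2.enorm.pow_const p)

lemma lineE {E : Type*} [NormedAddCommGroup E] [NormedSpace ℝ E] (p : ℝ) (hp : 1 < p)
    (u : E → ℝ) (hu : ContDiff ℝ 1 u) (x0 v : E) (M : NNReal) (hM : 1 ≤ M) (hv : ‖v‖ₑ ≤ M)
    (a b c : ℝ) (hb : b - a ≤ 1) (hc : c ∈ Set.Icc a b) :
    ENNReal.ofReal (b - a) * ‖u (x0 + c • v)‖ₑ ^ p ≤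
      2 ^ (p - 1) * (M : ℝ≥0∞) ^ p * ∫⁻ s in Set.Icc a b, GG p u (x0 + s • v) := by
  have hp0 : 0 < p := by linarith
  have hcont := hu.continuous_fderiv one_ne_zero
  have h := oneD p hp (fun s => u (x0 + s • v)) (fun s => fderiv ℝ u (x0 + s • v) v) (by
    intro s
    have h1 : HasDerivAt (fun s : ℝ => x0 + s • v) v s := by
      simpa using ((hasDerivAt_id s).smul_const v).const_add x0
    exact ((hu.differentiable one_ne_zero (x0 + s • v)).hasFDerivAt).comp_hasDerivAt s h1)
    (by fun_prop) a b c hb hc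
  refine h.trans ?_
  rw [mul_assoc, ← lintegral_const_mul' _ _ (ENNReal.rpow_ne_top_of_nonneg hp0.le ENNReal.coe_ne_top)]
  gcongr with s
  unfold GG
  rw [mul_add]
  have hM1 : (1 : ℝ≥0∞) ≤ (M : ℝ≥0∞) ^ p := ENNReal.one_le_rpow (by exact_mod_cast hM) hp0
  gcongr
  · exact le_mul_of_one_le_left' hM1
  · rw [← ENNReal.mul_rpow_of_nonneg _ _ hp0.le]
    refine ENNReal.rpow_le_rpow ?_ hp0.le
    rw [mul_comm]
    refine (ContinuousLinearMap.le_opENorm _ _).trans ?_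
    gcongr

def cuspK (k : ℕ) (α : ℝ) : Set (EuclideanSpace ℝ (Fin (k + 2))) :=
  {x | 0 ≤ x (Fin.last (k + 1)) ∧ x (Fin.last (k + 1)) ≤ 1 ∧
    ∀ j : Fin (k + 1), 0 ≤ x j.castSucc ∧ x j.castSucc ≤ x (Fin.last (k + 1)) ^ α}

lemma cuspK_closed (k : ℕ) (α : ℝ) (hα : 1 ≤ α) : IsClosed (cuspK k α) := by
  have h1 : Continuous fun x : EuclideanSpace ℝ (Fin (k + 2)) => x (Fin.last (k + 1)) ^ α :=
    (show Continuous fun x : EuclideanSpace ℝ (Fin (k + 2)) => x (Fin.last (k + 1)) by fun_prop).rpow_const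
      (fun _ => Or.inr (by linarith))
  unfold cuspK
  simp only [Set.ofPred_and, Set.ofPred_forall]
  refine IsClosed.inter (isClosed_le (by fun_prop) (by fun_prop)) (IsClosed.inter
    (isClosed_le (by fun_prop) (by fun_prop)) (isClosed_iInter fun j => IsClosed.inter
    (isClosed_le (by fun_prop) (by fun_prop)) (isClosed_le (by fun_prop) h1)))

lemma pow_lip (α : ℝ) (hα : 1 ≤ α) : LipschitzOnWith α.toNNReal (fun t : ℝ => t ^ α) (Set.Icc 0 1) := by
  refine Convex.lipschitzOnWith_of_nnnorm_deriv_le (𝕜 := ℝ) (fun x _ => ?_) (fun x hx => ?_) (convex_Icc 0 1)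
  · exact (Real.hasDerivAt_rpow_const (Or.inr hα)).differentiableAt
  · rw [(Real.hasDerivAt_rpow_const (Or.inr hα)).deriv, ← NNReal.coe_le_coe, coe_nnnorm,
      Real.coe_toNNReal _ (by linarith), Real.norm_of_nonneg
      (mul_nonneg (by linarith) (Real.rpow_nonneg hx.1 _))]
    exact mul_le_of_le_one_right (by linarith) (Real.rpow_le_one hx.1 hx.2 (by linarith))

lemma insert_lip {m : ℕ} (i : Fin (m + 1)) (φ : (Fin m → ℝ) → ℝ) (D : Set (Fin m → ℝ)) (L : NNReal)
    (hL1 : 1 ≤ L) (hL : LipschitzOnWith L φ D) :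
    ∃ L' : NNReal, LipschitzOnWith L'
      (fun z => (WithLp.toLp 2 (i.insertNth (φ z) z : Fin (m + 1) → ℝ) : EuclideanSpace ℝ (Fin (m + 1)))) D := by
  have h1 : LipschitzOnWith L (fun z => (i.insertNth (φ z) z : Fin (m + 1) → ℝ)) D := by
    intro x hx y hy
    rw [edist_pi_le_iff]
    intro l
    rcases Fin.eq_self_or_eq_succAbove i l with h | ⟨j, h⟩
    · subst h; simpa using hL hx hy
    · subst h
      simp only [Fin.insertNth_apply_succAbove]
      refine (edist_le_pi_edist x y j).trans ?_
      exact le_mul_of_one_le_left' (by exact_mod_cast hL1)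
  exact ⟨_, (PiLp.lipschitzWith_toLp 2 (fun _ : Fin (m + 1) => ℝ)).comp_lipschitzOnWith h1⟩

lemma side (k : ℕ) (α p : ℝ) (hα : 1 ≤ α) (hp : 1 < p) (j : Fin (k + 1)) (c : ℝ) (hc : c ∈ Set.Icc (0:ℝ) 1) :
    ∃ A : NNReal, ∀ u : EuclideanSpace ℝ (Fin (k + 2)) → ℝ, ContDiff ℝ 1 u →
      ∫⁻ x in {x | x ∈ cuspK k α ∧ x j.castSucc = c * x (Fin.last (k + 1)) ^ α},
        ‖u x‖ₑ ^ p * ENNReal.ofReal (x (Fin.last (k + 1)) ^ α) ∂(μH[((k + 1 : ℕ) : ℝ)]) ≤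
      A * ∫⁻ x in cuspK k α, GG p u x := by
  have hp0 : 0 < p := by linarith
  set i : Fin (k + 2) := j.castSucc with hi
  have hlast : i.succAbove (Fin.last k) = Fin.last (k + 1) := by
    rw [hi, Fin.succAbove_of_le_castSucc _ _ (by simpa using Fin.le_last j)]; rfl
  set φ : (Fin (k + 1) → ℝ) → ℝ := fun z => c * z (Fin.last k) ^ α with hφ
  have hφm : Measurable φ := by fun_prop
  set F : (Fin (k + 1) → ℝ) → EuclideanSpace ℝ (Fin (k + 2)) :=
    fun z => WithLp.toLp 2 (i.insertNth (φ z) z) with hF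
  have hFm : Measurable F := by
    have : Continuous fun q : ℝ × (Fin (k + 1) → ℝ) =>
      (WithLp.toLp 2 (i.insertNth q.1 q.2) : EuclideanSpace ℝ (Fin (k + 2))) := by fun_prop
    exact this.measurable.comp (hφm.prodMk measurable_id)
  have ins_last : ∀ s z, (WithLp.toLp 2 (i.insertNth s z) : EuclideanSpace ℝ (Fin (k + 2))) (Fin.last (k + 1))
      = z (Fin.last k) := by
    intro s z
    rw [← hlast]; simp
  have ins_last' : ∀ s z, (i.insertNth s z : Fin (k + 2) → ℝ) (Fin.last (k + 1)) = z (Fin.last k) := ins_last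
  set D : Set (Fin (k + 1) → ℝ) := F ⁻¹' cuspK k α with hD
  have hKm : MeasurableSet (cuspK k α) := (cuspK_closed k α hα).measurableSet
  have hDm : MeasurableSet D := hFm hKm
  have hDt : ∀ z ∈ D, z (Fin.last k) ∈ Set.Icc (0:ℝ) 1 := by
    intro z hz
    have h := hz
    simp only [hD, Set.mem_preimage, cuspK, Set.mem_ofPred_eq, hF, ins_last'] at h
    exact ⟨h.1, h.2.1⟩
  have hφL : LipschitzOnWith α.toNNReal φ D := by
    intro x hx y hy
    have h1 := pow_lip α hα (hDt x hx) (hDt y hy)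
    have h2 : edist (φ x) (φ y) ≤ edist (x (Fin.last k) ^ α) (y (Fin.last k) ^ α) := by
      rw [edist_dist, edist_dist]
      apply ENNReal.ofReal_le_ofReal
      rw [Real.dist_eq, Real.dist_eq, hφ]
      simp only
      rw [← mul_sub, abs_mul, abs_of_nonneg hc.1]
      exact mul_le_of_le_one_left (abs_nonneg _) hc.2
    refine h2.trans (h1.trans ?_)
    gcongr
    exact edist_le_pi_edist x y _
  obtain ⟨L, hL⟩ := insert_lip i φ D α.toNNReal (by simpa using hα) hφL
  have himg : {x | x ∈ cuspK k α ∧ x i = c * x (Fin.last (k + 1)) ^ α} ⊆ F '' D := by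
    rintro x ⟨hx, hxi⟩
    have hz : F (fun l => x (i.succAbove l)) = x := by
      simp only [hF, hφ, hlast, ← hxi]
      ext l
      exact congrFun (Fin.insertNth_self_removeNth i (fun l => x l)) l
    exact ⟨fun l => x (i.succAbove l), by rw [hD, Set.mem_preimage, hz]; exact hx, hz⟩
  refine ⟨L ^ ((k + 1 : ℕ) : ℝ) * 2 ^ (p - 1), fun u hu => ?_⟩
  have hGm := GG_meas p u hu
  have hum : Measurable u := hu.continuous.measurable
  have pointwise : ∀ z ∈ D, ‖u (F z)‖ₑ ^ p * ENNReal.ofReal (F z (Fin.last (k + 1)) ^ α) ≤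
      2 ^ (p - 1) * ∫⁻ s : ℝ, (cuspK k α).indicator (GG p u) (WithLp.toLp 2 (i.insertNth s z)) := by
    intro z hz
    have ht := hDt z hz
    have hadd : ∀ s : ℝ, (WithLp.toLp 2 (i.insertNth s z) : EuclideanSpace ℝ (Fin (k + 2))) =
        WithLp.toLp 2 (i.insertNth 0 z) + s • EuclideanSpace.single i (1:ℝ) := by
      intro s
      ext l
      rcases Fin.eq_self_or_eq_succAbove i l with h | ⟨l', h⟩
      · subst h; simp
      · subst h; simp
    have hh0 : 0 ≤ z (Fin.last k) ^ α := Real.rpow_nonneg ht.1 _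
    have h := lineE p hp u hu (WithLp.toLp 2 (i.insertNth 0 z)) (EuclideanSpace.single i (1:ℝ)) 1 le_rfl
      (by rw [← ofReal_norm]; simp) 0 (z (Fin.last k) ^ α) (φ z)
      (by simpa using Real.rpow_le_one ht.1 ht.2 (by linarith))
      ⟨mul_nonneg hc.1 hh0, mul_le_of_le_one_left hh0 hc.2⟩
    simp only [← hadd] at h
    simp only [hF, ins_last']
    rw [sub_zero] at h
    rw [mul_comm]
    refine h.trans ?_
    simp only [ENNReal.coe_one, ENNReal.one_rpow, mul_one]
    refine mul_le_mul_right ?_ _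
    rw [← lintegral_indicator measurableSet_Icc]
    refine lintegral_mono fun s => ?_
    refine Set.indicator_apply_le' (fun hs => ?_) (fun _ => zero_le)
    rw [Set.indicator_of_mem]
    have hz' := hz
    simp only [hD, Set.mem_preimage, cuspK, Set.mem_ofPred_eq, hF, ins_last'] at hz' ⊢
    refine ⟨hz'.1, hz'.2.1, fun l => ?_⟩
    rcases Fin.eq_self_or_eq_succAbove i l.castSucc with h | ⟨l', h⟩
    · rw [h]; simpa using hs
    · have := hz'.2.2 l
      rw [h] at this ⊢
      simpa using this
  calc _ ≤ ∫⁻ x in F '' D, ‖u x‖ₑ ^ p * ENNReal.ofReal (x (Fin.last (k + 1)) ^ α) ∂(μH[((k + 1 : ℕ) : ℝ)]) :=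
        lintegral_mono_set himg
    _ ≤ (L : ℝ≥0∞) ^ ((k + 1 : ℕ) : ℝ) * ∫⁻ z in D, ‖u (F z)‖ₑ ^ p * ENNReal.ofReal (F z (Fin.last (k + 1)) ^ α) :=
        haus_param F hFm D L hL _ (by fun_prop)
    _ ≤ (L : ℝ≥0∞) ^ ((k + 1 : ℕ) : ℝ) * ∫⁻ z in D, 2 ^ (p - 1) * ∫⁻ s : ℝ, (cuspK k α).indicator (GG p u) (WithLp.toLp 2 (i.insertNth s z)) := by
        refine mul_le_mul_right ?_ _
        exact setLIntegral_mono' hDm pointwise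
    _ ≤ (L : ℝ≥0∞) ^ ((k + 1 : ℕ) : ℝ) * ∫⁻ z, 2 ^ (p - 1) * ∫⁻ s : ℝ, (cuspK k α).indicator (GG p u) (WithLp.toLp 2 (i.insertNth s z)) := by
        gcongr
        exact Measure.restrict_le_self
    _ = _ := by
        rw [lintegral_const_mul' _ _ (ENNReal.rpow_ne_top_of_nonneg (by linarith) (by simp)),
          ← lint_insert i _ (hGm.indicator hKm), lintegral_indicator hKm, ← mul_assoc]
        congr 1
        rw [ENNReal.coe_mul, ENNReal.coe_rpow_of_nonneg _ (by positivity), ENNReal.coe_rpow_of_nonneg _ (by linarith)]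
        rfl

lemma lint_scale {m : ℕ} (r : ℝ) (hr : 1 / 2 ≤ r) (H : (Fin m → ℝ) → ℝ≥0∞) (hH : Measurable H) :
    ∫⁻ z, H (r • z) ≤ 2 ^ m * ∫⁻ w, H w := by
  have hr0 : 0 < r := by linarith
  rw [← lintegral_map (f := H) (g := fun z : Fin m → ℝ => r • z) hH (by fun_prop),
    Measure.map_addHaar_smul volume hr0.ne', lintegral_smul_measure, smul_eq_mul]
  gcongr
  rw [Module.finrank_fin_fun, abs_of_nonneg (by positivity)]
  have : (r ^ m)⁻¹ ≤ 2 ^ m := by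
    rw [← inv_pow]
    gcongr
    rw [inv_le_comm₀ hr0 (by norm_num)]
    linarith
  refine (ENNReal.ofReal_le_ofReal this).trans ?_
  rw [ENNReal.ofReal_pow (by norm_num)]
  simp

lemma topF (k : ℕ) (α p : ℝ) (hα : 1 ≤ α) (hp : 1 < p) :
    ∃ A : NNReal, ∀ u : EuclideanSpace ℝ (Fin (k + 2)) → ℝ, ContDiff ℝ 1 u →
      ∫⁻ x in {x | x ∈ cuspK k α ∧ x (Fin.last (k + 1)) = 1},
        ‖u x‖ₑ ^ p * ENNReal.ofReal (x (Fin.last (k + 1)) ^ α) ∂(μH[((k + 1 : ℕ) : ℝ)]) ≤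
      A * ∫⁻ x in cuspK k α, GG p u x := by
  have hp0 : 0 < p := by linarith
  have hα0 : 0 < α := by linarith
  set i : Fin (k + 2) := Fin.last (k + 1) with hi
  have hsa : ∀ l : Fin (k + 1), i.succAbove l = l.castSucc := fun l => by rw [hi, Fin.succAbove_last]
  have ins_i : ∀ (s : ℝ) (z : Fin (k + 1) → ℝ), (i.insertNth s z : Fin (k + 2) → ℝ) i = s := by
    intro s z; simp
  have ins_c : ∀ (s : ℝ) (z : Fin (k + 1) → ℝ) (l : Fin (k + 1)),
      (i.insertNth s z : Fin (k + 2) → ℝ) l.castSucc = z l := by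
    intro s z l; rw [← hsa]; simp
  set F : (Fin (k + 1) → ℝ) → EuclideanSpace ℝ (Fin (k + 2)) :=
    fun z => WithLp.toLp 2 (i.insertNth 1 z) with hF
  have hinsc : Continuous fun q : ℝ × (Fin (k + 1) → ℝ) =>
      (WithLp.toLp 2 (i.insertNth q.1 q.2) : EuclideanSpace ℝ (Fin (k + 2))) := by fun_prop
  have hFm : Measurable F := by
    exact hinsc.measurable.comp (measurable_const.prodMk measurable_id)
  set D : Set (Fin (k + 1) → ℝ) := F ⁻¹' cuspK k α with hD
  have hKm : MeasurableSet (cuspK k α) := (cuspK_closed k α hα).measurableSet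
  have hDm : MeasurableSet D := hFm hKm
  have hDt : ∀ z ∈ D, ∀ l, z l ∈ Set.Icc (0:ℝ) 1 := by
    intro z hz l
    have h := hz
    simp only [hD, Set.mem_preimage, cuspK, Set.mem_ofPred_eq, hF, ins_c, ← hi, ins_i, Real.one_rpow] at h
    exact h.2.2 l
  obtain ⟨L, hL⟩ := insert_lip i (fun _ => (1:ℝ)) D 1 le_rfl
    ((LipschitzWith.const (1:ℝ)).weaken zero_le |>.lipschitzOnWith)
  have himg : {x | x ∈ cuspK k α ∧ x i = 1} ⊆ F '' D := by
    rintro x ⟨hx, hxi⟩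
    have hz : F (fun l => x (i.succAbove l)) = x := by
      simp only [hF, ← hxi]
      ext l
      exact congrFun (Fin.insertNth_self_removeNth i (fun l => x l)) l
    exact ⟨fun l => x (i.succAbove l), by rw [hD, Set.mem_preimage, hz]; exact hx, hz⟩
  obtain ⟨M, hM1, hM⟩ : ∃ M : NNReal, 1 ≤ M ∧ ∀ z ∈ D,
      ‖(WithLp.toLp 2 (i.insertNth 1 (α • z)) : EuclideanSpace ℝ (Fin (k + 2)))‖ₑ ≤ M := by
    have hl := PiLp.lipschitzWith_toLp 2 (fun _ : Fin (k + 2) => ℝ)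
    set C0 : NNReal := (↑(Fintype.card (Fin (k + 2))) ^ (1 / (2:ℝ≥0∞)).toReal)
    refine ⟨max 1 (C0 * α.toNNReal), le_max_left _ _, fun z hz => ?_⟩
    have h := hl (i.insertNth 1 (α • z)) 0
    rw [WithLp.toLp_zero, edist_zero_right, edist_zero_right] at h
    refine h.trans ?_
    have h2 : ‖(i.insertNth 1 (α • z) : Fin (k + 2) → ℝ)‖ₑ ≤ (α.toNNReal : ℝ≥0∞) := by
      rw [← ofReal_norm]
      apply ENNReal.ofReal_le_ofReal
      rw [pi_norm_le_iff_of_nonneg hα0.le]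
      intro l
      rcases Fin.eq_self_or_eq_succAbove i l with h | ⟨l', h⟩
      · subst h; simpa using hα
      · subst h
        simp only [Fin.insertNth_apply_succAbove, Pi.smul_apply, smul_eq_mul]
        have := hDt z hz l'
        rw [Real.norm_of_nonneg (mul_nonneg hα0.le this.1)]
        exact mul_le_of_le_one_right hα0.le this.2
    calc (C0 : ℝ≥0∞) * ‖(i.insertNth 1 (α • z) : Fin (k + 2) → ℝ)‖ₑ ≤ C0 * α.toNNReal := by gcongr
      _ ≤ _ := by rw [← ENNReal.coe_mul]; exact_mod_cast le_max_right _ _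
  set a : ℝ := 1 - 1 / (2 * α) with ha
  set lam : ℝ → ℝ := fun t => (1 - α) + α * t with hlam
  have hlam1 : ∀ t ∈ Set.Icc a 1, 1 / 2 ≤ lam t := by
    intro t ht
    have h1 : α * a ≤ α * t := mul_le_mul_of_nonneg_left ht.1 hα0.le
    have h2 : α * a = α - 1 / 2 := by rw [ha]; field_simp
    simp only [hlam]; linarith
  have ha0 : 0 ≤ a := by
    rw [ha, sub_nonneg, div_le_one (by linarith)]; linarith
  have hlam2 : ∀ t ∈ Set.Icc a 1, lam t ≤ t ^ α := by
    intro t ht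
    have := one_add_mul_self_le_rpow_one_add (s := t - 1) (by linarith [ht.1]) hα
    simp only [hlam]
    calc _ = 1 + α * (t - 1) := by ring
      _ ≤ _ := this
      _ = _ := by congr 1; ring
  refine ⟨L ^ ((k + 1 : ℕ) : ℝ) * ((2 * α).toNNReal * (2 ^ (p - 1) * M ^ p) * 2 ^ (k + 1)), fun u hu => ?_⟩
  have hGm := GG_meas p u hu
  have hum : Measurable u := hu.continuous.measurable
  set H := (cuspK k α).indicator (GG p u) with hH
  have hHm : Measurable H := hGm.indicator hKm
  set B : ℝ≥0∞ := ((2 * α).toNNReal : ℝ≥0∞) * (2 ^ (p - 1) * (M : ℝ≥0∞) ^ p) with hB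
  have hBtop : B ≠ ∞ := by
    refine ENNReal.mul_ne_top ENNReal.coe_ne_top (ENNReal.mul_ne_top ?_ ?_)
    · exact ENNReal.rpow_ne_top_of_nonneg (by linarith) (by simp)
    · exact ENNReal.rpow_ne_top_of_nonneg hp0.le ENNReal.coe_ne_top
  have pointwise : ∀ z ∈ D, ‖u (F z)‖ₑ ^ p * ENNReal.ofReal (F z i ^ α) ≤
      B * ∫⁻ t in Set.Icc a 1, H (WithLp.toLp 2 (i.insertNth t (lam t • z))) := by
    intro z hz
    have hadd : ∀ t : ℝ, (WithLp.toLp 2 (i.insertNth t (lam t • z)) : EuclideanSpace ℝ (Fin (k + 2))) =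
        WithLp.toLp 2 (i.insertNth 0 ((1 - α) • z)) + t • WithLp.toLp 2 (i.insertNth 1 (α • z)) := by
      intro t
      ext l
      rcases Fin.eq_self_or_eq_succAbove i l with h | ⟨l', h⟩
      · subst h; simp
      · subst h; simp [hlam]; ring
    have h := lineE p hp u hu (WithLp.toLp 2 (i.insertNth 0 ((1 - α) • z)))
      (WithLp.toLp 2 (i.insertNth 1 (α • z))) M hM1 (hM z hz) a 1 1 (by linarith)
      ⟨by rw [ha]; linarith [show 0 ≤ 1 / (2 * α) by positivity], le_rfl⟩
    simp only [← hadd] at h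
    have hl1 : lam 1 = 1 := by simp [hlam]
    rw [hl1, one_smul, show 1 - a = 1 / (2 * α) by rw [ha]; ring] at h
    have hw : ENNReal.ofReal (F z i ^ α) = 1 := by simp [hF]
    rw [hw, mul_one]
    have h2 : ‖u (F z)‖ₑ ^ p = ((2 * α).toNNReal : ℝ≥0∞) * (ENNReal.ofReal (1 / (2 * α)) * ‖u (F z)‖ₑ ^ p) := by
      rw [← mul_assoc, ← ENNReal.ofReal, ← ENNReal.ofReal_mul (by positivity), mul_one_div_cancel (by positivity),
        ENNReal.ofReal_one, one_mul]
    rw [h2, hB, mul_assoc]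
    refine mul_le_mul_right (h.trans (mul_le_mul_right ?_ _)) _
    refine setLIntegral_mono' measurableSet_Icc fun t ht => ?_
    rw [hH, Set.indicator_of_mem]
    simp only [cuspK, Set.mem_ofPred_eq, ins_c, ← hi, ins_i]
    refine ⟨ha0.trans ht.1, ht.2, fun l => ?_⟩
    have h3 := hlam1 t ht
    have h4 := hlam2 t ht
    have h5 := hDt z hz l
    simp only [Pi.smul_apply, smul_eq_mul]
    exact ⟨mul_nonneg (by linarith) h5.1, (mul_le_of_le_one_right (by linarith) h5.2).trans h4⟩
  have hm1 : Measurable (Function.uncurry fun (z : Fin (k + 1) → ℝ) (t : ℝ) => H (WithLp.toLp 2 (i.insertNth t (lam t • z)))) := by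
    refine hHm.comp (hinsc.measurable.comp (g := fun q : ℝ × (Fin (k + 1) → ℝ) => _) (f := fun q : (Fin (k + 1) → ℝ) × ℝ => (q.2, lam q.2 • q.1)) ?_)
    apply Continuous.measurable
    fun_prop
  have hm2 : Measurable (Function.uncurry fun (z : Fin (k + 1) → ℝ) (t : ℝ) => H (WithLp.toLp 2 (i.insertNth t z))) :=
    hHm.comp (hinsc.measurable.comp measurable_swap)
  have main : ∫⁻ z, ∫⁻ t in Set.Icc a 1, H (WithLp.toLp 2 (i.insertNth t (lam t • z))) ≤
      2 ^ (k + 1) * ∫⁻ x, H x := by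
    rw [lintegral_lintegral_swap hm1.aemeasurable, lint_insert i H hHm,
      lintegral_lintegral_swap hm2.aemeasurable]
    rw [← lintegral_const_mul' _ _ (by simp)]
    refine (setLIntegral_mono' measurableSet_Icc fun t ht => ?_).trans (setLIntegral_le_lintegral (Set.Icc a 1) _)
    exact lint_scale (lam t) (hlam1 t ht) (fun z => H (WithLp.toLp 2 (i.insertNth t z)))
      (hHm.comp (hinsc.measurable.comp (measurable_const.prodMk measurable_id)))
  calc _ ≤ ∫⁻ x in F '' D, ‖u x‖ₑ ^ p * ENNReal.ofReal (x i ^ α) ∂(μH[((k + 1 : ℕ) : ℝ)]) :=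
        lintegral_mono_set himg
    _ ≤ (L : ℝ≥0∞) ^ ((k + 1 : ℕ) : ℝ) * ∫⁻ z in D, ‖u (F z)‖ₑ ^ p * ENNReal.ofReal (F z i ^ α) :=
        haus_param F hFm D L hL _ (by fun_prop)
    _ ≤ (L : ℝ≥0∞) ^ ((k + 1 : ℕ) : ℝ) * ∫⁻ z in D, B * ∫⁻ t in Set.Icc a 1, H (WithLp.toLp 2 (i.insertNth t (lam t • z))) := by
        refine mul_le_mul_right ?_ _
        exact setLIntegral_mono' hDm pointwise
    _ ≤ (L : ℝ≥0∞) ^ ((k + 1 : ℕ) : ℝ) * ∫⁻ z, B * ∫⁻ t in Set.Icc a 1, H (WithLp.toLp 2 (i.insertNth t (lam t • z))) :=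
        mul_le_mul_right (setLIntegral_le_lintegral _ _) _
    _ ≤ (L : ℝ≥0∞) ^ ((k + 1 : ℕ) : ℝ) * (B * (2 ^ (k + 1) * ∫⁻ x, H x)) := by
        rw [lintegral_const_mul' _ _ hBtop]
        gcongr
    _ = _ := by
        rw [hH, lintegral_indicator hKm, ← mul_assoc B, ← mul_assoc]
        congr 1
        rw [hB]
        push_cast
        rw [ENNReal.coe_rpow_of_nonneg _ (by positivity), ENNReal.coe_rpow_of_nonneg _ (by linarith),
          ENNReal.coe_rpow_of_nonneg _ hp0.le]
        rfl

lemma cover (k : ℕ) (hn : 2 ≤ k + 2) (γ : ℝ) (x : EuclideanSpace ℝ (Fin (k + 2))) (α : ℝ)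
    (hα : α = (γ - 1) / (((k + 2 : ℕ) : ℝ) - 1)) (hα1 : 1 ≤ α)
    (hx : x ∈ cuspK k α) (hx2 : x ∉ cuspDomain (k + 2) hn γ) :
    x (Fin.last (k + 1)) = 1 ∨ ∃ j : Fin (k + 1), x j.castSucc = 0 * x (Fin.last (k + 1)) ^ α ∨
      x j.castSucc = 1 * x (Fin.last (k + 1)) ^ α := by
  by_contra hcon
  push Not at hcon
  obtain ⟨h1, h2⟩ := hcon
  obtain ⟨k1, k2, k3⟩ := hx
  apply hx2
  have ht : 0 < x (Fin.last (k + 1)) := by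
    refine lt_of_le_of_ne k1 fun h => ?_
    have h3 := k3 0
    have h4 := (h2 0).1
    rw [← h, Real.zero_rpow (by linarith)] at h3 h4
    exact h4 (by linarith)
  refine ⟨ht, lt_of_le_of_ne k2 h1, fun l hl => ?_⟩
  obtain ⟨j, rfl⟩ : ∃ j : Fin (k + 1), l = j.castSucc := ⟨⟨l, by omega⟩, rfl⟩
  rw [← hα]
  have h3 := h2 j
  rw [zero_mul, one_mul] at h3
  exact ⟨lt_of_le_of_ne (k3 j).1 (Ne.symm h3.1), lt_of_le_of_ne (k3 j).2 h3.2⟩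

lemma cusp_open (n : ℕ) (hn : 2 ≤ n) (γ : ℝ) (hγ : (n : ℝ) < γ) : IsOpen (cuspDomain n hn γ) := by
  have hn' : (2:ℝ) ≤ n := by exact_mod_cast hn
  have h1 : Continuous fun x : EuclideanSpace ℝ (Fin n) => x ⟨n - 1, by omega⟩ ^ ((γ - 1) / ((n : ℝ) - 1)) :=
    (show Continuous fun x : EuclideanSpace ℝ (Fin n) => x ⟨n - 1, by omega⟩ by fun_prop).rpow_const
      (fun _ => Or.inr (div_nonneg (by linarith) (by linarith)))
  unfold cuspDomain
  simp only [Set.ofPred_and, Set.ofPred_forall]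
  refine IsOpen.inter (isOpen_lt (by fun_prop) (by fun_prop)) (IsOpen.inter
    (isOpen_lt (by fun_prop) (by fun_prop)) (isOpen_iInter_of_finite fun j => isOpen_iInter_of_finite fun _ => IsOpen.inter
    (isOpen_lt (by fun_prop) (by fun_prop)) (isOpen_lt (by fun_prop) h1)))

lemma cusp_sub (k : ℕ) (hn : 2 ≤ k + 2) (γ : ℝ) (α : ℝ)
    (hα : α = (γ - 1) / (((k + 2 : ℕ) : ℝ) - 1)) : cuspDomain (k + 2) hn γ ⊆ cuspK k α := by
  rintro x ⟨h1, h2, h3⟩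
  refine ⟨h1.le, h2.le, fun j => ?_⟩
  have := h3 j.castSucc (by simp; omega)
  rw [← hα] at this
  exact ⟨this.1.le, this.2.le⟩

lemma cusp_null (k : ℕ) (hn : 2 ≤ k + 2) (γ : ℝ) (α : ℝ)
    (hα : α = (γ - 1) / (((k + 2 : ℕ) : ℝ) - 1)) (hα1 : 1 ≤ α) :
    volume (cuspK k α \ cuspDomain (k + 2) hn γ) = 0 := by
  have hs : ∀ (j : Fin (k + 1)) (c : ℝ), volume {x : EuclideanSpace ℝ (Fin (k + 2)) |
      x j.castSucc = c * x (Fin.last (k + 1)) ^ α} = 0 := by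
    intro j c
    have h := graph_null j.castSucc (fun z => c * z (Fin.last k) ^ α) (by fun_prop)
    have hlast : j.castSucc.succAbove (Fin.last k) = Fin.last (k + 1) := by
      rw [Fin.succAbove_of_le_castSucc _ _ (by simpa using Fin.le_last j)]; rfl
    simpa only [hlast] using h
  have ht := graph_null (Fin.last (k + 1)) (fun _ => 1) measurable_const
  refine measure_mono_null (t := {x : EuclideanSpace ℝ (Fin (k + 2)) | x (Fin.last (k + 1)) = 1} ∪
    ⋃ j : Fin (k + 1), ({x | x j.castSucc = 0 * x (Fin.last (k + 1)) ^ α} ∪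
      {x | x j.castSucc = 1 * x (Fin.last (k + 1)) ^ α})) ?_ ?_
  · rintro x ⟨hx, hx2⟩
    rcases cover k hn γ x α hα hα1 hx hx2 with h | ⟨j, h⟩
    · exact Or.inl h
    · exact Or.inr (Set.mem_iUnion.2 ⟨j, h⟩)
  · refine measure_union_null ht (measure_iUnion_null fun j => measure_union_null (hs j 0) (hs j 1))

/-- Trace inequality with the weight `x_n^α`, `α = (γ-1)/(n-1)`:
`W^{1,p}(Ω_γ) → L^p(∂Ω_γ, x_n^α)` is bounded, stated on C¹ functions. -/
theorem trace_inequality_weight_alpha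
    (n : ℕ) (hn : 2 ≤ n) (γ p : ℝ)
    (hγ : (n : ℝ) < γ) (hp1 : 1 < p) (hpn : p < n) :
    ∃ C : ℝ, 0 < C ∧
      ∀ u : EuclideanSpace ℝ (Fin n) → ℝ, ContDiff ℝ 1 u →
        (∫⁻ x in frontier (cuspDomain n hn γ),
            ENNReal.ofReal (|u x| ^ p *
              x ⟨n - 1, by omega⟩ ^ ((γ - 1) / ((n : ℝ) - 1)))
            ∂(μH[(n : ℝ) - 1])) ^ (1 / p)
        ≤ ENNReal.ofReal C *
          ((∫⁻ x in cuspDomain n hn γ, ENNReal.ofReal (‖fderiv ℝ u x‖ ^ p)) ^ (1 / p) +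
           (∫⁻ x in cuspDomain n hn γ, ENNReal.ofReal (|u x| ^ p)) ^ (1 / p)) := by
  obtain ⟨k, rfl⟩ : ∃ k, n = k + 2 := ⟨n - 2, by omega⟩
  have hp0 : 0 < p := by linarith
  set α : ℝ := (γ - 1) / (((k + 2 : ℕ) : ℝ) - 1) with hα
  have hα1 : 1 ≤ α := by
    have : (2:ℝ) ≤ ((k + 2 : ℕ) : ℝ) := by exact_mod_cast hn
    rw [hα, le_div_iff₀ (by linarith)]; linarith
  have hdim : ((k + 2 : ℕ) : ℝ) - 1 = ((k + 1 : ℕ) : ℝ) := by push_cast; ring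
  obtain ⟨A0, hA0⟩ := topF k α p hα1 hp1
  choose A1 hA1 using fun j => side k α p hα1 hp1 j 0 ⟨le_rfl, zero_le_one⟩
  choose A2 hA2 using fun j => side k α p hα1 hp1 j 1 ⟨zero_le_one, le_rfl⟩
  set A : NNReal := A0 + ∑ j, (A1 j + A2 j) with hA
  refine ⟨(A ^ (1 / p) : NNReal) + 1, by positivity, fun u hu => ?_⟩
  have h1 := fun j => hA1 j u hu
  have h2 := fun j => hA2 j u hu
  clear hA1 hA2
  set X := ∫⁻ x in cuspDomain (k + 2) hn γ, ENNReal.ofReal (‖fderiv ℝ u x‖ ^ p) with hX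
  set Y := ∫⁻ x in cuspDomain (k + 2) hn γ, ENNReal.ofReal (|u x| ^ p) with hY
  have hG : ∫⁻ x in cuspK k α, GG p u x = X + Y := by
    have : (cuspK k α : Set _) =ᵐ[volume] cuspDomain (k + 2) hn γ := by
      refine (ae_eq_set.2 ⟨cusp_null k hn γ α hα hα1, ?_⟩)
      rw [Set.sdiff_eq_empty.2 (cusp_sub k hn γ α hα), measure_empty]
    rw [setLIntegral_congr this, add_comm X Y, hX, hY, ← lintegral_add_left]
    · refine lintegral_congr fun x => ?_
      unfold GG
      rw [← ofReal_norm, ← ofReal_norm, ENNReal.ofReal_rpow_of_nonneg (norm_nonneg _) hp0.le,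
        ENNReal.ofReal_rpow_of_nonneg (norm_nonneg _) hp0.le, Real.norm_eq_abs]
    · have := hu.continuous.measurable
      exact ((measurable_norm.comp this).pow_const p).ennreal_ofReal
  have hfr : frontier (cuspDomain (k + 2) hn γ) ⊆
      {x | x ∈ cuspK k α ∧ x (Fin.last (k + 1)) = 1} ∪
      ⋃ j : Fin (k + 1), ({x | x ∈ cuspK k α ∧ x j.castSucc = 0 * x (Fin.last (k + 1)) ^ α} ∪
        {x | x ∈ cuspK k α ∧ x j.castSucc = 1 * x (Fin.last (k + 1)) ^ α}) := by
    intro x hx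
    rw [(cusp_open (k + 2) hn γ hγ).frontier_eq] at hx
    have hxK : x ∈ cuspK k α :=
      closure_minimal (cusp_sub k hn γ α hα) (cuspK_closed k α hα1) hx.1
    rcases cover k hn γ x α hα hα1 hxK hx.2 with h | ⟨j, h | h⟩
    · exact Or.inl ⟨hxK, h⟩
    · exact Or.inr (Set.mem_iUnion.2 ⟨j, Or.inl ⟨hxK, h⟩⟩)
    · exact Or.inr (Set.mem_iUnion.2 ⟨j, Or.inr ⟨hxK, h⟩⟩)
  have hmain : ∫⁻ x in frontier (cuspDomain (k + 2) hn γ),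
            ENNReal.ofReal (|u x| ^ p * x (Fin.last (k + 1)) ^ α) ∂(μH[((k + 2 : ℕ) : ℝ) - 1]) ≤ A * (X + Y) := by
    rw [hdim, ← hG]
    have hcg : ∀ x : EuclideanSpace ℝ (Fin (k + 2)), ENNReal.ofReal (|u x| ^ p * x (Fin.last (k + 1)) ^ α) =
        ‖u x‖ₑ ^ p * ENNReal.ofReal (x (Fin.last (k + 1)) ^ α) := by
      intro x
      rw [ENNReal.ofReal_mul (by positivity), ← ofReal_norm,
        ENNReal.ofReal_rpow_of_nonneg (norm_nonneg _) hp0.le, Real.norm_eq_abs]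
    simp only [hcg]
    refine (lintegral_mono_set hfr).trans ?_
    refine (lintegral_union_le _ _ _).trans ?_
    rw [hA, ENNReal.coe_add, ENNReal.coe_finsetSum, add_mul, Finset.sum_mul]
    refine add_le_add (hA0 u hu) ?_
    refine (lintegral_iUnion_le _ _).trans ?_
    rw [tsum_fintype]
    refine Finset.sum_le_sum fun j _ => ?_
    refine (lintegral_union_le _ _ _).trans ?_
    rw [ENNReal.coe_add, add_mul]
    exact add_le_add (h1 j) (h2 j)
  have h1p : 1 / p ≤ 1 := by rw [div_le_one hp0]; exact hp1.le
  have h0p : 0 ≤ 1 / p := by positivity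
  calc _ ≤ ((A : ℝ≥0∞) * (X + Y)) ^ (1 / p) := ENNReal.rpow_le_rpow hmain h0p
    _ = (A : ℝ≥0∞) ^ (1 / p) * (X + Y) ^ (1 / p) := ENNReal.mul_rpow_of_nonneg _ _ h0p
    _ ≤ _ := by
      refine mul_le_mul' ?_ (ENNReal.rpow_add_le_add_rpow _ _ h0p h1p)
      rw [← ENNReal.coe_rpow_of_nonneg _ h0p, ← ENNReal.ofReal_coe_nnreal]
      exact ENNReal.ofReal_le_ofReal (by linarith)
end
end
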